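/- Let d ≥ 4 and c ∈ (1, 1+c₃(d)) with c₃(d) = 2h(d)/(1−h(d)) if 4 ≤ d ≤ 11, c₃(d) = 2k(d)/(1−k(d)) if d even, d ≥ 12, c₃(d) = 2l(d)/(1−l(d)) if d odd, d ≥ 12, and let θ(d,c) = ((1+c)/2)(1−h(d)) for 4 ≤ d ≤ 11, ((1+c)/2)(1−k(d)) for even d ≥ 12, ((1+c)/2)(1−l(d)) for odd d ≥ 12. Let Δψ(t) = ψ(−(t+1)^{1/c}) − ψ(−t^{1/c}), where ψ(u) = u − ⌊u⌋ − 1/2. Then uniformly in θ ∈ [0,1), for all y ≥ 2, ∑_{y<m≤2y} e(m^d θ) Δψ(m) ≪ y^{θ(d,c)/c + ε}. -/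

import Mathlib

open scoped BigOperators Classical
open Real

noncomputable section

/-- `e(t) = e^{2πit}`. -/
def eC (t : ℝ) : ℂ := Complex.exp (2 * Real.pi * Complex.I * t)

/-- The Piatetski-Shapiro set `ℕ^c = {⌊n^c⌋ : n ∈ ℕ}`. -/
def PS (c : ℝ) : Set ℕ := {m | ∃ n : ℕ, 0 < n ∧ m = ⌊(n : ℝ) ^ c⌋₊}

/-- The Fourier transform `f̂(α) = ∑_{n ∈ ℤ} f(n) e(αn)` of a finitely
supported function on `ℤ`. -/
def FT (f : ℤ → ℂ) (α : ℝ) : ℂ := ∑ᶠ n : ℤ, f n * eC (α * n)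

/-- `w = (1/2) log log x`. -/
def wps (x : ℕ) : ℝ := Real.log (Real.log x) / 2

/-- `W = 4 d³ ∏_{p ≤ w} p`. -/
def Wps (d x : ℕ) : ℕ :=
  4 * d ^ 3 * ∏ p ∈ Finset.filter Nat.Prime (Finset.Iic ⌊wps x⌋₊), p

/-- `σ(b) = #{z ∈ [W] : z^d ≡ -b (mod W)}`. -/
def sigmaPS (d W b : ℕ) : ℕ :=
  ((Finset.Icc 1 W).filter fun z => (z ^ d + b) % W = 0).card

/-- `N = ⌊x^d / W⌋ + 1`. -/
def Nps (d x : ℕ) : ℕ := ⌊(x : ℝ) ^ d / (Wps d x : ℝ)⌋₊ + 1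

/-- `b ∈ [W]` and `-b ∈ (ℤ/Wℤ)^{×d}`. -/
def bSpec (d x b : ℕ) : Prop :=
  b ∈ Finset.Icc 1 (Wps d x) ∧
    ∃ z : (ZMod (Wps d x))ˣ, (z : ZMod (Wps d x)) ^ d = -(b : ZMod (Wps d x))

/-- `S(d) = 2⌊d²/2⌋`. -/
def Sd (d : ℕ) : ℕ := 2 * (d ^ 2 / 2)

def hD (d : ℕ) : ℝ := 1 / ((d : ℝ) * ((d : ℝ) + 1) ^ 2 - 1)
def kD (d : ℕ) : ℝ := 2 / (27 * (d : ℝ) ^ 2 - 14)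
def lD (d : ℕ) : ℝ := 2 / (27 * (d : ℝ) ^ 2 - 5)

/-- `θ(d, c)`. -/
def θdc (d : ℕ) (c : ℝ) : ℝ :=
  if d = 2 then (4 * c + 7) / 13
  else if d = 3 then (15 * c + 14) / 30
  else if d ≤ 11 then (1 + c) / 2 * (1 - hD d)
  else if 2 ∣ d then (1 + c) / 2 * (1 - kD d)
  else (1 + c) / 2 * (1 - lD d)

/-- `c₂(d)`. -/
def c2ps (d : ℕ) : ℝ :=
  if d = 2 then 1 / 54
  else if d = 3 then 1 / 495
  else if d ≤ 11 then 2 * hD d / (4 * (Sd d : ℝ) + 1 - hD d)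
  else if 2 ∣ d then 2 * kD d / (4 * (Sd d : ℝ) + 1 - kD d)
  else 2 * lD d / (4 * (Sd d : ℝ) + 1 - lD d)

/-- The majorant `ν = ν_b` from the density transfer lemma, characterized by
its defining property. -/
def nuSpec (d x : ℕ) (c : ℝ) (b : ℕ) (ν : ℤ → ℝ) : Prop :=
  (∀ n : ℤ, ∀ p : ℕ, p.Prime → p ∈ PS c → p ≤ x →
      (Wps d x : ℤ) * n - (b : ℤ) = (p : ℤ) ^ d →
      ν n = c * (Nat.totient (Wps d x) : ℝ) /
          ((sigmaPS d (Wps d x) b : ℝ) * (Wps d x : ℝ)) *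
          (p : ℝ) ^ ((d : ℝ) - 1 / c) * Real.log p) ∧
  (∀ n : ℤ, (¬ ∃ p : ℕ, p.Prime ∧ p ∈ PS c ∧ p ≤ x ∧
      (Wps d x : ℤ) * n - (b : ℤ) = (p : ℤ) ^ d) → ν n = 0)

/-- The majorant `τ`, characterized by its defining property. -/
def tauSpec (d x : ℕ) (c : ℝ) (b : ℕ) (τ : ℤ → ℝ) : Prop :=
  (∀ n : ℤ, ∀ m : ℕ, m ∈ PS c → m ≤ x →
      (Wps d x : ℤ) * n - (b : ℤ) = (m : ℤ) ^ d →
      τ n = c / (sigmaPS d (Wps d x) b : ℝ) * (m : ℝ) ^ ((d : ℝ) - 1 / c)) ∧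
  (∀ n : ℤ, (¬ ∃ m : ℕ, m ∈ PS c ∧ m ≤ x ∧
      (Wps d x : ℤ) * n - (b : ℤ) = (m : ℤ) ^ d) → τ n = 0)

/-- The function `μ`, characterized by its defining property. -/
def muSpec (d x : ℕ) (b : ℕ) (μ : ℤ → ℝ) : Prop :=
  (∀ n : ℤ, ∀ m : ℕ, 1 ≤ m → m ≤ x →
      (Wps d x : ℤ) * n - (b : ℤ) = (m : ℤ) ^ d →
      μ n = (m : ℝ) ^ (d - 1) / (sigmaPS d (Wps d x) b : ℝ)) ∧
  (∀ n : ℤ, (¬ ∃ m : ℕ, 1 ≤ m ∧ m ≤ x ∧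
      (Wps d x : ℤ) * n - (b : ℤ) = (m : ℤ) ^ d) → μ n = 0)

/-- `c₃(d)` (for `d ≥ 4`). -/
def c3ps (d : ℕ) : ℝ :=
  if d ≤ 11 then 2 * hD d / (1 - hD d)
  else if 2 ∣ d then 2 * kD d / (1 - kD d)
  else 2 * lD d / (1 - lD d)

/-- `ψ(u) = u − ⌊u⌋ − 1/2`. -/
def psiSaw (u : ℝ) : ℝ := u - ⌊u⌋ - 1 / 2

/-- `Δψ(t) = ψ(−(t+1)^{1/c}) − ψ(−t^{1/c})`. -/
def deltaPsi (c t : ℝ) : ℝ := psiSaw (-((t + 1) ^ (1 / c))) - psiSaw (-(t ^ (1 / c)))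

open Polynomial in
/-- normalized antiderivative -/
def AD (K : ℕ) (Q : Polynomial ℤ) : Polynomial ℤ :=
  ∑ i ∈ Finset.range K, monomial (i+1) (((K.factorial / (i+1) : ℕ) : ℤ) * Q.coeff i)

open Polynomial in
lemma AD_Cmul (K : ℕ) (c : ℤ) (Q : Polynomial ℤ) : AD K (C c * Q) = C c * AD K Q := by
  unfold AD
  rw [Finset.mul_sum]
  refine Finset.sum_congr rfl fun i _ => ?_
  rw [C_mul_monomial, coeff_C_mul]; congr 1; ring

open Polynomial in
lemma AD_add (K : ℕ) (P Q : Polynomial ℤ) : AD K (P + Q) = AD K P + AD K Q := by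
  unfold AD
  rw [← Finset.sum_add_distrib]
  refine Finset.sum_congr rfl fun i _ => ?_
  rw [← map_add, coeff_add]; congr 1; ring

lemma AD_zero (K : ℕ) : AD K 0 = 0 := by
  unfold AD; simp

lemma AD_sum {ι : Type*} (K : ℕ) (s : Finset ι) (f : ι → Polynomial ℤ) :
    AD K (∑ i ∈ s, f i) = ∑ i ∈ s, AD K (f i) := by
  induction s using Finset.induction_on with
  | empty => simp [AD_zero]
  | insert a s ha ih => rw [Finset.sum_insert ha, Finset.sum_insert ha, AD_add, ih]

open Polynomial in
lemma AD_deriv (K : ℕ) (Q : Polynomial ℤ) (h : Q.natDegree < K) :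
    derivative (AD K Q) = C (K.factorial : ℤ) * Q := by
  unfold AD
  rw [derivative_sum]
  conv_rhs => rw [Q.as_sum_range' K h, Finset.mul_sum]
  refine Finset.sum_congr rfl fun i hi => ?_
  rw [derivative_monomial, C_mul_monomial]
  have : (i+1) ∣ K.factorial := Nat.dvd_factorial (by omega) (by have := Finset.mem_range.1 hi; omega)
  obtain ⟨t, ht⟩ := this
  have h2 : K.factorial / (i+1) = t := by rw [ht]; exact Nat.mul_div_cancel_left _ (by omega)
  rw [h2, ht]; simp only [Nat.add_sub_cancel]; congr 1; push_cast; ring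

open Polynomial in
lemma AD_eval_zero (K : ℕ) (Q : Polynomial ℤ) : (AD K Q).eval 0 = 0 := by
  unfold AD
  rw [eval_finsetSum]
  refine Finset.sum_eq_zero fun i _ => ?_
  simp [eval_monomial]

open Polynomial in
lemma AD_shift (K : ℕ) (Q : Polynomial ℤ) (h : Q.natDegree < K) (ξ a u : ℤ) :
    (AD K Q).eval (ξ + a * u) = (AD K Q).eval ξ + a * (AD K (Q.comp (C ξ + C a * X))).eval u := by
  set L : Polynomial ℤ := C ξ + C a * X with hL
  have hLd : L.natDegree ≤ 1 := by
    rw [hL]; compute_degree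
  have hd : (Q.comp L).natDegree < K := by
    refine lt_of_le_of_lt natDegree_comp_le ?_
    calc Q.natDegree * L.natDegree ≤ Q.natDegree * 1 := Nat.mul_le_mul_left _ hLd
      _ < K := by omega
  set D := (AD K Q).comp L - (C ((AD K Q).eval ξ) + C a * AD K (Q.comp L)) with hD
  have h1 : derivative D = 0 := by
    rw [hD, derivative_sub, derivative_add, derivative_comp, derivative_C, derivative_C_mul,
      AD_deriv K _ hd, AD_deriv K _ h]
    have : derivative L = C a := by simp [hL]
    rw [this]; simp only [mul_comp, C_comp]; ring
  have h2 : D.natDegree = 0 := Polynomial.derivative_eq_zero.1 h1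
  have h3 := eq_C_of_natDegree_eq_zero h2
  have h4 : D.eval 0 = 0 := by
    rw [hD]; simp [eval_comp, AD_eval_zero, hL]
  have h5 : D.eval u = 0 := by
    rw [h3] at h4 ⊢; simpa using h4
  have hLu : L.eval u = ξ + a * u := by simp [hL]
  rw [hD, eval_sub, eval_comp, hLu, eval_add, eval_C, eval_mul, eval_C] at h5
  linarith

open Polynomial in
lemma AD_vanish (K : ℕ) (R : Polynomial ℤ) (e : ℕ) (η P y : ℤ)
    (h : ((X - C η)^e * R).natDegree < K) (hy : P ∣ y - η) :
    P^(e+1) ∣ (AD K ((X - C η)^e * R)).eval y - (AD K ((X - C η)^e * R)).eval η := by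
  obtain ⟨u, hu⟩ := hy
  have : y = η + P * u := by linarith
  rw [this, AD_shift K _ h]
  have h2 : ((X - C η)^e * R).comp (C η + C P * X) = C (P^e) * (X^e * R.comp (C η + C P * X)) := by
    simp only [mul_comp, pow_comp, sub_comp, X_comp, C_comp]
    rw [C_pow]; ring
  rw [h2, AD_Cmul]
  refine ⟨(AD K (X^e * R.comp (C η + C P * X))).eval u, ?_⟩
  simp; ring

open Polynomial in
/-- nonvanishing constant mod p -/
def IsU (p : ℕ) (W : Polynomial ℤ) : Prop :=
  ∃ (c : ℤ) (V : Polynomial ℤ), ¬ ((p:ℤ) ∣ c) ∧ W = C c + C (p:ℤ) * V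

open Polynomial in
lemma IsU.mul {p : ℕ} (hp : p.Prime) {W W' : Polynomial ℤ} (h : IsU p W) (h' : IsU p W') :
    IsU p (W * W') := by
  obtain ⟨c, V, hc, rfl⟩ := h
  obtain ⟨c', V', hc', rfl⟩ := h'
  refine ⟨c * c', V * C c' + C c * V' + C (p:ℤ) * V * V', ?_, ?_⟩
  · intro hh
    rcases (Nat.prime_iff_prime_int.1 hp).dvd_or_dvd hh with h | h
    · exact hc h
    · exact hc' h
  · rw [C_mul]; ring

open Polynomial in
lemma IsU.one {p : ℕ} (hp : p.Prime) : IsU p 1 := by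
  refine ⟨1, 0, ?_, by simp⟩
  intro h
  exact (Nat.prime_iff_prime_int.1 hp).not_isUnit (isUnit_of_dvd_one h)

lemma IsU.pow {p : ℕ} (hp : p.Prime) {W : Polynomial ℤ} (h : IsU p W) (n : ℕ) : IsU p (W^n) := by
  induction n with
  | zero => simpa using IsU.one hp
  | succ n ih => rw [pow_succ]; exact ih.mul hp h

open Polynomial in
lemma IsU.comp {p : ℕ} {W : Polynomial ℤ} (h : IsU p W) (L : Polynomial ℤ) : IsU p (W.comp L) := by
  obtain ⟨c, V, hc, rfl⟩ := h
  exact ⟨c, V.comp L, hc, by simp⟩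

open Polynomial in
lemma AD_inj (p K : ℕ) (hp : p.Prime) (hK : 1 ≤ K) (hpK : K < p) (W : Polynomial ℤ) (h : IsU p W)
    (m : ℕ) (x y : ℤ) (hxy : (p:ℤ)^m ∣ (AD K W).eval x - (AD K W).eval y) : (p:ℤ)^m ∣ x - y := by
  obtain ⟨c, V, hc, rfl⟩ := h
  rw [AD_add, AD_Cmul] at hxy
  have hC : AD K (C c) = C ((K.factorial : ℤ) * c) * X := by
    unfold AD
    rw [Finset.sum_eq_single_of_mem 0 (Finset.mem_range.2 hK)]
    · simp [← C_mul_X_eq_monomial]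
    · intro b _ hb
      rw [coeff_C_of_ne_zero hb]; simp
  rw [hC] at hxy
  obtain ⟨t, ht⟩ := Polynomial.sub_dvd_eval_sub x y (AD K V)
  have h2 : (p:ℤ)^m ∣ ((K.factorial : ℤ) * c + p * t) * (x - y) := by
    convert hxy using 1
    simp only [eval_add, eval_mul, eval_C, eval_X]
    linear_combination (-(p:ℤ)) * ht
  have hcop : IsCoprime ((p:ℤ)^m) ((K.factorial : ℤ) * c + p * t) := by
    apply IsCoprime.pow_left
    rw [Prime.coprime_iff_not_dvd (Nat.prime_iff_prime_int.1 hp)]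
    intro hh
    have : (p:ℤ) ∣ (K.factorial : ℤ) * c := by
      have := dvd_sub hh (Dvd.intro t rfl : (p:ℤ) ∣ p * t)
      simpa using this
    rcases (Nat.prime_iff_prime_int.1 hp).dvd_or_dvd this with h | h
    · have := (Nat.Prime.dvd_factorial hp).1 (by exact_mod_cast h); omega
    · exact hc h
  exact hcop.dvd_of_dvd_mul_left h2

/-- weighted finite data -/
structure Dat where
  S : Finset ℤ
  u : ℤ → ℤ
  c : ℤ → ℂ

def ee (p N : ℕ) [Fact p.Prime] : AddChar (ZMod (p^N)) ℂ := ZMod.stdAddChar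

open Polynomial in
def Ph (K p N k : ℕ) (W : Polynomial ℤ) (β : Fin k → ZMod (p^N)) (x : ℤ) : ZMod (p^N) :=
  ∑ j : Fin k, β j * (((AD K (W * X^(j:ℕ))).eval x : ℤ) : ZMod (p^N))

def ff (K p N k : ℕ) [Fact p.Prime] (W : Polynomial ℤ) (D : Dat) (ξ : ℤ) (a : ℕ)
    (β : Fin k → ZMod (p^N)) : ℂ :=
  ∑ x ∈ D.S.filter (fun x => (p:ℤ)^a ∣ D.u x - ξ), D.c x * ee p N (Ph K p N k W β (D.u x))

def InW (K p l : ℕ) (W : Polynomial ℤ) : Prop := W.natDegree ≤ K - l ∧ IsU p W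

def qq (l : ℕ) : ℕ := l * (l+1)
def hh (l : ℕ) : ℕ := l * (l+1) / 2 - 1

def Dec (K p l m : ℕ) [Fact p.Prime] (B : ℝ) : Prop :=
  ∀ (W : Polynomial ℤ), InW K p l W → ∀ D : Dat,
    ∑ β, ‖ff K p (l*m) l W D 0 0 β‖^(qq l) ≤
      B * (p:ℝ)^(m * hh l) * ∑ r ∈ Finset.range (p^m), ∑ β, ‖ff K p (l*m) l W D (r:ℤ) m β‖^(qq l)

lemma ee_norm (p N : ℕ) [Fact p.Prime] (z : ZMod (p^N)) : ‖ee p N z‖ = 1 :=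
  AddChar.norm_apply _ _

lemma ee_lift (p N M : ℕ) [Fact p.Prime] (h : M ≤ N) (z : ℤ) :
    ee p N (((p:ℤ)^(N-M) * z : ℤ) : ZMod (p^N)) = ee p M ((z : ℤ) : ZMod (p^M)) := by
  unfold ee
  rw [ZMod.stdAddChar_coe, ZMod.stdAddChar_coe]
  congr 1
  have hp : (p:ℂ) ≠ 0 := by exact_mod_cast (Fact.out : p.Prime).ne_zero
  have : (p:ℂ)^N = p^(N-M) * p^M := by rw [← pow_add]; congr 1; omega
  push_cast
  rw [this]; field_simp

lemma Ph_add (K p N k : ℕ) (W : Polynomial ℤ) (β β' : Fin k → ZMod (p^N)) (x : ℤ) :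
    Ph K p N k W (β + β') x = Ph K p N k W β x + Ph K p N k W β' x := by
  unfold Ph
  rw [← Finset.sum_add_distrib]
  refine Finset.sum_congr rfl fun j _ => ?_
  rw [Pi.add_apply]; ring

open Polynomial in
def sh (p N M k l : ℕ) (η ξ : ℤ) (a : ℕ) (γ : Fin l → ZMod (p^M)) : Fin k → ZMod (p^N) :=
  fun j => ∑ i : Fin l, (((p:ℤ)^(N-M-((i:ℕ)+1)*a) * ((γ i).val : ℤ) *
    ((X - C η)^(k-l) * (X - C ξ)^(i:ℕ)).coeff j : ℤ) : ZMod (p^N))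

open Polynomial in
lemma AD_expand (K k : ℕ) (W R : Polynomial ℤ) (h : R.natDegree < k) :
    AD K (W * R) = ∑ j : Fin k, C (R.coeff j) * AD K (W * X^(j:ℕ)) := by
  conv_lhs => rw [R.as_sum_range' k h, Finset.mul_sum, AD_sum]
  rw [Finset.sum_range]
  refine Finset.sum_congr rfl fun j _ => ?_
  rw [← AD_Cmul, ← C_mul_X_pow_eq_monomial]; congr 1; ring

open Polynomial in
lemma natDeg_aux (k l : ℕ) (h : l ≤ k) (i : ℕ) (hi : i < l) (η ξ : ℤ) :
    ((X - C η)^(k-l) * (X - C ξ)^i : Polynomial ℤ).natDegree < k := by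
  have : ((X - C η)^(k-l) * (X - C ξ)^i : Polynomial ℤ).natDegree ≤ (k-l) + i := by
    refine natDegree_mul_le.trans ?_
    rw [natDegree_pow, natDegree_pow, natDegree_X_sub_C, natDegree_X_sub_C]; omega
  omega

open Polynomial in
lemma Ph_sh (K p N M k l : ℕ) (hlk : l ≤ k) (W : Polynomial ℤ) (η ξ : ℤ) (a : ℕ)
    (γ : Fin l → ZMod (p^M)) (x : ℤ) :
    Ph K p N k W (sh p N M k l η ξ a γ) x =
    ((∑ i : Fin l, (p:ℤ)^(N-M-((i:ℕ)+1)*a) * ((γ i).val : ℤ) *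
      (AD K (W * ((X - C η)^(k-l) * (X - C ξ)^(i:ℕ)))).eval x : ℤ) : ZMod (p^N)) := by
  unfold Ph sh
  simp_rw [Finset.sum_mul]
  rw [Finset.sum_comm]
  push_cast
  refine Finset.sum_congr rfl fun i _ => ?_
  rw [AD_expand K k W _ (natDeg_aux k l hlk i i.2 η ξ), eval_finsetSum]
  push_cast
  rw [Finset.mul_sum]
  refine Finset.sum_congr rfl fun j _ => ?_
  rw [eval_mul, eval_C]; push_cast; ring

/-- the key norm identity for shifted frequencies and constants -/
lemma norm_ff_const (K p N k : ℕ) [Fact p.Prime] (W : Polynomial ℤ) (D : Dat) (ξ : ℤ) (a : ℕ)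
    (β σ : Fin k → ZMod (p^N)) (z : ZMod (p^N))
    (h : ∀ x, (p:ℤ)^a ∣ x - ξ → Ph K p N k W σ x = z) :
    ‖ff K p N k W D ξ a (β + σ)‖ = ‖ff K p N k W D ξ a β‖ := by
  have : ff K p N k W D ξ a (β + σ) = ee p N z * ff K p N k W D ξ a β := by
    unfold ff
    rw [Finset.mul_sum]
    refine Finset.sum_congr rfl fun x hx => ?_
    rw [Ph_add, AddChar.map_add_eq_mul, h _ (Finset.mem_filter.1 hx).2]; ring
  rw [this, norm_mul, ee_norm, one_mul]

open Polynomial in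
lemma natDeg_aux2 (K k l : ℕ) (hl : l ≤ k) (hkK : k ≤ K) (i : ℕ) (hi : i < l) (η ξ : ℤ)
    (W : Polynomial ℤ) (hW : W.natDegree ≤ K - k) :
    (W * ((X - C η)^(k-l) * (X - C ξ)^i) : Polynomial ℤ).natDegree < K := by
  have := natDeg_aux k l hl i hi η ξ
  have h2 := natDegree_mul_le (p := W) (q := ((X - C η)^(k-l) * (X - C ξ)^i))
  omega

open Polynomial in
lemma norm_ff_inv (K p N k l m : ℕ) [Fact p.Prime] (hlk : l ≤ k) (hkK : k ≤ K) (W : Polynomial ℤ)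
    (hW : W.natDegree ≤ K - k) (D : Dat) (η ξ : ℤ) (a b : ℕ)
    (hN : l * (m + a) ≤ N) (hb : l * (m + a) ≤ (k - l + 1) * b)
    (β : Fin k → ZMod (p^N)) (γ : Fin l → ZMod (p^(l*m))) :
    ‖ff K p N k W D η b (β + sh p N (l*m) k l η ξ a γ)‖ = ‖ff K p N k W D η b β‖ := by
  apply norm_ff_const K p N k W D η b β _ (Ph K p N k W (sh p N (l*m) k l η ξ a γ) η)
  intro x hx
  rw [Ph_sh _ _ _ _ _ _ hlk, Ph_sh _ _ _ _ _ _ hlk]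
  rw [ZMod.intCast_eq_intCast_iff_dvd_sub, ← Finset.sum_sub_distrib]
  push_cast
  refine Finset.dvd_sum fun i _ => ?_
  rw [← mul_sub]
  have hi := i.2
  have hle : ((i:ℕ)+1) * a ≤ l * a := Nat.mul_le_mul_right _ hi
  have e1 : W * ((X - C η)^(k-l) * (X - C ξ)^(i:ℕ)) = (X - C η)^(k-l) * (W * (X - C ξ)^(i:ℕ)) := by ring
  have hd := natDeg_aux2 K k l hlk hkK i i.2 η ξ W hW
  rw [e1] at hd ⊢
  have hv := AD_vanish K _ (k-l) η ((p:ℤ)^b) x hd hx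
  rw [← pow_mul] at hv
  have hv2 := dvd_neg.2 hv
  rw [neg_sub] at hv2
  have : (p:ℤ)^N ∣ (p:ℤ)^(N-l*m-((i:ℕ)+1)*a) * (p:ℤ)^(b*(k-l+1)) := by
    rw [← pow_add]; apply pow_dvd_pow
    rw [mul_add] at hN hb
    rw [mul_comm b]
    omega
  refine this.trans ?_
  rw [mul_assoc]
  exact mul_dvd_mul_left _ (Dvd.dvd.mul_left hv2 _)

open Polynomial in
def Wt (p k l : ℕ) (W : Polynomial ℤ) (η ξ : ℤ) (a : ℕ) : Polynomial ℤ :=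
  W.comp (C ξ + C ((p:ℤ)^a) * X) * (C (ξ - η) + C ((p:ℤ)^a) * X)^(k-l)

open Polynomial in
lemma Wt_inW (K p k l : ℕ) (hp : p.Prime) (hlk : l ≤ k) (hkK : k ≤ K) (W : Polynomial ℤ)
    (hW : InW K p k W) (η ξ : ℤ) (a : ℕ) (h : l = k ∨ (1 ≤ a ∧ ¬ (p:ℤ) ∣ ξ - η)) :
    InW K p l (Wt p k l W η ξ a) := by
  refine ⟨?_, ?_⟩
  · have h1 : (W.comp (C ξ + C ((p:ℤ)^a) * X)).natDegree ≤ W.natDegree := by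
      refine natDegree_comp_le.trans ?_
      have : (C ξ + C ((p:ℤ)^a) * X : Polynomial ℤ).natDegree ≤ 1 := by compute_degree
      calc _ ≤ W.natDegree * 1 := Nat.mul_le_mul_left _ this
        _ = _ := mul_one _
    have h2 : ((C (ξ - η) + C ((p:ℤ)^a) * X)^(k-l) : Polynomial ℤ).natDegree ≤ k - l := by
      refine natDegree_pow_le.trans ?_
      have : (C (ξ-η) + C ((p:ℤ)^a) * X : Polynomial ℤ).natDegree ≤ 1 := by compute_degree
      calc _ ≤ (k-l) * 1 := Nat.mul_le_mul_left _ this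
        _ = _ := mul_one _
    have h3 := hW.1
    unfold Wt
    refine natDegree_mul_le.trans ?_
    omega
  · refine (hW.2.comp _).mul hp ?_
    rcases h with h | ⟨ha, h⟩
    · subst h; simpa using IsU.one hp
    · refine IsU.pow hp ⟨ξ - η, C ((p:ℤ)^(a-1)) * X, h, ?_⟩ _
      rw [← mul_assoc, ← C_mul, ← pow_succ']
      congr 4; omega

open Polynomial in
lemma Ph_sh_rescale (K p N k l m : ℕ) [Fact p.Prime] (hlk : l ≤ k) (hkK : k ≤ K) (W : Polynomial ℤ)
    (hW : W.natDegree ≤ K - k) (η ξ : ℤ) (a : ℕ)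
    (hN : l * (m + a) ≤ N) (γ : Fin l → ZMod (p^(l*m))) (u : ℤ) :
    ee p N (Ph K p N k W (sh p N (l*m) k l η ξ a γ) (ξ + (p:ℤ)^a * u)) =
    ee p N (Ph K p N k W (sh p N (l*m) k l η ξ a γ) ξ) *
      ee p (l*m) (Ph K p (l*m) l (Wt p k l W η ξ a) γ u) := by
  have key : Ph K p N k W (sh p N (l*m) k l η ξ a γ) (ξ + (p:ℤ)^a * u) =
     Ph K p N k W (sh p N (l*m) k l η ξ a γ) ξ +
     (((p:ℤ)^(N-l*m) * (∑ i : Fin l, ((γ i).val : ℤ) * (AD K (Wt p k l W η ξ a * X^(i:ℕ))).eval u) : ℤ) : ZMod (p^N)) := by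
    rw [Ph_sh _ _ _ _ _ _ hlk, Ph_sh _ _ _ _ _ _ hlk, ← Int.cast_add]
    congr 1
    rw [Finset.mul_sum, ← Finset.sum_add_distrib]
    refine Finset.sum_congr rfl fun i _ => ?_
    rw [AD_shift K _ (natDeg_aux2 K k l hlk hkK i i.2 η ξ W hW)]
    have e1 : (W * ((X - C η)^(k-l) * (X - C ξ)^(i:ℕ))).comp (C ξ + C ((p:ℤ)^a) * X)
       = C ((p:ℤ)^(a*i)) * (Wt p k l W η ξ a * X^(i:ℕ)) := by
      unfold Wt
      simp only [mul_comp, pow_comp, sub_comp, X_comp, C_comp]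
      have e2 : (C ξ + C ((p:ℤ)^a) * X - C ξ : Polynomial ℤ) = C ((p:ℤ)^a) * X := by ring
      have e3 : (C ξ + C ((p:ℤ)^a) * X - C η : Polynomial ℤ) = C (ξ - η) + C ((p:ℤ)^a) * X := by
        rw [C_sub]; ring
      rw [e2, e3, mul_pow, ← C_pow, ← pow_mul]; ring
    rw [e1, AD_Cmul, eval_mul, eval_C]
    have hle : ((i:ℕ)+1) * a ≤ l * a := Nat.mul_le_mul_right _ i.2
    have e4 : (p:ℤ)^(N-l*m) = (p:ℤ)^(N-l*m-((i:ℕ)+1)*a) * ((p:ℤ)^a * (p:ℤ)^(a*i)) := by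
      rw [← pow_add, ← pow_add]; congr 1
      rw [mul_add] at hN
      have : a + a * (i:ℕ) = ((i:ℕ)+1)*a := by ring
      omega
    rw [e4]; ring
  have hM : l*m ≤ N := le_trans (Nat.mul_le_mul_left _ (by omega)) hN
  rw [key, AddChar.map_add_eq_mul, ee_lift p N (l*m) hM]
  congr 2
  unfold Ph
  push_cast
  refine Finset.sum_congr rfl fun i _ => ?_
  rw [ZMod.natCast_zmod_val]

def Dt (K p N k : ℕ) [Fact p.Prime] (W : Polynomial ℤ) (D : Dat) (ξ : ℤ) (a : ℕ) (β : Fin k → ZMod (p^N)) : Dat :=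
  ⟨D.S.filter (fun x => (p:ℤ)^a ∣ D.u x - ξ), fun x => (D.u x - ξ) / (p:ℤ)^a,
   fun x => D.c x * ee p N (Ph K p N k W β (D.u x))⟩

lemma norm_ff_rescale (K p N k l m : ℕ) [Fact p.Prime] (hlk : l ≤ k) (hkK : k ≤ K) (W : Polynomial ℤ)
    (hW : W.natDegree ≤ K - k) (D : Dat) (η ξ : ℤ) (a : ℕ)
    (hN : l * (m + a) ≤ N) (β : Fin k → ZMod (p^N)) (γ : Fin l → ZMod (p^(l*m))) (r : ℤ) (m' : ℕ) :
    ‖ff K p N k W D (ξ + (p:ℤ)^a * r) (a+m') (β + sh p N (l*m) k l η ξ a γ)‖ =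
    ‖ff K p (l*m) l (Wt p k l W η ξ a) (Dt K p N k W D ξ a β) r m' γ‖ := by
  have hp0 : (p:ℤ)^a ≠ 0 := pow_ne_zero _ (by exact_mod_cast (Fact.out : p.Prime).ne_zero)
  have : ff K p N k W D (ξ + (p:ℤ)^a * r) (a+m') (β + sh p N (l*m) k l η ξ a γ) =
    ee p N (Ph K p N k W (sh p N (l*m) k l η ξ a γ) ξ) *
     ff K p (l*m) l (Wt p k l W η ξ a) (Dt K p N k W D ξ a β) r m' γ := by
    unfold ff Dt
    simp only
    rw [Finset.mul_sum, Finset.filter_filter]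
    have hset : D.S.filter (fun x => (p:ℤ)^(a+m') ∣ D.u x - (ξ + (p:ℤ)^a * r)) =
       D.S.filter (fun x => (p:ℤ)^a ∣ D.u x - ξ ∧ (p:ℤ)^m' ∣ (D.u x - ξ) / (p:ℤ)^a - r) := by
      apply Finset.filter_congr
      intro x _
      constructor
      · rintro ⟨t, ht⟩
        have e : D.u x - ξ = (p:ℤ)^a * ((p:ℤ)^m' * t + r) := by
          rw [pow_add] at ht; linear_combination ht
        refine ⟨⟨_, e⟩, ?_⟩
        rw [e, Int.mul_ediv_cancel_left _ hp0]
        exact ⟨t, by ring⟩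
      · rintro ⟨⟨v, hv⟩, h⟩
        rw [hv, Int.mul_ediv_cancel_left _ hp0] at h
        obtain ⟨t, ht⟩ := h
        refine ⟨t, ?_⟩
        rw [pow_add]; linear_combination hv + (p:ℤ)^a * ht
    rw [hset]
    refine Finset.sum_congr rfl fun x hx => ?_
    obtain ⟨v, hv⟩ := (Finset.mem_filter.1 hx).2.1
    rw [hv, Int.mul_ediv_cancel_left _ hp0]
    have e : D.u x = ξ + (p:ℤ)^a * v := by linarith
    rw [Ph_add, AddChar.map_add_eq_mul, e, Ph_sh_rescale K p N k l m hlk hkK W hW η ξ a hN γ v]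
    ring
  rw [this, norm_mul, ee_norm, one_mul]

lemma AL (K p N k l m : ℕ) [Fact p.Prime] (hlk : l ≤ k) (hkK : k ≤ K) (W : Polynomial ℤ)
    (hW : InW K p k W) (D : Dat) (η ξ : ℤ) (a : ℕ)
    (hN : l * (m + a) ≤ N) (h : l = k ∨ (1 ≤ a ∧ ¬ (p:ℤ) ∣ ξ - η))
    (w : (Fin k → ZMod (p^N)) → ℝ) (hw : ∀ β, 0 ≤ w β)
    (hinv : ∀ β (γ : Fin l → ZMod (p^(l*m))), w (β + sh p N (l*m) k l η ξ a γ) = w β)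
    (B : ℝ) (hdec : Dec K p l m B) :
    ∑ β, w β * ‖ff K p N k W D ξ a β‖^(qq l) ≤
    B * (p:ℝ)^(m * hh l) * ∑ r ∈ Finset.range (p^m), ∑ β, w β * ‖ff K p N k W D (ξ + (p:ℤ)^a * r) (a+m) β‖^(qq l) := by
  have havg : ∀ g : (Fin k → ZMod (p^N)) → ℝ,
      (Fintype.card (Fin l → ZMod (p^(l*m))) : ℝ) * ∑ β, w β * g β =
      ∑ β, w β * ∑ γ : Fin l → ZMod (p^(l*m)), g (β + sh p N (l*m) k l η ξ a γ) := by
    intro g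
    have h1 : ∑ β, w β * ∑ γ : Fin l → ZMod (p^(l*m)), g (β + sh p N (l*m) k l η ξ a γ) =
        ∑ γ : Fin l → ZMod (p^(l*m)), ∑ β, w β * g (β + sh p N (l*m) k l η ξ a γ) := by
      simp_rw [Finset.mul_sum]
      rw [Finset.sum_comm]
    have h2 : ∀ γ : Fin l → ZMod (p^(l*m)), ∑ β, w β * g (β + sh p N (l*m) k l η ξ a γ) = ∑ β, w β * g β := by
      intro γ
      rw [← Equiv.sum_comp (Equiv.addRight (sh p N (l*m) k l η ξ a γ)) (fun β => w β * g β)]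
      refine Finset.sum_congr rfl fun β _ => ?_
      simp only [Equiv.coe_addRight]
      rw [hinv]
    rw [h1]
    simp_rw [h2]
    rw [Finset.sum_const, nsmul_eq_mul, Finset.card_univ]
  have hcard : (0:ℝ) < (Fintype.card (Fin l → ZMod (p^(l*m))) : ℝ) := by
    exact_mod_cast Fintype.card_pos
  refine le_of_mul_le_mul_left ?_ hcard
  rw [havg (fun β => ‖ff K p N k W D ξ a β‖^(qq l))]
  rw [mul_left_comm, Finset.mul_sum]
  simp_rw [fun r : ℕ => havg (fun β => ‖ff K p N k W D (ξ + (p:ℤ)^a * r) (a+m) β‖^(qq l))]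
  rw [Finset.sum_comm, Finset.mul_sum]
  refine Finset.sum_le_sum fun β _ => ?_
  rw [← Finset.mul_sum, mul_left_comm]
  refine mul_le_mul_of_nonneg_left ?_ (hw β)
  have h0 := hdec (Wt p k l W η ξ a) (Wt_inW K p k l Fact.out hlk hkK W hW η ξ a h) (Dt K p N k W D ξ a β)
  have e1 : ∀ γ, ‖ff K p (l*m) l (Wt p k l W η ξ a) (Dt K p N k W D ξ a β) 0 0 γ‖ =
      ‖ff K p N k W D ξ a (β + sh p N (l*m) k l η ξ a γ)‖ := by
    intro γ
    rw [← norm_ff_rescale K p N k l m hlk hkK W hW.1 D η ξ a hN β γ 0 0]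
    simp
  simp_rw [e1] at h0
  simp_rw [← norm_ff_rescale K p N k l m hlk hkK W hW.1 D η ξ a hN β] at h0
  exact h0

lemma holder2 {Ω : Type*} (s : Finset Ω) (f g : Ω → ℝ) (hf : ∀ x, 0 ≤ f x) (hg : ∀ x, 0 ≤ g x)
    (t : ℝ) (h0 : 0 < t) (h1 : t < 1) :
    ∑ x ∈ s, (f x)^t * (g x)^(1-t) ≤ (∑ x ∈ s, f x)^t * (∑ x ∈ s, g x)^(1-t) := by
  have hc : (1/t).HolderConjugate (1/(1-t)) := by
    rw [Real.holderConjugate_iff]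
    refine ⟨by rw [lt_div_iff₀ h0]; linarith, ?_⟩
    simp
  have := Real.inner_le_Lp_mul_Lq_of_nonneg s hc (f := fun x => (f x)^t) (g := fun x => (g x)^(1-t))
    (fun x _ => rpow_nonneg (hf x) _) (fun x _ => rpow_nonneg (hg x) _)
  have e1 : ∀ x, ((f x)^t)^(1/t) = f x := fun x => by
    rw [← rpow_mul (hf x), mul_one_div_cancel h0.ne', rpow_one]
  have e2 : ∀ x, ((g x)^(1-t))^(1/(1-t)) = g x := fun x => by
    rw [← rpow_mul (hg x), mul_one_div_cancel (by linarith), rpow_one]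
  simp_rw [e1, e2] at this
  simpa using this

lemma powcomb (x y : ℝ) (hx : 0 ≤ x) (hy : 0 ≤ y) (A B A' B' C D : ℕ) (t : ℝ) (h0 : 0 < t) (h1 : t < 1)
    (e1 : t * A + (1-t) * A' = C) (e2 : t * B + (1-t) * B' = D) :
    x^C * y^D = (x^A * y^B)^t * (x^A' * y^B')^(1-t) := by
  have key : ∀ z : ℝ, 0 ≤ z → ∀ A A' C : ℕ, t * A + (1-t) * A' = C → z^C = (z^A)^t * (z^A')^(1-t) := by
    intro z hz A A' C e
    rw [← rpow_natCast z A, ← rpow_natCast z A', ← rpow_mul hz, ← rpow_mul hz, ← rpow_add_of_nonneg hz,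
      ← rpow_natCast z C, ← e]
    · congr 1; ring
    · positivity
    · have : 0 < 1 - t := by linarith
      positivity
  rw [mul_rpow (by positivity) (by positivity), mul_rpow (by positivity) (by positivity),
    key x hx A A' C e1, key y hy B B' D e2]; ring

lemma sum_rpow_le {Ω : Type*} (s : Finset Ω) (f : Ω → ℝ) (hf : ∀ x, 0 ≤ f x)
    (t : ℝ) (h0 : 0 < t) (h1 : t < 1) :
    ∑ x ∈ s, (f x)^t ≤ (s.card : ℝ)^(1-t) * (∑ x ∈ s, f x)^t := by
  have := holder2 s f (fun _ => 1) hf (fun _ => zero_le_one) t h0 h1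
  simp only [one_rpow, mul_one, Finset.sum_const, nsmul_eq_mul] at this
  rw [mul_comm]; exact this

/-- abstract system -/
structure Sys (p k n : ℕ) {Ω : Type} [Fintype Ω] (F : ℤ → ℕ → Ω → ℝ) (A η B ε : ℝ) : Prop where
  nonneg : ∀ ξ a β, 0 ≤ F ξ a β
  split : ∀ ξ a m β, F ξ a β ≤ ∑ r ∈ Finset.range (p^m), F (ξ + (p:ℤ)^a * r) (a+m) β
  full : ∀ ξ a, a ≤ n → ∑ β, F ξ a β^(qq k) ≤ A * (p:ℝ)^(η * ((n:ℝ) - a)) * ((p:ℝ)^((n-a) * hh k) *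
    ∑ r ∈ Finset.range (p^(n-a)), ∑ β, F (ξ + (p:ℤ)^a * r) n β^(qq k))
  low : ∀ l, 1 ≤ l → l < k → ∀ ξ ζ a b m, 1 ≤ a → ¬ (p:ℤ) ∣ ξ - ζ → l * (m + a) ≤ (k-l+1)*b → b ≤ n →
    ∑ β, F ξ a β^(qq l) * F ζ b β^(qq k - qq l) ≤ B * (p:ℝ)^(ε * m) * (p:ℝ)^(m * hh l) *
      ∑ r ∈ Finset.range (p^m), ∑ β, F (ξ + (p:ℤ)^a * r) (a+m) β^(qq l) * F ζ b β^(qq k - qq l)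

def Zf (p k n : ℕ) {Ω : Type} [Fintype Ω] (F : ℤ → ℕ → Ω → ℝ) (ξ : ℤ) (a : ℕ) : ℝ :=
  (p:ℝ)^((n-a) * hh k) * ∑ r ∈ Finset.range (p^(n-a)), ∑ β, F (ξ + (p:ℤ)^a * r) n β^(qq k)

def BL (k : ℕ) {Ω : Type} [Fintype Ω] (F : ℤ → ℕ → Ω → ℝ) (l : ℕ) (ξ : ℤ) (a : ℕ) (ζ : ℤ) (b : ℕ) : ℝ :=
  ∑ β, F ξ a β^(qq l) * F ζ b β^(qq k - qq l)

lemma range_pow_split (p m n : ℕ) (g : ℕ → ℝ) :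
    ∑ r ∈ Finset.range (p^(m+n)), g r = ∑ r ∈ Finset.range (p^m), ∑ s ∈ Finset.range (p^n), g (r + p^m * s) := by
  rw [pow_add, Finset.sum_comm]
  generalize p^m = a
  generalize p^n = b
  induction b with
  | zero => simp
  | succ b ih =>
    rw [mul_add, mul_one, Finset.sum_range_add, ih, Finset.sum_range_succ]
    congr 1
    exact Finset.sum_congr rfl fun r _ => by rw [add_comm]

lemma Zf_split (p k n : ℕ) {Ω : Type} [Fintype Ω] (F : ℤ → ℕ → Ω → ℝ) (ξ : ℤ) (a m : ℕ) (h : a + m ≤ n) :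
    (p:ℝ)^(m * hh k) * ∑ r ∈ Finset.range (p^m), Zf p k n F (ξ + (p:ℤ)^a * r) (a+m) = Zf p k n F ξ a := by
  unfold Zf
  have e : n - a = m + (n - (a+m)) := by omega
  rw [← Finset.mul_sum, ← mul_assoc, ← pow_add, ← add_mul, ← e]
  congr 1
  conv_rhs => rw [e, range_pow_split]
  refine Finset.sum_congr rfl fun r _ => Finset.sum_congr rfl fun s _ => Finset.sum_congr rfl fun β _ => ?_
  congr 2
  push_cast; rw [pow_add]; ring

lemma Zf_nonneg (p k n : ℕ) {Ω : Type} [Fintype Ω] (F : ℤ → ℕ → Ω → ℝ) (hF : ∀ ξ a β, 0 ≤ F ξ a β)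
    (ξ : ℤ) (a : ℕ) : 0 ≤ Zf p k n F ξ a := by
  unfold Zf
  refine mul_nonneg (by positivity) (Finset.sum_nonneg fun r _ => Finset.sum_nonneg fun β _ => pow_nonneg (hF _ _ _) _)

lemma BL_nonneg (k : ℕ) {Ω : Type} [Fintype Ω] (F : ℤ → ℕ → Ω → ℝ) (hF : ∀ ξ a β, 0 ≤ F ξ a β)
    (l : ℕ) (ξ : ℤ) (a : ℕ) (ζ : ℤ) (b : ℕ) : 0 ≤ BL k F l ξ a ζ b :=
  Finset.sum_nonneg fun _ _ => mul_nonneg (pow_nonneg (hF _ _ _) _) (pow_nonneg (hF _ _ _) _)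

lemma Zf_le (p k n : ℕ) (hp : 1 ≤ p) {Ω : Type} [Fintype Ω] (F : ℤ → ℕ → Ω → ℝ) (hF : ∀ ξ a β, 0 ≤ F ξ a β)
    (ξ : ℤ) (a m : ℕ) (h : a + m ≤ n) (r : ℕ) (hr : r < p^m) :
    Zf p k n F (ξ + (p:ℤ)^a * r) (a+m) ≤ Zf p k n F ξ a := by
  rw [← Zf_split p k n F ξ a m h]
  have hnn : ∀ i ∈ Finset.range (p^m), 0 ≤ Zf p k n F (ξ + (p:ℤ)^a * (i:ℕ)) (a+m) := fun i _ => Zf_nonneg p k n F hF _ _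
  have h1 := Finset.single_le_sum hnn (Finset.mem_range.2 hr)
  have h2 : (1:ℝ) ≤ (p:ℝ)^(m * hh k) := one_le_pow₀ (by exact_mod_cast hp)
  have h3 := Finset.sum_nonneg hnn
  nlinarith

def yy (k : ℕ) (η ε : ℝ) : ℕ → ℕ → ℝ
  | 0, l => if l = 0 then η else 0
  | (t+1), l => if l = 0 then η else
      yy k η ε t (k-l) / l + ((k-l:ℕ):ℝ)/((k-l:ℕ)+1) * yy k η ε t (l-1) - k * ε

lemma yy_zero (k : ℕ) (η ε : ℝ) (t : ℕ) : yy k η ε t 0 = η := by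
  cases t <;> simp [yy]

lemma yy_sum (k : ℕ) (hk : 1 ≤ k) (η ε : ℝ) (t : ℕ) :
    ∑ l ∈ Finset.Ico 1 k, yy k η ε t l = t * (((k:ℝ)-1) * (η / k - k * ε)) := by
  induction t with
  | zero =>
    simp only [Nat.cast_zero, zero_mul]
    refine Finset.sum_eq_zero fun l hl => ?_
    have := (Finset.mem_Ico.1 hl).1
    simp [yy]; omega
  | succ t ih =>
    have e : ∀ l ∈ Finset.Ico 1 k, yy k η ε (t+1) l = yy k η ε t (k-l) / l + ((k-l:ℕ):ℝ)/((k-l:ℕ)+1) * yy k η ε t (l-1) - k * ε := by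
      intro l hl
      have := (Finset.mem_Ico.1 hl).1
      simp only [yy]; rw [if_neg (by omega)]
    rw [Finset.sum_congr rfl e, Finset.sum_sub_distrib, Finset.sum_add_distrib]
    have s1 : ∑ l ∈ Finset.Ico 1 k, yy k η ε t (k-l) / l = ∑ l ∈ Finset.Ico 1 k, yy k η ε t l / ((k-l:ℕ):ℝ) := by
      refine Finset.sum_nbij' (fun l => k - l) (fun l => k - l) ?_ ?_ ?_ ?_ ?_
      all_goals intro l hl; have := Finset.mem_Ico.1 hl
      · simp only [Finset.mem_Ico]; omega
      · simp only [Finset.mem_Ico]; omega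
      · omega
      · omega
      · have : k - (k - l) = l := by omega
        rw [this]
    have s2 : ∑ l ∈ Finset.Ico 1 k, ((k-l:ℕ):ℝ)/((k-l:ℕ)+1) * yy k η ε t (l-1) =
        ((k:ℝ)-1)/k * η + ∑ l ∈ Finset.Ico 1 k, ((k-l:ℕ):ℝ)⁻¹ * (((k-l:ℕ):ℝ) - 1) * yy k η ε t l := by
      have : ∀ l ∈ Finset.range k, ((k-(l+1):ℕ):ℝ)/((k-(l+1):ℕ)+1) * yy k η ε t l = ((k-l:ℕ):ℝ)⁻¹ * (((k-l:ℕ):ℝ) - 1) * yy k η ε t l := by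
        intro l hl
        have := Finset.mem_range.1 hl
        have h1 : k - l = (k - (l+1)) + 1 := by omega
        rw [h1]; push_cast; ring
      have h3 : ∑ l ∈ Finset.range k, ((k-(l+1):ℕ):ℝ)/((k-(l+1):ℕ)+1) * yy k η ε t l = ∑ l ∈ Finset.Ico 1 k, ((k-l:ℕ):ℝ)/((k-l:ℕ)+1) * yy k η ε t (l-1) := by
        obtain ⟨j, rfl⟩ : ∃ j, k = j + 1 := ⟨k-1, by omega⟩
        rw [Finset.sum_range_succ, Finset.sum_Ico_eq_sum_range]
        simp only [Nat.add_sub_cancel, Nat.sub_self, Nat.cast_zero, zero_div, zero_mul, add_zero]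
        refine Finset.sum_congr rfl fun l _ => ?_
        rw [add_comm l 1, Nat.add_sub_cancel_left]
      rw [← h3, Finset.sum_congr rfl this, Finset.range_eq_Ico, Finset.sum_eq_sum_Ico_succ_bot (by omega), yy_zero]
      simp only [Nat.sub_zero, zero_add]; ring
    rw [s1, s2, Finset.sum_const, Nat.card_Ico, nsmul_eq_mul]
    have s3 : ∑ l ∈ Finset.Ico 1 k, yy k η ε t l / ((k-l:ℕ):ℝ) + ∑ l ∈ Finset.Ico 1 k, ((k-l:ℕ):ℝ)⁻¹ * (((k-l:ℕ):ℝ) - 1) * yy k η ε t l = ∑ l ∈ Finset.Ico 1 k, yy k η ε t l := by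
      rw [← Finset.sum_add_distrib]
      refine Finset.sum_congr rfl fun l hl => ?_
      have := Finset.mem_Ico.1 hl
      have : ((k-l:ℕ):ℝ) ≠ 0 := by norm_cast; omega
      field_simp; ring
    have : ((k-1:ℕ):ℝ) = (k:ℝ) - 1 := by push_cast [hk]; ring
    rw [this]; push_cast
    have hk0 : (k:ℝ) ≠ 0 := by norm_cast; omega
    rw [ih] at s3
    linear_combination s3

lemma qq_cast (l : ℕ) : ((qq l : ℕ):ℝ) = (l:ℝ)*(l+1) := by unfold qq; push_cast; ring

lemma hh_cast (l : ℕ) (h : 1 ≤ l) : ((hh l : ℕ):ℝ) = (l:ℝ)*(l+1)/2 - 1 := by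
  unfold hh
  have h2 : 2 ∣ l * (l+1) := (Nat.even_mul_succ_self l).two_dvd
  obtain ⟨t, ht⟩ := h2
  have h3 : 2 ≤ l * (l+1) := by nlinarith
  rw [ht, Nat.mul_div_cancel_left _ (by norm_num)]
  have : (1:ℕ) ≤ t := by omega
  push_cast [this]
  have h4 : (l:ℝ)*(l+1) = 2 * t := by exact_mod_cast ht
  rw [h4]; ring

lemma qq_lt (l k : ℕ) (h : l < k) : qq l < qq k := by unfold qq; nlinarith

lemma BL_holder (k : ℕ) {Ω : Type} [Fintype Ω] (F : ℤ → ℕ → Ω → ℝ) (hF : ∀ ξ a β, 0 ≤ F ξ a β)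
    (l : ℕ) (h1 : 1 ≤ l) (h2 : l < k) (ξ ζ : ℤ) (a b : ℕ) :
    BL k F l ξ a ζ b ≤ (BL k F (k-l) ζ b ξ a)^(1/(((k-l:ℕ):ℝ)+1)) * (BL k F (l-1) ξ a ζ b)^(1-1/(((k-l:ℕ):ℝ)+1)) := by
  have hkl : (0:ℝ) < ((k-l:ℕ):ℝ) := by norm_cast; omega
  have ht0 : 0 < 1/(((k-l:ℕ):ℝ)+1) := by positivity
  have ht1 : 1/(((k-l:ℕ):ℝ)+1) < 1 := by rw [div_lt_one (by positivity)]; linarith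
  refine le_trans (le_of_eq ?_) (holder2 Finset.univ _ _ (fun x => ?_) (fun x => ?_) _ ht0 ht1)
  · unfold BL
    refine Finset.sum_congr rfl fun β _ => ?_
    have c1 := (qq_lt (k-l) k (by omega)).le
    have c2 := (qq_lt (l-1) k (by omega)).le
    have c3 := (qq_lt l k h2).le
    obtain ⟨j, rfl⟩ : ∃ j, k = l + j := ⟨k - l, by omega⟩
    obtain ⟨i, rfl⟩ : ∃ i, l = i + 1 := ⟨l - 1, by omega⟩
    simp only [Nat.add_sub_cancel_left, Nat.add_sub_cancel] at *
    rw [powcomb (F ξ a β) (F ζ b β) (hF _ _ _) (hF _ _ _) (qq (i+1+j) - qq j) (qq j) (qq i) (qq (i+1+j) - qq i)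
      (qq (i+1)) (qq (i+1+j) - qq (i+1)) (1/((j:ℝ)+1)) ht0 ht1]
    · rw [mul_comm (F ξ a β^(qq (i+1+j) - qq j))]
    · push_cast [c1, qq_cast]; field_simp; ring
    · push_cast [c2, c3, qq_cast]; field_simp; ring
  · exact mul_nonneg (pow_nonneg (hF _ _ _) _) (pow_nonneg (hF _ _ _) _)
  · exact mul_nonneg (pow_nonneg (hF _ _ _) _) (pow_nonneg (hF _ _ _) _)

lemma BL_triv (p k n : ℕ) (hp : 2 ≤ p) {Ω : Type} [Fintype Ω] (F : ℤ → ℕ → Ω → ℝ) (A η B ε : ℝ)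
    (hA : 0 ≤ A) (hη : 0 ≤ η)
    (hS : Sys p k n F A η B ε) (l : ℕ) (h1 : 1 ≤ l) (h2 : l < k) (ξ ζ : ℤ) (a b : ℕ) (ha : a ≤ n) (hb : b ≤ n) :
    BL k F l ξ a ζ b ≤ A * (p:ℝ)^(η * n) * (Zf p k n F ξ a)^((qq l:ℝ)/qq k) * (Zf p k n F ζ b)^(1-(qq l:ℝ)/qq k) := by
  have hq := qq_lt l k h2
  have hq0 : 0 < qq l := by unfold qq; positivity
  have hqk : (0:ℝ) < qq k := by exact_mod_cast (hq0.trans hq)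
  have ht0 : 0 < (qq l:ℝ)/qq k := by positivity
  have ht1 : (qq l:ℝ)/qq k < 1 := by rw [div_lt_one hqk]; exact_mod_cast hq
  set t := (qq l:ℝ)/qq k with ht
  have hP : (1:ℝ) ≤ p := by exact_mod_cast (by omega : 1 ≤ p)
  have key : ∀ ξ a, a ≤ n → ∑ β, F ξ a β^(qq k) ≤ A * (p:ℝ)^(η * n) * Zf p k n F ξ a := by
    intro ξ a ha
    refine (hS.full ξ a ha).trans ?_
    refine mul_le_mul_of_nonneg_right ?_ (Zf_nonneg p k n F hS.nonneg ξ a)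
    refine mul_le_mul_of_nonneg_left ?_ hA
    apply rpow_le_rpow_of_exponent_le hP
    have : (0:ℝ) ≤ a := by positivity
    nlinarith
  calc BL k F l ξ a ζ b = ∑ β, (F ξ a β^(qq k))^t * (F ζ b β^(qq k))^(1-t) := by
        unfold BL
        refine Finset.sum_congr rfl fun β _ => ?_
        have := powcomb (F ξ a β) (F ζ b β) (hS.nonneg _ _ _) (hS.nonneg _ _ _) (qq k) 0 0 (qq k) (qq l) (qq k - qq l) t ht0 ht1
          (by rw [ht]; field_simp; simp) (by push_cast [hq.le]; rw [ht]; field_simp; ring)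
        rw [this]; simp
    _ ≤ (∑ β, F ξ a β^(qq k))^t * (∑ β, F ζ b β^(qq k))^(1-t) :=
        holder2 _ _ _ (fun _ => pow_nonneg (hS.nonneg _ _ _) _) (fun _ => pow_nonneg (hS.nonneg _ _ _) _) t ht0 ht1
    _ ≤ (A * (p:ℝ)^(η * n) * Zf p k n F ξ a)^t * (A * (p:ℝ)^(η * n) * Zf p k n F ζ b)^(1-t) := by
        have h3 : ∀ ξ a, 0 ≤ ∑ β, F ξ a β^(qq k) := fun ξ a => Finset.sum_nonneg fun β _ => pow_nonneg (hS.nonneg _ _ _) _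
        have h4 : 0 ≤ 1 - t := by linarith
        exact mul_le_mul (rpow_le_rpow (h3 _ _) (key _ _ ha) ht0.le) (rpow_le_rpow (h3 _ _) (key _ _ hb) h4)
          (rpow_nonneg (h3 _ _) _) (rpow_nonneg ((h3 _ _).trans (key _ _ ha)) _)
    _ = _ := by
        have hc : 0 ≤ A * (p:ℝ)^(η * n) := by positivity
        rw [mul_rpow hc (Zf_nonneg p k n F hS.nonneg _ _), mul_rpow hc (Zf_nonneg p k n F hS.nonneg _ _)]
        have : (A * (p:ℝ)^(η * n))^t * (A * (p:ℝ)^(η * n))^(1-t) = A * (p:ℝ)^(η * n) := by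
          rw [← rpow_add_of_nonneg hc ht0.le (by linarith)]
          simp
        linear_combination (Zf p k n F ξ a ^ t * Zf p k n F ζ b ^ (1 - t)) * this

lemma BL_zero (p k n : ℕ) (hp : 2 ≤ p) {Ω : Type} [Fintype Ω] (F : ℤ → ℕ → Ω → ℝ) (A η η0 B ε : ℝ)
    (hA : 0 ≤ A) (hη : η0 ≤ η) (hS : Sys p k n F A η B ε) (ξ ζ : ℤ) (a b : ℕ) (hb : b ≤ n) :
    BL k F 0 ξ a ζ b ≤ A * (p:ℝ)^(η * n - η0 * b) * (Zf p k n F ξ a)^((qq 0:ℝ)/qq k) * (Zf p k n F ζ b)^(1-(qq 0:ℝ)/qq k) := by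
  have hP : (1:ℝ) ≤ p := by exact_mod_cast (by omega : 1 ≤ p)
  have e : qq 0 = 0 := by simp [qq]
  have h := hS.full ζ b hb
  unfold BL
  simp only [e, pow_zero, one_mul, Nat.sub_zero, Nat.cast_zero, zero_div, rpow_zero, mul_one, sub_zero, rpow_one]
  refine h.trans ?_
  refine mul_le_mul_of_nonneg_right ?_ (Zf_nonneg p k n F hS.nonneg ζ b)
  refine mul_le_mul_of_nonneg_left ?_ hA
  apply rpow_le_rpow_of_exponent_le hP
  have : (0:ℝ) ≤ b := by positivity
  nlinarith

set_option maxHeartbeats 1000000 in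
lemma Pt (p k n : ℕ) (hp : 2 ≤ p) (hk : 2 ≤ k) {Ω : Type} [Fintype Ω] (F : ℤ → ℕ → Ω → ℝ) (A η η0 B ε : ℝ)
    (hA : 1 ≤ A) (hB : 1 ≤ B) (hε : 0 ≤ ε) (hη0 : 0 ≤ η0) (hη : η0 ≤ η)
    (hS : Sys p k n F A η B ε) (t : ℕ) :
    ∀ l, l < k → ∀ (ξ ζ : ℤ) (a b : ℕ), 0 < b → k.factorial^t ∣ b → k^t * b ≤ n → 1 ≤ a → a ≤ n →
      l * a ≤ (k-l+1)*b → ¬ (p:ℤ) ∣ ξ - ζ →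
      BL k F l ξ a ζ b ≤ A * B^t * (p:ℝ)^(η * n - yy k η0 ε t l * b) *
        (Zf p k n F ξ a)^((qq l:ℝ)/qq k) * (Zf p k n F ζ b)^(1-(qq l:ℝ)/qq k) := by
  have hP : (1:ℝ) ≤ p := by exact_mod_cast (by omega : 1 ≤ p)
  have hP0 : (0:ℝ) < p := by linarith
  have hZ := Zf_nonneg p k n F hS.nonneg
  induction t with
  | zero =>
    intro l hl ξ ζ a b hb0 _ hbn ha han _ _
    simp only [pow_zero, one_mul] at hbn
    rw [pow_zero, mul_one]
    rcases Nat.eq_zero_or_pos l with rfl | hl0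
    · rw [yy_zero]
      exact BL_zero p k n hp F A η η0 B ε (by linarith) hη hS ξ ζ a b hbn
    · have : yy k η0 ε 0 l = 0 := by simp [yy]; omega
      rw [this, zero_mul, sub_zero]
      exact BL_triv p k n hp F A η B ε (by linarith) (by linarith) hS l hl0 hl ξ ζ a b han hbn
  | succ t ih =>
    intro l hl ξ ζ a b hb0 hdb hbn ha han hlab hpx
    have hkt : k^t * b ≤ k^(t+1) * b := Nat.mul_le_mul_right _ (Nat.pow_le_pow_right (by omega) (by omega))
    have hbn' : b ≤ n := le_trans (Nat.le_mul_of_pos_left _ (by positivity)) hbn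
    rcases Nat.eq_zero_or_pos l with rfl | hl0
    · rw [yy_zero]
      refine (BL_zero p k n hp F A η η0 B ε (by linarith) hη hS ξ ζ a b hbn').trans ?_
      have : A ≤ A * B^(t+1) := le_mul_of_one_le_right (by linarith) (one_le_pow₀ hB)
      have h1 := hZ ξ a
      have h2 := hZ ζ b
      gcongr
    · -- main step
      obtain ⟨c, hc⟩ := hdb
      obtain ⟨f, hf⟩ : l ∣ k.factorial := Nat.dvd_factorial hl0 hl.le
      set b' := (k-l+1) * (f * k.factorial^t * c) with hb'
      have hlb' : l * b' = (k-l+1) * b := by rw [hb', hc, pow_succ, hf]; ring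
      have hb'd : k.factorial^t ∣ b' := ⟨(k-l+1)*f*c, by rw [hb']; ring⟩
      have hb'kb : b' ≤ k * b := by
        have h1 : (k-l+1) * b ≤ (l * k) * b := by
          apply Nat.mul_le_mul_right
          obtain ⟨j, rfl⟩ : ∃ j, k = l + j := ⟨k-l, by omega⟩
          rw [Nat.add_sub_cancel_left]; nlinarith
        rw [← hlb', mul_assoc] at h1
        exact Nat.le_of_mul_le_mul_left h1 hl0
      have hab' : a ≤ b' := by
        rw [← hlb'] at hlab; exact Nat.le_of_mul_le_mul_left hlab hl0
      have hb'n : k^t * b' ≤ n := by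
        calc k^t * b' ≤ k^t * (k * b) := Nat.mul_le_mul_left _ hb'kb
          _ = k^(t+1) * b := by ring
          _ ≤ n := hbn
      have hb'n' : b' ≤ n := le_trans (Nat.le_mul_of_pos_left _ (by positivity)) hb'n
      obtain ⟨m, hm⟩ : ∃ m, b' = a + m := ⟨b' - a, by omega⟩
      have hlow := hS.low l hl0 hl ξ ζ a b m ha hpx (by rw [add_comm m a, ← hm, hlb']) hbn'
      have hkl1 : (0:ℝ) < ((k-l:ℕ):ℝ) := by norm_cast; omega
      have hl1 : (0:ℝ) < l := by exact_mod_cast hl0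
      set τ : ℝ := 1/(((k-l:ℕ):ℝ)+1) with hτ
      have ht0 : 0 < τ := by positivity
      have ht1 : τ < 1 := by rw [hτ, div_lt_one (by positivity)]; linarith
      have hq := qq_lt l k hl
      have hq0 : 0 < qq l := by unfold qq; positivity
      have hqk : (0:ℝ) < qq k := by exact_mod_cast (hq0.trans hq)
      set th := (qq l:ℝ)/qq k with hth
      have hth0 : 0 < th := by positivity
      have hth1 : th < 1 := by rw [hth, div_lt_one hqk]; exact_mod_cast hq
      set yl := yy k η0 ε t (k-l) / l + ((k-l:ℕ):ℝ)/((k-l:ℕ)+1) * yy k η0 ε t (l-1) with hyl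
      have hyy : yy k η0 ε (t+1) l = yl - k * ε := by
        simp only [yy]; rw [if_neg (by omega)]
      have hbr : (l:ℝ) * b' = (((k-l:ℕ):ℝ)+1) * b := by exact_mod_cast hlb'
      have each : ∀ r : ℕ, BL k F l (ξ + (p:ℤ)^a * r) b' ζ b ≤
          A * B^t * (p:ℝ)^(η * n - yl * b) * (Zf p k n F (ξ + (p:ℤ)^a * r) b')^th * (Zf p k n F ζ b)^(1-th) := by
        intro r
        set ξ' := ξ + (p:ℤ)^a * r with hξ'
        have hpx' : ¬ (p:ℤ) ∣ ξ' - ζ := by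
          intro h
          apply hpx
          have h2 : (p:ℤ) ∣ (p:ℤ)^a * r := Dvd.dvd.mul_right (dvd_pow_self _ (by omega)) _
          have := dvd_sub h h2
          have e : ξ' - ζ - (p:ℤ)^a * r = ξ - ζ := by rw [hξ']; ring
          rwa [e] at this
        have hpx2 : ¬ (p:ℤ) ∣ ζ - ξ' := by
          rwa [← dvd_neg, neg_sub]
        have b1 := ih (k-l) (by omega) ζ ξ' b b' (by omega) hb'd hb'n (by omega) hbn' (by
          have e : k - (k-l) = l := by omega
          rw [e]
          have : (k-l)*b ≤ (k-l+1)*b := Nat.mul_le_mul_right _ (by omega)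
          rw [← hlb'] at this
          refine this.trans (Nat.mul_le_mul_right _ (by omega))) hpx2
        have b2 := ih (l-1) (by omega) ξ' ζ b' b hb0 ⟨k.factorial*c, by rw [hc]; ring⟩ (hkt.trans hbn) (by omega) hb'n' (by
          calc (l-1)*b' ≤ l*b' := Nat.mul_le_mul_right _ (by omega)
            _ = (k-l+1)*b := hlb'
            _ ≤ _ := Nat.mul_le_mul_right _ (by omega)) hpx'
        refine (BL_holder k F hS.nonneg l hl0 hl ξ' ζ b' b).trans ?_
        have hn1 := BL_nonneg k F hS.nonneg (k-l) ζ b ξ' b'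
        have hn2 := BL_nonneg k F hS.nonneg (l-1) ξ' b' ζ b
        refine (mul_le_mul (rpow_le_rpow hn1 b1 ht0.le) (rpow_le_rpow hn2 b2 (by linarith : (0:ℝ) ≤ 1 - τ))
          (rpow_nonneg hn2 _) (rpow_nonneg (hn1.trans b1) _)).trans (le_of_eq ?_)
        have z1 := hZ ξ' b'
        have z2 := hZ ζ b
        have hqle1 : (qq (k-l):ℝ) < qq k := by exact_mod_cast qq_lt (k-l) k (by omega)
        have hqle2 : (qq (l-1):ℝ) < qq k := by exact_mod_cast qq_lt (l-1) k (by omega)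
        have x1 : 0 ≤ (qq (k-l):ℝ)/qq k := by positivity
        have x2 : 0 ≤ 1 - (qq (k-l):ℝ)/qq k := by rw [sub_nonneg, div_le_one hqk]; exact hqle1.le
        have x3 : 0 ≤ (qq (l-1):ℝ)/qq k := by positivity
        have x4 : 0 ≤ 1 - (qq (l-1):ℝ)/qq k := by rw [sub_nonneg, div_le_one hqk]; exact hqle2.le
        have cK : 0 ≤ A * B^t := by positivity
        have t1 : 0 ≤ 1 - τ := by linarith
        generalize A * B^t = Kt at cK
        rw [mul_rpow (by positivity) (by positivity), mul_rpow (by positivity) (by positivity), mul_rpow (by positivity) (by positivity),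
          mul_rpow (by positivity) (by positivity), mul_rpow (by positivity) (by positivity), mul_rpow (by positivity) (by positivity)]
        rw [← rpow_mul z1, ← rpow_mul z1, ← rpow_mul z2, ← rpow_mul z2, ← rpow_mul hP0.le, ← rpow_mul hP0.le]
        have g1 : Kt^τ * Kt^(1-τ) = Kt := by
          rw [← rpow_add_of_nonneg cK ht0.le t1]; simp
        have hqq1 : (qq l:ℝ) = (1 - τ) * qq (l-1) + τ * (qq k - qq (k-l)) := by
          rw [qq_cast, qq_cast, qq_cast, qq_cast, hτ]
          obtain ⟨j, rfl⟩ : ∃ j, k = l + j := ⟨k - l, by omega⟩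
          obtain ⟨i, rfl⟩ : ∃ i, l = i + 1 := ⟨l - 1, by omega⟩
          simp only [Nat.add_sub_cancel_left, Nat.add_sub_cancel]
          push_cast; field_simp; ring
        have g2 : (Zf p k n F ξ' b')^((1 - (qq (k-l):ℝ)/qq k) * τ) * (Zf p k n F ξ' b')^((qq (l-1):ℝ)/qq k * (1-τ)) = (Zf p k n F ξ' b')^th := by
          rw [← rpow_add_of_nonneg z1 (by positivity) (by positivity)]
          congr 1
          rw [hth, hqq1]; field_simp; ring
        have g3 : (Zf p k n F ζ b)^((qq (k-l):ℝ)/qq k * τ) * (Zf p k n F ζ b)^((1-(qq (l-1):ℝ)/qq k) * (1-τ)) = (Zf p k n F ζ b)^(1-th) := by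
          rw [← rpow_add_of_nonneg z2 (by positivity) (by positivity)]
          congr 1
          rw [hth, hqq1]; field_simp; ring
        have g4 : (p:ℝ)^((η * n - yy k η0 ε t (k-l) * b') * τ) * (p:ℝ)^((η * n - yy k η0 ε t (l-1) * b) * (1-τ)) = (p:ℝ)^(η * n - yl * b) := by
          rw [← rpow_add hP0]
          congr 1
          have e1 : τ * b' = b / l := by rw [hτ]; field_simp; linarith
          have e2 : 1 - τ = ((k-l:ℕ):ℝ)/((k-l:ℕ)+1) := by rw [hτ]; field_simp; ring
          rw [hyl, ← e2]
          linear_combination (- yy k η0 ε t (k-l)) * e1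
        rw [← g2, ← g3, ← g4]; nth_rewrite 3 [← g1]; ring
      have hZs := Zf_split p k n F ξ a m (by omega)
      rw [← hm] at hZs hlow
      have hsum : ∑ r ∈ Finset.range (p^m), BL k F l (ξ + (p:ℤ)^a * (r:ℕ)) b' ζ b ≤
         A * B^t * (p:ℝ)^(η * n - yl * b) * (((p^m:ℕ):ℝ)^(1-th) * (∑ r ∈ Finset.range (p^m), Zf p k n F (ξ + (p:ℤ)^a * (r:ℕ)) b')^th) * (Zf p k n F ζ b)^(1-th) := by
        refine (Finset.sum_le_sum fun r _ => each r).trans ?_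
        rw [← Finset.sum_mul, ← Finset.mul_sum]
        have := sum_rpow_le (Finset.range (p^m)) (fun r : ℕ => Zf p k n F (ξ + (p:ℤ)^a * r) b') (fun r => hZ _ _) th hth0 hth1
        rw [Finset.card_range] at this
        have z2 := hZ ζ b
        gcongr
      have hlow' : BL k F l ξ a ζ b ≤ B * (p:ℝ)^(ε * m) * (p:ℝ)^(m * hh l) *
          (A * B^t * (p:ℝ)^(η * n - yl * b) * (((p^m:ℕ):ℝ)^(1-th) * (∑ r ∈ Finset.range (p^m), Zf p k n F (ξ + (p:ℤ)^a * (r:ℕ)) b')^th) * (Zf p k n F ζ b)^(1-th)) := by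
        refine le_trans hlow ?_
        refine mul_le_mul_of_nonneg_left hsum (by positivity)
      refine hlow'.trans ?_
      set zs := ∑ r ∈ Finset.range (p^m), Zf p k n F (ξ + (p:ℤ)^a * (r:ℕ)) b' with hzs
      have hzs0 : 0 ≤ zs := Finset.sum_nonneg fun r _ => hZ _ _
      have hZth : (Zf p k n F ξ a)^th = (p:ℝ)^((m:ℝ) * hh k * th) * zs^th := by
        rw [← hZs, mul_rpow (by positivity) hzs0, ← rpow_natCast, ← rpow_mul hP0.le]; push_cast; ring_nf
      have hexp : (p:ℝ)^(m * hh l) * ((p^m:ℕ):ℝ)^(1-th) = (p:ℝ)^((m:ℝ) * hh k * th) := by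
        rw [Nat.cast_pow, ← rpow_natCast, ← rpow_natCast, ← rpow_mul hP0.le, ← rpow_add hP0]
        congr 1
        push_cast
        rw [hh_cast l hl0, hh_cast k (by omega), hth, qq_cast, qq_cast]
        have : (k:ℝ) ≠ 0 := by norm_cast; omega
        field_simp; ring
      have z2 := hZ ζ b
      have hmkb : (m:ℝ) ≤ k * b := by
        have : m ≤ k * b := by omega
        exact_mod_cast this
      have hpow : (p:ℝ)^(ε * m) * (p:ℝ)^(η * n - yl * b) ≤ (p:ℝ)^(η * n - yy k η0 ε (t+1) l * b) := by
        rw [← rpow_add hP0]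
        apply rpow_le_rpow_of_exponent_le hP
        rw [hyy]
        nlinarith
      calc _ = A * B^(t+1) * ((p:ℝ)^(ε * m) * (p:ℝ)^(η * n - yl * b)) * (((p:ℝ)^(m * hh l) * ((p^m:ℕ):ℝ)^(1-th)) * zs^th) * (Zf p k n F ζ b)^(1-th) := by
            rw [pow_succ]; ring
        _ = A * B^(t+1) * ((p:ℝ)^(ε * m) * (p:ℝ)^(η * n - yl * b)) * (Zf p k n F ξ a)^th * (Zf p k n F ζ b)^(1-th) := by
            rw [hexp, hZth]
        _ ≤ _ := by
            refine mul_le_mul_of_nonneg_right (mul_le_mul_of_nonneg_right (mul_le_mul_of_nonneg_left hpow ?_) ?_) ?_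
            · positivity
            · exact rpow_nonneg (hZ ξ a) _
            · exact rpow_nonneg z2 _

lemma pow_sum_le_card {ι : Type*} (s : Finset ι) (f : ι → ℝ) (hf : ∀ i, 0 ≤ f i) (e : ℕ) (he : 1 ≤ e) :
    (∑ i ∈ s, f i)^e ≤ (s.card : ℝ)^(e-1) * ∑ i ∈ s, f i^e := by
  obtain ⟨n, rfl⟩ : ∃ n, e = n + 1 := ⟨e-1, by omega⟩
  rcases s.eq_empty_or_nonempty with rfl | hs
  · simp
  have := pow_sum_div_card_le_sum_pow (s := s) (f := f) (n := n) (fun i _ => hf i)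
  have hc : (0:ℝ) < (s.card:ℝ)^n := by have := hs.card_pos; positivity
  rw [div_le_iff₀ hc] at this
  rw [Nat.add_sub_cancel, mul_comm]; exact this

lemma broad_narrow (p : ℕ) (hp : 1 ≤ p) (F0 : ℝ) (f : ℕ → ℝ) (hf : ∀ i, 0 ≤ f i) (hF : 0 ≤ F0)
    (h : F0 ≤ ∑ r ∈ Finset.range p, f r) (e1 e2 : ℕ) :
    F0^(e1+e2) ≤ 2^(e1+e2) * ∑ r ∈ Finset.range p, f r^(e1+e2) +
      (2*(p:ℝ))^(e1+e2) * ∑ r ∈ Finset.range p, ∑ r' ∈ (Finset.range p).filter (fun r' => r' ≠ r), f r^e1 * f r'^e2 := by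
  obtain ⟨m, hm, hmax⟩ := Finset.exists_max_image (Finset.range p) f ⟨0, Finset.mem_range.2 hp⟩
  have n1 : 0 ≤ ∑ r ∈ Finset.range p, ∑ r' ∈ (Finset.range p).filter (fun r' => r' ≠ r), f r^e1 * f r'^e2 :=
    Finset.sum_nonneg fun r _ => Finset.sum_nonneg fun r' _ => mul_nonneg (pow_nonneg (hf _) _) (pow_nonneg (hf _) _)
  have n2 : 0 ≤ ∑ r ∈ Finset.range p, f r^(e1+e2) := Finset.sum_nonneg fun r _ => pow_nonneg (hf _) _
  by_cases hc : F0 ≤ 2 * f m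
  · have h1 : F0^(e1+e2) ≤ 2^(e1+e2) * f m^(e1+e2) := by rw [← mul_pow]; exact pow_le_pow_left₀ hF hc _
    have h2 := Finset.single_le_sum (f := fun r => f r^(e1+e2)) (fun i _ => pow_nonneg (hf _) _) hm
    have h3 : (0:ℝ) < 2^(e1+e2) := by positivity
    have h4 : 0 ≤ (2*(p:ℝ))^(e1+e2) := by positivity
    have := mul_le_mul_of_nonneg_left h2 h3.le
    have := mul_nonneg h4 n1
    linarith
  · push Not at hc
    have hex : ∃ r' ∈ (Finset.range p).filter (fun r' => r' ≠ m), F0 ≤ 2 * p * f r' := by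
      by_contra hcon
      push Not at hcon
      have hsum : ∑ r ∈ Finset.range p, f r = f m + ∑ r ∈ (Finset.range p).filter (fun r' => r' ≠ m), f r := by
        rw [Finset.filter_ne', Finset.add_sum_erase _ _ hm]
      have hp0 : (0:ℝ) < p := by exact_mod_cast hp
      have hb : ∑ r ∈ (Finset.range p).filter (fun r' => r' ≠ m), f r ≤ ∑ r ∈ (Finset.range p).filter (fun r' => r' ≠ m), F0 / (2*p) := by
        refine Finset.sum_le_sum fun r hr => ?_
        rw [le_div_iff₀ (by positivity)]; have := hcon r hr; linarith
      rw [Finset.sum_const, nsmul_eq_mul] at hb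
      have hcard : (((Finset.range p).filter (fun r' => r' ≠ m)).card : ℝ) ≤ p := by
        have := Finset.card_filter_le (Finset.range p) (fun r' => r' ≠ m)
        rw [Finset.card_range] at this; exact_mod_cast this
      have : (((Finset.range p).filter (fun r' => r' ≠ m)).card : ℝ) * (F0/(2*p)) ≤ p * (F0/(2*p)) := by gcongr
      have e : p * (F0/(2*p)) = F0/2 := by field_simp
      rw [hsum] at h; linarith
    obtain ⟨r', hr', hF'⟩ := hex
    have hm' : F0 ≤ 2 * p * f m := by
      have := hmax r' (Finset.mem_filter.1 hr').1
      refine hF'.trans ?_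
      gcongr
    have h1 : F0^(e1+e2) ≤ (2*(p:ℝ))^(e1+e2) * (f m^e1 * f r'^e2) := by
      calc F0^(e1+e2) = F0^e1 * F0^e2 := pow_add _ _ _
        _ ≤ (2 * p * f m)^e1 * (2 * p * f r')^e2 := by have := hf m; gcongr
        _ = _ := by rw [mul_pow, mul_pow, pow_add]; ring
    have h2 := Finset.single_le_sum (f := fun r' => f m^e1 * f r'^e2) (fun i _ => mul_nonneg (pow_nonneg (hf _) _) (pow_nonneg (hf _) _)) hr'
    have h3 := Finset.single_le_sum (f := fun r => ∑ r' ∈ (Finset.range p).filter (fun r' => r' ≠ r), f r^e1 * f r'^e2) (fun r _ => Finset.sum_nonneg fun r' _ => mul_nonneg (pow_nonneg (hf _) _) (pow_nonneg (hf _) _)) hm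
    have h4 : 0 ≤ (2*(p:ℝ))^(e1+e2) := by positivity
    have h5 := mul_le_mul_of_nonneg_left (h2.trans h3) h4
    have h6 : 0 ≤ 2^(e1+e2) * ∑ r ∈ Finset.range p, f r^(e1+e2) := by positivity
    linarith

lemma sys_broad (p k n : ℕ) (hp : 2 ≤ p) (hk : 2 ≤ k) {Ω : Type} [Fintype Ω] (F : ℤ → ℕ → Ω → ℝ) (A η η0 B ε : ℝ)
    (hA : 1 ≤ A) (hB : 1 ≤ B) (hε : 0 ≤ ε) (hη0 : 0 ≤ η0) (hη : η0 ≤ η)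
    (hS : Sys p k n F A η B ε) (t l b : ℕ) (hl : l < k) (hl1 : 1 ≤ l) (hy : (qq k : ℝ) + 2 ≤ yy k η0 ε t l)
    (hkb : k ≤ b) (hd : k.factorial^t ∣ b) (hbn : k^t * b ≤ n) (ρ ρ' : ℕ) (h1 : ρ < p) (h2 : ρ' < p) (hne : ρ' ≠ ρ) :
    ∑ β, F (ρ:ℤ) 1 β^(qq l) * F (ρ':ℤ) 1 β^(qq k - qq l) ≤ A * B^t * (p:ℝ)^(η * n - b) * Zf p k n F 0 0 := by
  have hP : (1:ℝ) ≤ p := by exact_mod_cast (by omega : 1 ≤ p)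
  have hP0 : (0:ℝ) < p := by linarith
  have hbn' : b ≤ n := le_trans (Nat.le_mul_of_pos_left _ (by positivity)) hbn
  have hq := qq_lt l k hl
  have hqk : (0:ℝ) < qq k := by exact_mod_cast lt_of_le_of_lt (Nat.zero_le _) hq
  obtain ⟨m, rfl⟩ : ∃ m, b = 1 + m := ⟨b-1, by omega⟩
  set Z0 := Zf p k n F 0 0 with hZ0
  have hZ := Zf_nonneg p k n F hS.nonneg
  have z1 : Zf p k n F (ρ:ℤ) 1 ≤ Z0 := by
    have := Zf_le p k n (by omega) F hS.nonneg 0 0 1 (by omega) ρ (by simpa using h1)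
    simpa using this
  have z2 : ∀ r : ℕ, r < p^m → Zf p k n F ((ρ':ℤ) + (p:ℤ)^1 * r) (1+m) ≤ Z0 := by
    intro r hr
    refine (Zf_le p k n (by omega) F hS.nonneg (ρ':ℤ) 1 m hbn' r hr).trans ?_
    have := Zf_le p k n (by omega) F hS.nonneg 0 0 1 (by omega) ρ' (by simpa using h2)
    simpa using this
  have hnd : ∀ r : ℕ, ¬ (p:ℤ) ∣ (ρ:ℤ) - ((ρ':ℤ) + (p:ℤ)^1 * r) := by
    intro r hdv
    have h3 : (p:ℤ) ∣ (ρ:ℤ) - ρ' := by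
      have := dvd_add hdv (Dvd.intro (r:ℤ) rfl : (p:ℤ) ∣ (p:ℤ) * r)
      have e : (ρ:ℤ) - ((ρ':ℤ) + (p:ℤ)^1 * r) + p * r = ρ - ρ' := by ring
      rwa [e] at this
    have := Int.eq_zero_of_abs_lt_dvd h3 (by rw [abs_lt]; constructor <;> omega)
    omega
  have each : ∀ r ∈ Finset.range (p^m), BL k F l (ρ:ℤ) 1 ((ρ':ℤ) + (p:ℤ)^1 * (r:ℕ)) (1+m) ≤
      A * B^t * (p:ℝ)^(η * n - ((qq k:ℝ)+2) * ((1+m:ℕ):ℝ)) * Z0 := by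
    intro r hr
    have := Pt p k n hp hk F A η η0 B ε hA hB hε hη0 hη hS t l hl (ρ:ℤ) ((ρ':ℤ) + (p:ℤ)^1 * r) 1 (1+m) (by omega) hd hbn le_rfl (by omega)
      (by
        have : l * 1 ≤ 1 * (1+m) := by omega
        exact this.trans (Nat.mul_le_mul_right _ (by omega))) (hnd r)
    refine this.trans ?_
    have y1 : (Zf p k n F (ρ:ℤ) 1)^((qq l:ℝ)/qq k) ≤ Z0^((qq l:ℝ)/qq k) := rpow_le_rpow (hZ _ _) z1 (by positivity)
    have tt : (0:ℝ) ≤ 1 - (qq l:ℝ)/qq k := by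
      rw [sub_nonneg, div_le_one hqk]; exact_mod_cast hq.le
    have y2 : (Zf p k n F ((ρ':ℤ) + (p:ℤ)^1 * r) (1+m))^(1-(qq l:ℝ)/qq k) ≤ Z0^(1-(qq l:ℝ)/qq k) :=
      rpow_le_rpow (hZ _ _) (z2 r (Finset.mem_range.1 hr)) tt
    have y3 : (p:ℝ)^(η * n - yy k η0 ε t l * ((1+m:ℕ):ℝ)) ≤ (p:ℝ)^(η * n - ((qq k:ℝ)+2) * ((1+m:ℕ):ℝ)) := by
      apply rpow_le_rpow_of_exponent_le hP
      have : (0:ℝ) ≤ ((1+m:ℕ):ℝ) := by positivity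
      nlinarith
    have y4 : Z0^((qq l:ℝ)/qq k) * Z0^(1-(qq l:ℝ)/qq k) = Z0 := by
      rw [hZ0, ← rpow_add_of_nonneg (hZ _ _) (by positivity) tt]; simp
    have c0 : 0 ≤ A * B^t := by positivity
    calc _ ≤ A * B^t * (p:ℝ)^(η * n - ((qq k:ℝ)+2) * ((1+m:ℕ):ℝ)) * Z0^((qq l:ℝ)/qq k) * Z0^(1-(qq l:ℝ)/qq k) := by
          have w1 := rpow_nonneg (hZ ((ρ':ℤ) + (p:ℤ)^1 * r) (1+m)) (1-(qq l:ℝ)/qq k)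
          have w2 := rpow_nonneg (hZ (ρ:ℤ) 1) ((qq l:ℝ)/qq k)
          have w3 := rpow_nonneg (hZ 0 0) ((qq l:ℝ)/qq k)
          gcongr
      _ = _ := by rw [mul_assoc _ (Z0^_) (Z0^_), y4]
  have hsp : ∀ β, F (ρ:ℤ) 1 β^(qq l) * F (ρ':ℤ) 1 β^(qq k - qq l) ≤
     (p:ℝ)^(m * qq k) * ∑ r ∈ Finset.range (p^m), F (ρ:ℤ) 1 β^(qq l) * F ((ρ':ℤ) + (p:ℤ)^1 * (r:ℕ)) (1+m) β^(qq k - qq l) := by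
    intro β
    have s1 := pow_le_pow_left₀ (hS.nonneg (ρ':ℤ) 1 β) (hS.split (ρ':ℤ) 1 m β) (qq k - qq l)
    have s2 := pow_sum_le_card (Finset.range (p^m)) (fun r : ℕ => F ((ρ':ℤ) + (p:ℤ)^1 * r) (1+m) β) (fun r => hS.nonneg _ _ _) (qq k - qq l) (by omega)
    have s3 : ((Finset.range (p^m)).card:ℝ)^(qq k - qq l - 1) ≤ (p:ℝ)^(m * qq k) := by
      rw [Finset.card_range, Nat.cast_pow, ← pow_mul]
      exact pow_le_pow_right₀ hP (Nat.mul_le_mul_left _ (by omega))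
    have s4 : 0 ≤ ∑ r ∈ Finset.range (p^m), F ((ρ':ℤ) + (p:ℤ)^1 * (r:ℕ)) (1+m) β^(qq k - qq l) :=
      Finset.sum_nonneg fun r _ => pow_nonneg (hS.nonneg _ _ _) _
    have s5 := pow_nonneg (hS.nonneg (ρ:ℤ) 1 β) (qq l)
    rw [← Finset.mul_sum, mul_left_comm]
    refine mul_le_mul_of_nonneg_left ?_ s5
    refine s1.trans (s2.trans ?_)
    gcongr
  refine (Finset.sum_le_sum fun β _ => hsp β).trans ?_
  rw [← Finset.mul_sum, Finset.sum_comm]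
  have := Finset.sum_le_sum each
  rw [Finset.sum_const, Finset.card_range, nsmul_eq_mul] at this
  unfold BL at this
  refine (mul_le_mul_of_nonneg_left this (by positivity)).trans ?_
  have key : (p:ℝ)^(m * qq k) * ((p^m:ℕ):ℝ) * (p:ℝ)^(η * n - ((qq k:ℝ)+2) * ((1+m:ℕ):ℝ)) ≤ (p:ℝ)^(η * n - ((1+m:ℕ):ℝ)) := by
    rw [Nat.cast_pow, ← rpow_natCast, ← rpow_natCast, ← rpow_add hP0, ← rpow_add hP0]
    apply rpow_le_rpow_of_exponent_le hP
    push_cast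
    nlinarith
  have c0 : 0 ≤ A * B^t * Z0 := mul_nonneg (by positivity) (hZ _ _)
  calc _ = A * B^t * Z0 * ((p:ℝ)^(m * qq k) * ((p^m:ℕ):ℝ) * (p:ℝ)^(η * n - ((qq k:ℝ)+2) * ((1+m:ℕ):ℝ))) := by ring
    _ ≤ A * B^t * Z0 * (p:ℝ)^(η * n - ((1+m:ℕ):ℝ)) := mul_le_mul_of_nonneg_left key c0
    _ = _ := by ring

lemma sys_improve (p k n : ℕ) (hp : 2 ≤ p) (hk : 2 ≤ k) (hpk : 2^(qq k + 1) ≤ p^(hh k)) {Ω : Type} [Fintype Ω] (F : ℤ → ℕ → Ω → ℝ) (A η η0 B ε : ℝ)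
    (hA : 1 ≤ A) (hB : 1 ≤ B) (hε : 0 ≤ ε) (hη0 : 0 ≤ η0) (hη : η0 ≤ η)
    (hS : Sys p k n F A η B ε) (t l b : ℕ) (hl : l < k) (hl1 : 1 ≤ l) (hy : (qq k : ℝ) + 2 ≤ yy k η0 ε t l)
    (hkb : k ≤ b) (hd : k.factorial^t ∣ b) (hbn : k^t * b ≤ n) (A' : ℝ) (hA' : 0 ≤ A')
    (hnar : ∀ ρ : ℕ, ∑ β, F (ρ:ℤ) 1 β^(qq k) ≤ A' * Zf p k n F ρ 1) :
    ∑ β, F 0 0 β^(qq k) ≤ (A'/2 + (p:ℝ)^(2 * qq k + 2) * (A * B^t * (p:ℝ)^(η * n - b))) * Zf p k n F 0 0 := by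
  have hP : (2:ℝ) ≤ p := by exact_mod_cast hp
  have hP0 : (0:ℝ) < p := by linarith
  have hbn' : b ≤ n := le_trans (Nat.le_mul_of_pos_left _ (by positivity)) hbn
  have hq := qq_lt l k hl
  have hZ := Zf_nonneg p k n F hS.nonneg
  have e : qq l + (qq k - qq l) = qq k := by omega
  have h1 : ∀ β, F 0 0 β^(qq k) ≤ 2^(qq k) * ∑ r ∈ Finset.range p, F (r:ℕ) 1 β^(qq k) +
      (2*(p:ℝ))^(qq k) * ∑ r ∈ Finset.range p, ∑ r' ∈ (Finset.range p).filter (fun r' => r' ≠ r), F (r:ℕ) 1 β^(qq l) * F (r':ℕ) 1 β^(qq k - qq l) := by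
    intro β
    have hs := hS.split 0 0 1 β
    simp only [pow_zero, one_mul, zero_add, pow_one] at hs
    have := broad_narrow p (by omega) (F 0 0 β) (fun r => F (r:ℕ) 1 β) (fun r => hS.nonneg _ _ _) (hS.nonneg _ _ _) hs (qq l) (qq k - qq l)
    rw [e] at this
    exact this
  refine (Finset.sum_le_sum fun β _ => h1 β).trans ?_
  rw [Finset.sum_add_distrib, ← Finset.mul_sum, ← Finset.mul_sum, Finset.sum_comm, add_mul]
  refine add_le_add ?_ ?_
  · have h2 : ∑ r ∈ Finset.range p, ∑ β, F (r:ℕ) 1 β^(qq k) ≤ A' * ∑ r ∈ Finset.range p, Zf p k n F (r:ℕ) 1 := by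
      rw [Finset.mul_sum]
      exact Finset.sum_le_sum fun r _ => hnar r
    have h3 := Zf_split p k n F 0 0 1 (by omega)
    simp only [pow_zero, one_mul, zero_add, pow_one] at h3
    rw [← h3]
    set zs := ∑ r ∈ Finset.range p, Zf p k n F (r:ℕ) 1 with hzs
    have hz0 : 0 ≤ zs := Finset.sum_nonneg fun r _ => hZ _ _
    have h4 : (2:ℝ)^(qq k) * 2 ≤ (p:ℝ)^(hh k) := by rw [← pow_succ]; exact_mod_cast hpk
    calc _ ≤ 2^(qq k) * (A' * zs) := mul_le_mul_of_nonneg_left h2 (by positivity)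
      _ = (2^(qq k) * 2) * (A'/2 * zs) := by ring
      _ ≤ (p:ℝ)^(hh k) * (A'/2 * zs) := mul_le_mul_of_nonneg_right h4 (by positivity)
      _ = _ := by ring
  · rw [Finset.sum_comm]
    simp_rw [Finset.sum_comm (s := Finset.univ)]
    set T := A * B^t * (p:ℝ)^(η * n - b) * Zf p k n F 0 0 with hT
    have hT0 : 0 ≤ T := mul_nonneg (by positivity) (hZ _ _)
    have h2 : ∑ r ∈ Finset.range p, ∑ r' ∈ (Finset.range p).filter (fun r' => r' ≠ r), ∑ β, F (r:ℕ) 1 β^(qq l) * F (r':ℕ) 1 β^(qq k - qq l) ≤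
       ∑ r ∈ Finset.range p, ∑ r' ∈ Finset.range p, T := by
      refine Finset.sum_le_sum fun r hr => ?_
      refine le_trans (Finset.sum_le_sum (g := fun _ => T) fun r' hr' => ?_) (Finset.sum_le_sum_of_subset_of_nonneg (Finset.filter_subset _ _) fun _ _ _ => hT0)
      obtain ⟨m1, m2⟩ := Finset.mem_filter.1 hr'
      exact sys_broad p k n hp hk F A η η0 B ε hA hB hε hη0 hη hS t l b hl hl1 hy hkb hd hbn r r' (Finset.mem_range.1 hr) (Finset.mem_range.1 m1) m2
    simp only [Finset.sum_const, Finset.card_range, nsmul_eq_mul] at h2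
    have h3 : (2*(p:ℝ))^(qq k) ≤ (p:ℝ)^(2 * qq k) := by
      rw [pow_mul, pow_two]
      exact pow_le_pow_left₀ (by positivity) (by nlinarith) _
    calc _ ≤ (2*(p:ℝ))^(qq k) * (p * (p * T)) := mul_le_mul_of_nonneg_left h2 (by positivity)
      _ ≤ (p:ℝ)^(2 * qq k) * (p * (p * T)) := mul_le_mul_of_nonneg_right h3 (by positivity)
      _ = _ := by rw [hT, pow_add]; ring

lemma ff_split (K p N k : ℕ) [Fact p.Prime] (W : Polynomial ℤ) (D : Dat) (ξ : ℤ) (a m : ℕ)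
    (β : Fin k → ZMod (p^N)) :
    ff K p N k W D ξ a β = ∑ r ∈ Finset.range (p^m), ff K p N k W D (ξ + (p:ℤ)^a * (r:ℕ)) (a+m) β := by
  have hp : 0 < p := (Fact.out : p.Prime).pos
  have hp0 : (p:ℤ)^a ≠ 0 := pow_ne_zero _ (by exact_mod_cast hp.ne')
  unfold ff
  simp_rw [Finset.sum_filter]
  rw [Finset.sum_comm]
  refine Finset.sum_congr rfl fun x _ => ?_
  by_cases h : (p:ℤ)^a ∣ D.u x - ξ
  · rw [if_pos h]
    obtain ⟨v, hv⟩ := h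
    have hpm : (0:ℤ) < (p:ℤ)^m := by positivity
    have key : ∀ r : ℕ, r ∈ Finset.range (p^m) →
       ((p:ℤ)^(a+m) ∣ D.u x - (ξ + (p:ℤ)^a * (r:ℕ)) ↔ r = (v % (p:ℤ)^m).toNat) := by
      intro r hr
      have hr' := Finset.mem_range.1 hr
      have e : D.u x - (ξ + (p:ℤ)^a * (r:ℕ)) = (p:ℤ)^a * (v - r) := by linear_combination hv
      rw [e, pow_add, mul_dvd_mul_iff_left hp0, ← Int.emod_eq_emod_iff_emod_sub_eq_zero.trans Int.dvd_iff_emod_eq_zero.symm]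
      have h1 := Int.emod_nonneg v hpm.ne'
      have h2 : (r:ℤ) % (p:ℤ)^m = r := Int.emod_eq_of_lt (by positivity) (by exact_mod_cast hr')
      rw [h2]; omega
    have hmem : (v % (p:ℤ)^m).toNat ∈ Finset.range (p^m) := by
      rw [Finset.mem_range]
      have h1 := Int.emod_nonneg v hpm.ne'
      have h2 := Int.emod_lt_of_pos v hpm
      have : ((v % (p:ℤ)^m).toNat : ℤ) < ((p^m:ℕ):ℤ) := by rw [Int.toNat_of_nonneg h1]; push_cast; exact h2
      exact_mod_cast this
    rw [Finset.sum_eq_single_of_mem _ hmem]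
    · rw [if_pos ((key _ hmem).2 rfl)]
    · intro r hr hne
      rw [if_neg]
      exact fun hh => hne ((key r hr).1 hh)
  · rw [if_neg h]
    symm
    refine Finset.sum_eq_zero fun r _ => ?_
    rw [if_neg]
    intro hh
    apply h
    have h1 : (p:ℤ)^a ∣ D.u x - (ξ + (p:ℤ)^a * (r:ℕ)) := (pow_dvd_pow _ (by omega)).trans hh
    have := dvd_add h1 (Dvd.intro (r:ℤ) rfl : (p:ℤ)^a ∣ (p:ℤ)^a * r)
    have e : D.u x - (ξ + (p:ℤ)^a * (r:ℕ)) + (p:ℤ)^a * r = D.u x - ξ := by ring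
    rwa [e] at this

def Good (K p l : ℕ) [Fact p.Prime] (η : ℝ) : Prop :=
  ∃ C : ℝ, 1 ≤ C ∧ ∀ m : ℕ, Dec K p l m (C * (p:ℝ)^(η * m))

lemma Dec_mono (K p l m : ℕ) [Fact p.Prime] (B B' : ℝ) (h : B ≤ B') (hd : Dec K p l m B) : Dec K p l m B' := by
  intro W hW D
  refine (hd W hW D).trans ?_
  have : 0 ≤ ∑ r ∈ Finset.range (p^m), ∑ β, ‖ff K p (l*m) l W D (r:ℤ) m β‖^(qq l) := by positivity
  gcongr

lemma good_mono (K p l : ℕ) [Fact p.Prime] (η η' : ℝ) (h : η ≤ η') (hg : Good K p l η) : Good K p l η' := by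
  obtain ⟨C, hC, hd⟩ := hg
  refine ⟨C, hC, fun m => Dec_mono K p l m _ _ ?_ (hd m)⟩
  have hP : (1:ℝ) ≤ p := by exact_mod_cast (Fact.out : p.Prime).one_le
  have := rpow_le_rpow_of_exponent_le hP (mul_le_mul_of_nonneg_right h (Nat.cast_nonneg m))
  gcongr

lemma good_triv (K p l : ℕ) [Fact p.Prime] (hl : 1 ≤ l) : Good K p l (qq l) := by
  refine ⟨1, le_rfl, fun m W _ D => ?_⟩
  have hP : (1:ℝ) ≤ p := by exact_mod_cast (Fact.out : p.Prime).one_le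
  rw [one_mul, Finset.sum_comm, Finset.mul_sum]
  refine Finset.sum_le_sum fun β _ => ?_
  have h1 := ff_split K p (l*m) l W D 0 0 m β
  simp only [pow_zero, one_mul, zero_add] at h1
  rw [h1]
  refine (pow_le_pow_left₀ (norm_nonneg _) (norm_sum_le _ _) _).trans ?_
  have hq : 1 ≤ qq l := by unfold qq; nlinarith
  refine (pow_sum_le_card _ _ (fun _ => norm_nonneg _) _ hq).trans ?_
  refine mul_le_mul_of_nonneg_right ?_ (by positivity)
  rw [Finset.card_range, Nat.cast_pow, ← pow_mul, ← Nat.cast_mul, rpow_natCast, ← pow_add]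
  apply pow_le_pow_right₀ hP
  have : m * (qq l - 1) ≤ qq l * m := by rw [mul_comm]; exact Nat.mul_le_mul_right _ (by omega)
  omega

lemma ff_sys (K p k n : ℕ) [Fact p.Prime] (hk : 1 ≤ k) (hkK : k ≤ K) (W : Polynomial ℤ) (hW : InW K p k W) (D : Dat)
    (A η B ε : ℝ) (hA : ∀ m : ℕ, Dec K p k m (A * (p:ℝ)^(η * m)))
    (hB : ∀ l, 1 ≤ l → l < k → ∀ m : ℕ, Dec K p l m (B * (p:ℝ)^(ε * m))) :
    Sys p k n (fun ξ a (β : Fin k → ZMod (p^(k*n))) => ‖ff K p (k*n) k W D ξ a β‖) A η B ε where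
  nonneg := fun _ _ _ => norm_nonneg _
  split := fun ξ a m β => by
    rw [ff_split K p (k*n) k W D ξ a m β]
    exact norm_sum_le _ _
  full := fun ξ a ha => by
    have := AL K p (k*n) k k (n-a) le_rfl hkK W hW D 0 ξ a (by rw [Nat.sub_add_cancel ha]) (Or.inl rfl) (fun _ => 1)
      (fun _ => zero_le_one) (fun _ _ => rfl) _ (hA (n-a))
    simp only [one_mul] at this
    have e : a + (n - a) = n := by omega
    rw [e, Nat.cast_sub ha] at this
    rw [← mul_assoc]; exact this
  low := fun l hl hlk ξ ζ a b m ha hpx hlb hbn => by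
    have hN : l * (m + a) ≤ k * n := by
      refine hlb.trans (Nat.mul_le_mul (by omega) hbn)
    have := AL K p (k*n) k l m hlk.le hkK W hW D ζ ξ a hN (Or.inr ⟨ha, hpx⟩)
      (fun β => ‖ff K p (k*n) k W D ζ b β‖^(qq k - qq l)) (fun _ => by positivity)
      (fun β γ => by
        rw [norm_ff_inv K p (k*n) k l m hlk.le hkK W hW.1 D ζ ξ a b hN hlb β γ]) _ (hB l hl hlk m)
    simp only [mul_comm (‖ff K p (k*n) k W D ζ b _‖^(qq k - qq l))] at this
    exact this

set_option maxHeartbeats 1000000 in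
lemma good_improve (K p k : ℕ) [Fact p.Prime] (hk : 2 ≤ k) (hkK : k ≤ K) (hp : 16 < p)
    (hlow : ∀ l, 1 ≤ l → l < k → ∀ ε : ℝ, 0 < ε → Good K p l ε) (η0 : ℝ) (hη0 : 0 < η0) :
    ∃ σ : ℝ, 0 < σ ∧ ∀ η, η0 ≤ η → Good K p k η → Good K p k (max η0 (η - σ)) := by
  have hP : (1:ℝ) ≤ p := by exact_mod_cast (Fact.out : p.Prime).one_le
  have hP0 : (0:ℝ) < p := by linarith
  have hk0 : (0:ℝ) < k := by exact_mod_cast (by omega : 0 < k)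
  have hk2 : (2:ℝ) ≤ k := by exact_mod_cast hk
  set ε : ℝ := η0 / (2 * k^2) with hε
  have hε0 : 0 < ε := by positivity
  -- common constant B
  have hBex : ∃ B : ℝ, 1 ≤ B ∧ ∀ l, 1 ≤ l → l < k → ∀ m : ℕ, Dec K p l m (B * (p:ℝ)^(ε * m)) := by
    have : ∀ j, j ≤ k → ∃ B : ℝ, 1 ≤ B ∧ ∀ l, 1 ≤ l → l < j → ∀ m : ℕ, Dec K p l m (B * (p:ℝ)^(ε * m)) := by
      intro j
      induction j with
      | zero => intro _; exact ⟨1, le_rfl, fun l _ h => by omega⟩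
      | succ j ih =>
        intro hj
        obtain ⟨B, hB, h⟩ := ih (by omega)
        rcases Nat.eq_zero_or_pos j with rfl | hj0
        · exact ⟨1, le_rfl, fun l _ h => by omega⟩
        obtain ⟨C, hC, h'⟩ := hlow j hj0 (by omega) ε hε0
        refine ⟨max B C, le_max_of_le_left hB, fun l hl hlj m => ?_⟩
        rcases Nat.lt_succ_iff_lt_or_eq.1 hlj with h1 | h1
        · refine Dec_mono K p l m _ _ ?_ (h l hl h1 m)
          have := le_max_left B C
          gcongr
        · subst h1
          refine Dec_mono K p l m _ _ ?_ (h' m)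
          have := le_max_right B C
          gcongr
    exact this k le_rfl
  obtain ⟨B, hB1, hB⟩ := hBex
  -- choose t, l
  set κ : ℝ := ((k:ℝ)-1) * (η0 / k - k * ε) with hκ
  have hκ0 : 0 < κ := by
    have : η0 / k - k * ε = η0 / (2*k) := by rw [hε]; field_simp; norm_num
    rw [hκ, this]
    have : 0 < (k:ℝ) - 1 := by linarith
    positivity
  obtain ⟨t, ht⟩ := exists_nat_ge ((((k:ℝ)-1) * (qq k + 2)) / κ)
  rw [div_le_iff₀ hκ0] at ht
  have hyl : ∃ l ∈ Finset.Ico 1 k, (qq k : ℝ) + 2 ≤ yy k η0 ε t l := by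
    by_contra hcon
    push Not at hcon
    have h1 := Finset.sum_lt_sum_of_nonempty (s := Finset.Ico 1 k) (by rw [Finset.nonempty_Ico]; omega) hcon
    rw [yy_sum k (by omega), Finset.sum_const, Nat.card_Ico, nsmul_eq_mul] at h1
    have : ((k-1:ℕ):ℝ) = (k:ℝ) - 1 := by push_cast [(by omega : 1 ≤ k)]; ring
    rw [this] at h1
    linarith
  obtain ⟨l, hl, hy⟩ := hyl
  obtain ⟨hl1, hlk⟩ := Finset.mem_Ico.1 hl
  set D : ℕ := k^t * k.factorial^t with hD
  have hD0 : 0 < D := by have := k.factorial_pos; positivity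
  have hD0' : (0:ℝ) < D := by exact_mod_cast hD0
  refine ⟨1/D, by positivity, fun η hη hg => ?_⟩
  obtain ⟨A, hA1, hA⟩ := hg
  set η' := max η0 (η - 1/D) with hη'
  have hη'0 : 0 ≤ η' := le_max_of_le_left hη0.le
  set C1 : ℝ := 2 * ((p:ℝ)^(2 * qq k + 3 + k) * (A * B^t)) with hC1
  have hABt : 1 ≤ A * B^t := by
    have : 1 ≤ B^t := one_le_pow₀ hB1
    nlinarith
  have hpp : ∀ j : ℕ, (1:ℝ) ≤ (p:ℝ)^j := fun j => one_le_pow₀ hP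
  have hC1' : 1 ≤ C1 := by
    have := hpp (2 * qq k + 3 + k)
    nlinarith
  have hexpn : ∀ n : ℕ, (p:ℝ)^(η * n) ≤ (p:ℝ)^(η' * n + n/D) := by
    intro n
    apply rpow_le_rpow_of_exponent_le hP
    have h1 : η - 1/D ≤ η' := le_max_right _ _
    have h2 : (0:ℝ) ≤ n := by positivity
    have h3 : (n:ℝ)/D = 1/D * n := by ring
    rw [h3]; nlinarith
  refine ⟨C1, hC1', fun n => ?_⟩
  induction n with
  | zero =>
    refine Dec_mono K p k 0 _ _ ?_ (hA 0)
    simp only [Nat.cast_zero, mul_zero, rpow_zero, mul_one]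
    have := hpp (2 * qq k + 3 + k)
    have : A ≤ A * B^t := le_mul_of_one_le_right (by linarith) (one_le_pow₀ hB1)
    nlinarith
  | succ n ih =>
    by_cases hn : n + 1 < k * D
    · refine Dec_mono K p k (n+1) _ _ ?_ (hA (n+1))
      refine (mul_le_mul_of_nonneg_left (hexpn (n+1)) (by linarith)).trans ?_
      rw [rpow_add hP0]
      have h1 : (p:ℝ)^(((n+1:ℕ):ℝ)/D) ≤ (p:ℝ)^(2 * qq k + 3 + k) := by
        rw [← rpow_natCast (p:ℝ) (2 * qq k + 3 + k)]
        apply rpow_le_rpow_of_exponent_le hP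
        rw [div_le_iff₀ hD0']
        have : ((n+1:ℕ):ℝ) ≤ k * D := by exact_mod_cast hn.le
        push_cast at this ⊢
        nlinarith [(Nat.cast_nonneg (qq k) : (0:ℝ) ≤ qq k)]
      have h2 : A ≤ A * B^t := le_mul_of_one_le_right (by linarith) (one_le_pow₀ hB1)
      have h3 : 0 ≤ (p:ℝ)^(η' * ((n+1:ℕ):ℝ)) := by positivity
      calc A * ((p:ℝ)^(η' * ((n+1:ℕ):ℝ)) * (p:ℝ)^(((n+1:ℕ):ℝ)/D))
          ≤ (A * B^t) * ((p:ℝ)^(η' * ((n+1:ℕ):ℝ)) * (p:ℝ)^(2 * qq k + 3 + k)) := by gcongr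
        _ = (C1/2) * (p:ℝ)^(η' * ((n+1:ℕ):ℝ)) := by rw [hC1]; ring
        _ ≤ _ := by gcongr; linarith
    · push Not at hn
      set c := (n+1)/D with hc
      have hck : k ≤ c := by rw [hc, Nat.le_div_iff_mul_le hD0]; exact hn
      set b := k.factorial^t * c with hb
      have hcb : c ≤ b := Nat.le_mul_of_pos_left _ (by have := k.factorial_pos; positivity)
      intro W hW Dd
      have hS := ff_sys K p k (n+1) (by omega) hkK W hW Dd A η B ε hA hB
      have hpk : 2^(qq k + 1) ≤ p^(hh k) := by
        have e : 4 * hh k ≥ qq k + 1 := by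
          have h1 : ((hh k:ℕ):ℝ) = _ := hh_cast k (by omega)
          have h2 : ((qq k:ℕ):ℝ) = _ := qq_cast k
          have : ((qq k + 1:ℕ):ℝ) ≤ ((4 * hh k:ℕ):ℝ) := by push_cast; rw [h1, h2]; nlinarith
          exact_mod_cast this
        calc 2^(qq k + 1) ≤ 2^(4 * hh k) := Nat.pow_le_pow_right (by norm_num) e
          _ = 16^(hh k) := by rw [pow_mul]; norm_num
          _ ≤ p^(hh k) := Nat.pow_le_pow_left (by omega) _
      have hmain := sys_improve p k (n+1) (by omega) hk hpk _ A η η0 B ε hA1 hB1 hε0.le hη0.le hη hS t l b hlk hl1 hy (hck.trans hcb)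
        ⟨c, rfl⟩ (by
          calc k^t * b = D * c := by rw [hb, hD]; ring
            _ ≤ n+1 := Nat.mul_div_le _ _) (C1 * (p:ℝ)^(η' * n)) (by positivity) (fun ρ => by
          have := AL K p (k*(n+1)) k k n le_rfl hkK W hW Dd 0 (ρ:ℤ) 1 le_rfl (Or.inl rfl) (fun _ => 1)
            (fun _ => zero_le_one) (fun _ _ => rfl) _ ih
          simp only [one_mul] at this
          unfold Zf
          rw [add_comm 1 n] at this
          simp only [Nat.add_sub_cancel]
          rw [← mul_assoc]; exact this)
      unfold Zf at hmain
      simp only [Nat.sub_zero, pow_zero, one_mul, zero_add] at hmain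
      refine hmain.trans ?_
      rw [← mul_assoc]
      refine mul_le_mul_of_nonneg_right ?_ (by positivity)
      refine mul_le_mul_of_nonneg_right ?_ (by positivity)
      have h1 : (p:ℝ)^(η' * n) ≤ (p:ℝ)^(η' * ((n+1:ℕ):ℝ)) := by
        apply rpow_le_rpow_of_exponent_le hP
        push_cast; nlinarith
      have h2 : (p:ℝ)^(η * ((n+1:ℕ):ℝ) - b) ≤ (p:ℝ)^(η' * ((n+1:ℕ):ℝ)) * p := by
        have e : (p:ℝ)^(η' * ((n+1:ℕ):ℝ)) * p = (p:ℝ)^(η' * ((n+1:ℕ):ℝ) + 1) := by rw [rpow_add hP0, rpow_one]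
        rw [e]
        apply rpow_le_rpow_of_exponent_le hP
        have g1 : η - 1/D ≤ η' := le_max_right _ _
        have g2 : (0:ℝ) ≤ ((n+1:ℕ):ℝ) := by positivity
        have g3 : ((n+1:ℕ):ℝ)/D ≤ c + 1 := by
          rw [div_le_iff₀ hD0']
          have := Nat.lt_mul_div_succ (n+1) hD0
          have h5 : ((n+1:ℕ):ℝ) < (D:ℝ) * (c+1) := by exact_mod_cast this
          linarith
        have g4 : (c:ℝ) ≤ b := by exact_mod_cast hcb
        have g5 : ((n+1:ℕ):ℝ)/D = 1/D * ((n+1:ℕ):ℝ) := by ring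
        rw [g5] at g3
        nlinarith
      set x := (p:ℝ)^(η' * ((n+1:ℕ):ℝ)) with hx
      have hx0 : 0 < x := by positivity
      have h3 : (p:ℝ)^(2 * qq k + 2) * (A * B^t * (p:ℝ)^(η * ((n+1:ℕ):ℝ) - b)) ≤ C1/2 * x := by
        calc _ ≤ (p:ℝ)^(2 * qq k + 2) * (A * B^t * (x * p)) := by gcongr
          _ = (p:ℝ)^(2 * qq k + 3) * (A * B^t) * x := by rw [pow_succ (p:ℝ) (2 * qq k + 2)]; ring
          _ ≤ (p:ℝ)^(2 * qq k + 3 + k) * (A * B^t) * x := by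
              have := pow_le_pow_right₀ hP (by omega : 2 * qq k + 3 ≤ 2 * qq k + 3 + k)
              gcongr
          _ = _ := by rw [hC1]; ring
      have h4 : C1 * (p:ℝ)^(η' * n) / 2 ≤ C1 / 2 * x := by
        have := mul_le_mul_of_nonneg_left h1 (by linarith : (0:ℝ) ≤ C1/2)
        linarith
      linarith

lemma char_sum_zmod (M k : ℕ) [NeZero M] (v : Fin k → ZMod M) :
    ∑ β : Fin k → ZMod M, (ZMod.stdAddChar (∑ j, β j * v j) : ℂ) = if v = 0 then (M:ℂ)^k else 0 := by
  have h1 : ∀ β : Fin k → ZMod M, (ZMod.stdAddChar (∑ j, β j * v j) : ℂ) = ∏ j, (ZMod.stdAddChar (β j * v j) : ℂ) := by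
    intro β
    induction (Finset.univ : Finset (Fin k)) using Finset.induction_on with
    | empty => simp
    | insert a s ha ih => rw [Finset.sum_insert ha, Finset.prod_insert ha, AddChar.map_add_eq_mul, ih]
  simp_rw [h1]
  rw [← Fintype.prod_sum (fun j (b : ZMod M) => (ZMod.stdAddChar (b * v j) : ℂ))]
  have h2 : ∀ w : ZMod M, ∑ b : ZMod M, (ZMod.stdAddChar (b * w) : ℂ) = if w = 0 then (M:ℂ) else 0 := by
    intro w
    have := AddChar.sum_mulShift w (ZMod.isPrimitive_stdAddChar M)
    rw [this, ZMod.card]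
    split_ifs <;> simp
  simp_rw [h2]
  split_ifs with h
  · subst h; simp
  · obtain ⟨j, hj⟩ := Function.ne_iff.1 h
    exact Finset.prod_eq_zero (Finset.mem_univ j) (by simp only [if_neg (show v j ≠ 0 from hj)])

lemma l2_orth {ι : Type*} (M k : ℕ) [NeZero M] (S : Finset ι) (c : ι → ℂ) (g : ι → Fin k → ZMod M) :
    ((∑ β : Fin k → ZMod M, ‖∑ x ∈ S, c x * (ZMod.stdAddChar (∑ j, β j * g x j) : ℂ)‖^2 : ℝ) : ℂ) =
    (M:ℂ)^k * ∑ x ∈ S, ∑ y ∈ S, if g x = g y then c x * (starRingEnd ℂ) (c y) else 0 := by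
  push_cast
  have h1 : ∀ z : ℂ, ((‖z‖:ℝ):ℂ)^2 = z * (starRingEnd ℂ) z := by
    intro z; rw [Complex.mul_conj, Complex.normSq_eq_norm_sq]; push_cast; rfl
  simp_rw [h1, map_sum, Finset.sum_mul_sum]
  rw [Finset.sum_comm, Finset.mul_sum]
  refine Finset.sum_congr rfl fun x _ => ?_
  rw [Finset.sum_comm, Finset.mul_sum]
  refine Finset.sum_congr rfl fun y _ => ?_
  have h2 : ∀ β : Fin k → ZMod M, c x * (ZMod.stdAddChar (∑ j, β j * g x j) : ℂ) *
      (starRingEnd ℂ) (c y * (ZMod.stdAddChar (∑ j, β j * g y j) : ℂ)) =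
      c x * (starRingEnd ℂ) (c y) * (ZMod.stdAddChar (∑ j, β j * (g x - g y) j) : ℂ) := by
    intro β
    have : ∑ j, β j * (g x - g y) j = ∑ j, β j * g x j + -(∑ j, β j * g y j) := by
      simp only [Pi.sub_apply, mul_sub, Finset.sum_sub_distrib]; ring
    rw [this, AddChar.map_add_eq_mul, AddChar.map_neg_eq_conj, map_mul]
    ring
  simp_rw [h2]
  rw [← Finset.mul_sum, char_sum_zmod]
  simp only [sub_eq_zero]
  split_ifs <;> ring

lemma dvd_sub_iff_cast (M : ℕ) (x y : ℤ) : ((x : ZMod M) = (y : ZMod M)) ↔ (M:ℤ) ∣ x - y := by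
  rw [← sub_eq_zero, ← Int.cast_sub, ZMod.intCast_zmod_eq_zero_iff_dvd _ M]

lemma good_one (K p : ℕ) [Fact p.Prime] (hK : 1 ≤ K) (hpK : K < p) : ∀ ε : ℝ, 0 < ε → Good K p 1 ε := by
  intro ε hε
  have hp : p.Prime := Fact.out
  have hP : (1:ℝ) ≤ p := by exact_mod_cast hp.one_le
  refine ⟨1, le_rfl, fun m => ?_⟩
  suffices h : Dec K p 1 m 1 by
    refine Dec_mono K p 1 m _ _ ?_ h
    rw [one_mul]; exact one_le_rpow hP (by positivity)
  intro W hW D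
  have e1 : qq 1 = 2 := rfl
  have e2 : hh 1 = 0 := rfl
  rw [e1, e2, mul_zero, pow_zero, one_mul (1:ℝ)]
  have e3 : ∀ z : ℝ, 1 * z = z := one_mul
  rw [e3]
  apply le_of_eq
  have key : ∀ (ξ : ℤ) (a : ℕ), ((∑ β, ‖ff K p (1*m) 1 W D ξ a β‖^2 : ℝ):ℂ) = ((p^(1*m):ℕ):ℂ)^1 *
      ∑ x ∈ D.S, ∑ y ∈ D.S, if (p:ℤ)^a ∣ D.u x - ξ ∧ (p:ℤ)^a ∣ D.u y - ξ ∧ (p:ℤ)^m ∣ D.u x - D.u y then D.c x * (starRingEnd ℂ) (D.c y) else 0 := by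
    intro ξ a
    have := l2_orth (p^(1*m)) 1 (D.S.filter (fun x => (p:ℤ)^a ∣ D.u x - ξ)) D.c
      (fun x j => (((AD K (W * Polynomial.X^(j:ℕ))).eval (D.u x) : ℤ) : ZMod (p^(1*m))))
    unfold ff Ph ee
    rw [this]
    congr 1
    rw [Finset.sum_filter]
    refine Finset.sum_congr rfl fun x _ => ?_
    by_cases hx : (p:ℤ)^a ∣ D.u x - ξ
    · simp only [hx, if_true, true_and]
      rw [Finset.sum_filter]
      refine Finset.sum_congr rfl fun y _ => ?_
      by_cases hy : (p:ℤ)^a ∣ D.u y - ξ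
      · simp only [hy, if_true, true_and]
        have : ((fun j : Fin 1 => (((AD K (W * Polynomial.X^(j:ℕ))).eval (D.u x) : ℤ) : ZMod (p^(1*m)))) =
          fun j : Fin 1 => (((AD K (W * Polynomial.X^(j:ℕ))).eval (D.u y) : ℤ) : ZMod (p^(1*m)))) ↔ (p:ℤ)^m ∣ D.u x - D.u y := by
          rw [funext_iff]
          simp only [Fin.forall_fin_one, Fin.val_zero, pow_zero, mul_one]
          rw [dvd_sub_iff_cast]
          push_cast
          rw [one_mul]
          constructor
          · exact AD_inj p K hp hK hpK W hW.2 m _ _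
          · intro h
            exact h.trans (Polynomial.sub_dvd_eval_sub _ _ _)
        simp only [this]
      · simp [hy]
    · simp [hx]
  have : ((∑ β, ‖ff K p (1*m) 1 W D 0 0 β‖^2 : ℝ):ℂ) = ((∑ r ∈ Finset.range (p^m), ∑ β, ‖ff K p (1*m) 1 W D (r:ℤ) m β‖^2 : ℝ):ℂ) := by
    rw [key, Complex.ofReal_sum]
    simp_rw [key]
    rw [← Finset.mul_sum]
    congr 1
    symm
    rw [Finset.sum_comm]
    refine Finset.sum_congr rfl fun x _ => ?_
    rw [Finset.sum_comm]
    refine Finset.sum_congr rfl fun y _ => ?_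
    simp only [pow_zero, one_dvd, true_and]
    have hpm : (0:ℤ) < (p:ℤ)^m := by have := hp.pos; positivity
    by_cases h : (p:ℤ)^m ∣ D.u x - D.u y
    · simp only [h, if_true, and_true]
      have hmem : (D.u x % (p:ℤ)^m).toNat ∈ Finset.range (p^m) := by
        rw [Finset.mem_range]
        have h1 := Int.emod_nonneg (D.u x) hpm.ne'
        have h2 := Int.emod_lt_of_pos (D.u x) hpm
        have : ((D.u x % (p:ℤ)^m).toNat : ℤ) < ((p^m:ℕ):ℤ) := by rw [Int.toNat_of_nonneg h1]; push_cast; exact h2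
        exact_mod_cast this
      have hx : (p:ℤ)^m ∣ D.u x - ((D.u x % (p:ℤ)^m).toNat:ℕ) := by
        rw [Int.toNat_of_nonneg (Int.emod_nonneg _ hpm.ne')]
        exact Int.dvd_self_sub_emod
      rw [Finset.sum_eq_single_of_mem _ hmem]
      · rw [if_pos]
        refine ⟨hx, ?_⟩
        have := dvd_sub hx h
        rwa [show D.u x - ((D.u x % (p:ℤ)^m).toNat:ℕ) - (D.u x - D.u y) = D.u y - ((D.u x % (p:ℤ)^m).toNat:ℕ) by ring] at this
      · intro r hr hne
        rw [if_neg]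
        rintro ⟨h1, _⟩
        apply hne
        have hr' := Finset.mem_range.1 hr
        have h2 : (r:ℤ) % (p:ℤ)^m = r := Int.emod_eq_of_lt (by positivity) (by exact_mod_cast hr')
        have h3 := (Int.emod_eq_emod_iff_emod_sub_eq_zero.trans Int.dvd_iff_emod_eq_zero.symm).2 h1
        rw [h3, h2]; simp
    · simp [h]
  exact_mod_cast this

lemma good_all (K p : ℕ) [Fact p.Prime] (hpK : K < p) (hp : 16 < p) :
    ∀ k, 1 ≤ k → k ≤ K → ∀ ε : ℝ, 0 < ε → Good K p k ε := by
  intro k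
  induction k using Nat.strong_induction_on with
  | _ k ih =>
    intro hk hkK ε hε
    rcases Nat.lt_or_ge k 2 with h | h
    · have : k = 1 := by omega
      subst this
      exact good_one K p hkK hpK ε hε
    obtain ⟨σ, hσ, himp⟩ := good_improve K p k h hkK hp (fun l hl hlk => ih l hlk hl (by omega)) ε hε
    have : ∀ j : ℕ, Good K p k (max ε (qq k - j * σ)) := by
      intro j
      induction j with
      | zero => exact good_mono K p k _ _ (by simp) (good_triv K p k hk)
      | succ j ihj =>
        refine good_mono K p k _ _ ?_ (himp _ (le_max_left _ _) ihj)
        apply max_le (le_max_left _ _)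
        rw [sub_le_iff_le_add]
        apply max_le
        · have := le_max_left ε (qq k - ((j+1:ℕ):ℝ) * σ); linarith
        · have := le_max_right ε (qq k - ((j+1:ℕ):ℝ) * σ); push_cast at this ⊢; linarith
    obtain ⟨j, hj⟩ := exists_nat_ge ((qq k : ℝ) / σ)
    rw [div_le_iff₀ hσ] at hj
    refine good_mono K p k _ _ (max_le le_rfl (by linarith)) (this j)

/-! Mean value -/
def bx (s M : ℕ) : Finset (Fin s → ℤ) := Fintype.piFinset (fun _ => Finset.Icc (1:ℤ) M)
def psv (d : ℕ) {s : ℕ} (x : Fin s → ℤ) : Fin d → ℤ := fun j => ∑ i, (x i)^((j:ℕ)+1)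
def Jn (s d M : ℕ) : ℝ := ∑ x ∈ bx s M, ∑ y ∈ bx s M, if psv d x = psv d y then 1 else 0

open Polynomial in
lemma AD_Xpow (K j : ℕ) (hj : j < K) (x : ℤ) : (AD K (1 * X^j)).eval x = ((K.factorial / (j+1) : ℕ):ℤ) * x^(j+1) := by
  unfold AD
  rw [Polynomial.eval_finsetSum, Finset.sum_eq_single_of_mem j (Finset.mem_range.2 hj)]
  · simp [coeff_X_pow]
  · intro b _ hb
    simp [coeff_X_pow, hb]

set_option maxHeartbeats 400000 in
theorem vmvt (d : ℕ) (hd : 1 ≤ d) (ε : ℝ) (hε : 0 < ε) :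
    ∃ C : ℝ, 1 ≤ C ∧ ∀ M : ℕ, 1 ≤ M → Jn (d*(d+1)/2) d M ≤ C * (M:ℝ)^(((d*(d+1)/2 : ℕ):ℝ) + ε) := by
  obtain ⟨p, hpd, hpp⟩ := Nat.exists_infinite_primes (d + 17)
  have : Fact p.Prime := ⟨hpp⟩
  obtain ⟨C, hC, hdec⟩ := good_all d p (by omega) (by omega) d hd le_rfl ε hε
  set s := d*(d+1)/2 with hs
  have hP : (1:ℝ) ≤ p := by exact_mod_cast hpp.one_le
  have hP0 : (0:ℝ) < p := by linarith
  have hqq : qq d = s * 2 := by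
    unfold qq; rw [hs]; exact (Nat.div_mul_cancel (even_iff_two_dvd.1 (Nat.even_mul_succ_self d))).symm
  have hs1 : 1 ≤ s := by
    have : 2 ≤ qq d := by unfold qq; nlinarith
    omega
  have hhh : hh d = s - 1 := rfl
  refine ⟨C * (p:ℝ)^((s:ℝ)+ε), ?_, fun M hM => ?_⟩
  · have : 1 ≤ (p:ℝ)^((s:ℝ)+ε) := one_le_rpow hP (by positivity)
    nlinarith
  obtain ⟨m, hm1, hm2⟩ : ∃ m : ℕ, M < p^m ∧ p^m ≤ p * M := by
    refine ⟨Nat.log p M + 1, Nat.lt_pow_succ_log_self hpp.one_lt M, ?_⟩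
    rw [pow_succ, mul_comm]
    exact Nat.mul_le_mul_left _ (Nat.pow_log_le_self p (by omega))
  let D : Dat := ⟨Finset.Icc (1:ℤ) M, fun x => x, fun _ => 1⟩
  have hW : InW d p d 1 := ⟨by simp, IsU.one hpp⟩
  have h := hdec m 1 hW D
  set N := d*m with hN
  have hPN : (0:ℝ) < ((p^N:ℕ):ℝ)^d := by
    have := hpp.pos; positivity
  -- lower bound
  have hlow : ((p^N:ℕ):ℝ)^d * Jn s d M ≤ ∑ β, ‖ff d p N d 1 D 0 0 β‖^(qq d) := by
    let g : (Fin s → ℤ) → Fin d → ZMod (p^N) := fun x j => ∑ i, (((AD d (1 * Polynomial.X^(j:ℕ))).eval (x i) : ℤ) : ZMod (p^N))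
    have h1 := l2_orth (p^N) d (bx s M) (fun _ => 1) g
    have h2 : ∀ β : Fin d → ZMod (p^N), ‖ff d p N d 1 D 0 0 β‖^(qq d) =
        ‖∑ x ∈ bx s M, (1:ℂ) * (ZMod.stdAddChar (∑ j, β j * g x j) : ℂ)‖^2 := by
      intro β
      rw [hqq, pow_mul, ← norm_pow]
      congr 2
      unfold ff bx
      simp only [pow_zero, one_dvd, Finset.filter_true]
      rw [← Fin.prod_const, Finset.prod_univ_sum]
      refine Finset.sum_congr rfl fun x _ => ?_
      simp only [D, g, one_mul, Ph, ee]
      have : ∑ j, β j * ∑ i, (((AD d (Polynomial.X^(j:ℕ))).eval (x i) : ℤ) : ZMod (p^N)) =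
         ∑ i, ∑ j : Fin d, β j * (((AD d (Polynomial.X^(j:ℕ))).eval (x i) : ℤ) : ZMod (p^N)) := by
        rw [Finset.sum_comm]; simp_rw [Finset.mul_sum]
      rw [this]
      induction (Finset.univ : Finset (Fin s)) using Finset.induction_on with
      | empty => simp
      | insert a s ha ih => rw [Finset.sum_insert ha, Finset.prod_insert ha, AddChar.map_add_eq_mul, ih]
    simp_rw [h2]
    have h3 : (∑ β : Fin d → ZMod (p^N), ‖∑ x ∈ bx s M, (1:ℂ) * (ZMod.stdAddChar (∑ j, β j * g x j) : ℂ)‖^2) =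
       ((p^N:ℕ):ℝ)^d * ∑ x ∈ bx s M, ∑ y ∈ bx s M, (if g x = g y then (1:ℝ) else 0) := by
      rw [← Complex.ofReal_inj, h1]
      push_cast
      congr 1
      refine Finset.sum_congr rfl fun x _ => Finset.sum_congr rfl fun y _ => ?_
      split_ifs <;> simp
    rw [h3]
    refine mul_le_mul_of_nonneg_left ?_ hPN.le
    unfold Jn
    refine Finset.sum_le_sum fun x _ => Finset.sum_le_sum fun y _ => ?_
    by_cases hxy : psv d x = psv d y
    · rw [if_pos hxy, if_pos]
      funext j
      have := congrFun hxy j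
      simp only [g, psv, AD_Xpow d j j.2] at this ⊢
      rw [← Int.cast_sum, ← Int.cast_sum, ← Finset.mul_sum, ← Finset.mul_sum, this]
    · rw [if_neg hxy]; split_ifs <;> norm_num
  have hup : ∑ r ∈ Finset.range (p^m), ∑ β, ‖ff d p N d 1 D (r:ℤ) m β‖^(qq d) ≤ (p:ℝ)^m * ((p^N:ℕ):ℝ)^d := by
    have h1 : ∀ r ∈ Finset.range (p^m), ∑ β, ‖ff d p N d 1 D (r:ℤ) m β‖^(qq d) ≤ ((p^N:ℕ):ℝ)^d := by
      intro r _
      have : ∀ β ∈ (Finset.univ : Finset (Fin d → ZMod (p^N))), ‖ff d p N d 1 D (r:ℤ) m β‖^(qq d) ≤ 1 := by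
        intro β _
        apply pow_le_one₀ (norm_nonneg _)
        unfold ff
        refine (norm_sum_le _ _).trans ?_
        have hc : (Finset.filter (fun x => (p:ℤ)^m ∣ D.u x - (r:ℤ)) D.S).card ≤ 1 := by
          rw [Finset.card_le_one]
          intro a ha b hb
          simp only [Finset.mem_filter, D, Finset.mem_Icc] at ha hb
          have hd1 := dvd_sub ha.2 hb.2
          have e : a - r - (b - r) = a - b := by ring
          rw [e] at hd1
          have : |a - b| < (p:ℤ)^m := by
            have : (M:ℤ) < (p:ℤ)^m := by exact_mod_cast hm1
            rw [abs_lt]; omega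
          have := Int.eq_zero_of_abs_lt_dvd hd1 this
          omega
        calc _ = ∑ x ∈ Finset.filter (fun x => (p:ℤ)^m ∣ D.u x - (r:ℤ)) D.S, (1:ℝ) := by
              refine Finset.sum_congr rfl fun x _ => ?_
              rw [norm_mul, ee_norm]; simp [D]
          _ ≤ 1 := by simp only [Finset.sum_const, nsmul_eq_mul, mul_one]; exact_mod_cast hc
      refine (Finset.sum_le_sum this).trans ?_
      simp [Finset.card_univ, ZMod.card]
    refine (Finset.sum_le_sum h1).trans ?_
    simp
  have h4 : ((p^N:ℕ):ℝ)^d * Jn s d M ≤ ((p^N:ℕ):ℝ)^d * (C * (p:ℝ)^(ε*m) * (p:ℝ)^(m * hh d) * (p:ℝ)^m) := by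
    calc _ ≤ _ := hlow
      _ ≤ _ := h
      _ ≤ C * (p:ℝ)^(ε*m) * (p:ℝ)^(m * hh d) * ((p:ℝ)^m * ((p^N:ℕ):ℝ)^d) := by gcongr
      _ = _ := by ring
  have h5 := le_of_mul_le_mul_left h4 hPN
  refine h5.trans ?_
  have h6 : (p:ℝ)^(ε*m) * (p:ℝ)^(m * hh d) * (p:ℝ)^m = ((p:ℝ)^m)^((s:ℝ)+ε) := by
    rw [← rpow_natCast (p:ℝ) m, ← rpow_natCast (p:ℝ) (m * hh d), ← rpow_mul hP0.le, ← rpow_add hP0, ← rpow_add hP0, hhh]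
    congr 1
    push_cast [hs1]; ring
  have h7 : (p:ℝ)^m ≤ p * M := by exact_mod_cast hm2
  calc _ = C * ((p:ℝ)^(ε*m) * (p:ℝ)^(m * hh d) * (p:ℝ)^m) := by ring
    _ = C * ((p:ℝ)^m)^((s:ℝ)+ε) := by rw [h6]
    _ ≤ C * ((p:ℝ) * M)^((s:ℝ)+ε) := by gcongr
    _ = _ := by rw [mul_rpow hP0.le (by positivity)]; ring

lemma eC_add (a b : ℝ) : eC (a + b) = eC a * eC b := by
  unfold eC; rw [← Complex.exp_add]; congr 1; push_cast; ring
lemma eC_norm (a : ℝ) : ‖eC a‖ = 1 := by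
  unfold eC
  rw [show (2 * (Real.pi:ℂ) * Complex.I * (a:ℂ)) = ((2 * Real.pi * a : ℝ):ℂ) * Complex.I by push_cast; ring]
  exact Complex.norm_exp_ofReal_mul_I _
lemma eC_zero : eC 0 = 1 := by simp [eC]
lemma eC_int (n : ℤ) : eC n = 1 := by
  unfold eC
  rw [show (2 * (Real.pi:ℂ) * Complex.I * ((n:ℝ):ℂ)) = n * (2 * Real.pi * Complex.I) by push_cast; ring]
  exact Complex.exp_int_mul_two_pi_mul_I n
lemma eC_neg (a : ℝ) : eC (-a) = (starRingEnd ℂ) (eC a) := by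
  unfold eC
  rw [← Complex.exp_conj]
  congr 1
  simp [Complex.conj_I]
  left; exact (map_ofNat (starRingEnd ℂ) 2).symm
lemma eC_sum {ι : Type*} (s : Finset ι) (f : ι → ℝ) : eC (∑ i ∈ s, f i) = ∏ i ∈ s, eC (f i) := by
  induction s using Finset.induction_on with
  | empty => simp [eC_zero]
  | insert a s ha ih => rw [Finset.sum_insert ha, Finset.prod_insert ha, eC_add, ih]
lemma eC_sub_int (a : ℝ) (n : ℤ) : eC (a - n) = eC a := by
  have := eC_add (a - n) n
  rw [sub_add_cancel, eC_int, mul_one] at this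
  exact this.symm
lemma eC_natmul (a : ℝ) (n : ℕ) : eC (a * n) = eC a ^ n := by
  unfold eC; rw [← Complex.exp_nat_mul]; congr 1; push_cast; ring

/-- distance to nearest integer -/
def dz (a : ℝ) : ℝ := |a - round a|

lemma norm_one_sub_eC (a : ℝ) : 4 * dz a ≤ ‖eC a - 1‖ := by
  set b := a - round a with hb
  have h1 : eC a = eC b := by rw [hb, eC_sub_int]
  have hb2 : |b| ≤ 1/2 := abs_sub_round a
  have hdz : dz a = |b| := rfl
  rw [h1, hdz]
  have h2 : ‖eC b - 1‖ = 2 * |Real.sin (π * b)| := by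
    have := Complex.norm_exp_I_mul_ofReal_sub_one (2 * π * b)
    have e : (Complex.I * ((2 * π * b : ℝ):ℂ)) = (2 * (π:ℂ) * Complex.I * (b:ℂ)) := by push_cast; ring
    rw [e] at this
    unfold eC
    rw [this, norm_mul, Real.norm_eq_abs, Real.norm_eq_abs, abs_of_pos (by norm_num : (0:ℝ) < 2)]
    congr 3; ring
  rw [h2]
  have h3 : 2 * |b| ≤ |Real.sin (π * b)| := by
    have := Real.mul_abs_le_abs_sin (x := π * b) (by rw [abs_mul, abs_of_pos pi_pos]; nlinarith [pi_pos])
    rw [abs_mul, abs_of_pos pi_pos] at this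
    have e : 2 / π * (π * |b|) = 2 * |b| := by field_simp
    linarith
  linarith

lemma geom_bound (a : ℝ) (L : ℕ) : ‖∑ v ∈ Finset.Icc (1:ℤ) L, eC (a * v)‖ * dz a ≤ 1 := by
  by_cases h0 : dz a = 0
  · rw [h0]; simp
  have hd : 0 < dz a := lt_of_le_of_ne (abs_nonneg _) (Ne.symm h0)
  have h1 := norm_one_sub_eC a
  have hs : ∑ v ∈ Finset.Icc (1:ℤ) L, eC (a * v) = eC a * ∑ v ∈ Finset.range L, eC a ^ v := by
    rw [Finset.mul_sum]
    refine Finset.sum_bij' (fun v _ => (v - 1).toNat) (fun v _ => (v:ℤ)+1) ?_ ?_ ?_ ?_ ?_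
    · intro v hv; rw [Finset.mem_Icc] at hv; rw [Finset.mem_range]; omega
    · intro v hv; rw [Finset.mem_range] at hv; rw [Finset.mem_Icc]; omega
    · intro v hv; rw [Finset.mem_Icc] at hv; omega
    · intro v hv; simp
    · intro v hv; rw [Finset.mem_Icc] at hv
      obtain ⟨w, hw⟩ := Int.eq_ofNat_of_zero_le (by omega : 0 ≤ v - 1)
      have : v = w + 1 := by omega
      subst this
      rw [← eC_natmul, ← eC_add]
      congr 1; simp; ring
  rw [hs, norm_mul, eC_norm, one_mul]
  have h2 := geom_sum_mul (eC a) L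
  have h3 : ‖∑ v ∈ Finset.range L, eC a ^ v‖ * ‖eC a - 1‖ ≤ 2 := by
    rw [← norm_mul, h2]
    refine (norm_sub_le _ _).trans ?_
    rw [norm_pow, eC_norm]; norm_num
  have h4 := norm_nonneg (∑ v ∈ Finset.range L, eC a ^ v)
  nlinarith

lemma geom_triv (a : ℝ) (L : ℕ) : ‖∑ v ∈ Finset.Icc (1:ℤ) L, eC (a * v)‖ ≤ L := by
  refine (norm_sum_le _ _).trans ?_
  simp [eC_norm]

lemma exists_phase (z : ℂ) : ∃ w : ℂ, ‖w‖ ≤ 1 ∧ w * z = (‖z‖:ℂ) := by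
  by_cases h : z = 0
  · exact ⟨0, by simp, by simp [h]⟩
  · refine ⟨(‖z‖:ℂ) / z, ?_, by field_simp⟩
    rw [norm_div]; simp [h]

/-- The block inequality -/
lemma block {ι : Type*} (s d M : ℕ) (hs : 1 ≤ s) (R : Finset ι) (α : ι → Fin d → ℝ) (j0 : Fin d) :
    (∑ r ∈ R, ‖∑ t ∈ Finset.Icc (1:ℤ) M, eC (∑ j, α r j * (t:ℝ)^((j:ℕ)+1))‖^s)^2 ≤
    Jn s d M * ((∏ j ∈ Finset.univ.erase j0, (s * (M:ℝ)^((j:ℕ)+1))) *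
      ∑ r ∈ R, ∑ r' ∈ R, ‖∑ v ∈ Finset.Icc (1:ℤ) ((s * M^((j0:ℕ)+1) : ℕ):ℤ), eC ((α r j0 - α r' j0) * v)‖) := by
  set Q : ι → ℂ := fun r => ∑ t ∈ Finset.Icc (1:ℤ) M, eC (∑ j, α r j * (t:ℝ)^((j:ℕ)+1)) with hQ
  set Box : Finset (Fin d → ℤ) := Fintype.piFinset (fun j : Fin d => Finset.Icc (1:ℤ) ((s * M^((j:ℕ)+1) : ℕ):ℤ)) with hBox
  set E : ι → (Fin d → ℤ) → ℂ := fun r v => eC (∑ j, α r j * (v j:ℝ)) with hE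
  set N : (Fin d → ℤ) → ℝ := fun v => ∑ x ∈ bx s M, if psv d x = v then (1:ℝ) else 0 with hN
  have hmaps : ∀ x ∈ bx s M, psv d x ∈ Box := by
    intro x hx
    rw [bx, Fintype.mem_piFinset] at hx
    rw [hBox, Fintype.mem_piFinset]
    intro j
    rw [Finset.mem_Icc]
    have hx1 : ∀ i, 1 ≤ x i ∧ x i ≤ M := fun i => Finset.mem_Icc.1 (hx i)
    have a1 : ∀ i ∈ (Finset.univ : Finset (Fin s)), (1:ℤ) ≤ (x i)^((j:ℕ)+1) := fun i _ => one_le_pow₀ (hx1 i).1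
    have a2 : ∀ i ∈ (Finset.univ : Finset (Fin s)), (x i)^((j:ℕ)+1) ≤ (M:ℤ)^((j:ℕ)+1) := fun i _ =>
      pow_le_pow_left₀ (by linarith [(hx1 i).1]) (hx1 i).2 _
    have b1 := Finset.sum_le_sum a1
    have b2 := Finset.sum_le_sum a2
    simp only [Finset.sum_const, Finset.card_univ, Fintype.card_fin, nsmul_eq_mul] at b1 b2
    constructor
    · have : (1:ℤ) ≤ s := by exact_mod_cast hs
      unfold psv; linarith
    · push_cast; exact b2
  have hQs : ∀ r, Q r ^ s = ∑ v ∈ Box, (N v : ℂ) * E r v := by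
    intro r
    have h1 : Q r ^ s = ∑ x ∈ bx s M, E r (psv d x) := by
      rw [hQ]
      simp only
      rw [← Fin.prod_const, Finset.prod_univ_sum]
      refine Finset.sum_congr rfl fun x _ => ?_
      rw [hE]
      simp only
      rw [← eC_sum, Finset.sum_comm]
      congr 1
      refine Finset.sum_congr rfl fun j _ => ?_
      rw [← Finset.mul_sum]; simp [psv]
    rw [h1]
    simp only [hN]
    push_cast
    simp_rw [Finset.sum_mul]
    rw [Finset.sum_comm]
    refine Finset.sum_congr rfl fun x hx => ?_
    rw [Finset.sum_eq_single_of_mem _ (hmaps x hx)]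
    · simp
    · intro b _ hb; simp [Ne.symm hb]
  have hJ : ∑ v ∈ Box, N v ^ 2 = Jn s d M := by
    unfold Jn
    simp only [hN, sq, Finset.sum_mul_sum]
    rw [Finset.sum_comm]
    refine Finset.sum_congr rfl fun x hx => ?_
    rw [Finset.sum_comm]
    refine Finset.sum_congr rfl fun y hy => ?_
    rw [Finset.sum_eq_single_of_mem _ (hmaps x hx)]
    · simp [eq_comm]
    · intro b _ hb; simp [Ne.symm hb]
  choose w hw1 hw2 using fun r => exists_phase (Q r ^ s)
  have hsum : ((∑ r ∈ R, ‖Q r‖^s : ℝ):ℂ) = ∑ v ∈ Box, (N v:ℂ) * ∑ r ∈ R, w r * E r v := by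
    push_cast
    simp_rw [Finset.mul_sum]
    rw [Finset.sum_comm]
    refine Finset.sum_congr rfl fun r _ => ?_
    have := hw2 r
    rw [norm_pow] at this
    push_cast at this
    rw [← this, hQs, Finset.mul_sum]
    refine Finset.sum_congr rfl fun v _ => by ring
  have hle : ∑ r ∈ R, ‖Q r‖^s ≤ ∑ v ∈ Box, N v * ‖∑ r ∈ R, w r * E r v‖ := by
    have h1 : ∑ r ∈ R, ‖Q r‖^s = ‖((∑ r ∈ R, ‖Q r‖^s : ℝ):ℂ)‖ := by
      rw [Complex.norm_real, Real.norm_of_nonneg (by positivity)]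
    rw [h1, hsum]
    refine (norm_sum_le _ _).trans (le_of_eq ?_)
    refine Finset.sum_congr rfl fun v _ => ?_
    rw [norm_mul, Complex.norm_real, Real.norm_of_nonneg]
    exact Finset.sum_nonneg fun x _ => by split_ifs <;> norm_num
  have hcs := Finset.sum_mul_sq_le_sq_mul_sq Box N (fun v => ‖∑ r ∈ R, w r * E r v‖)
  rw [hJ] at hcs
  refine (pow_le_pow_left₀ (by positivity) hle 2).trans (hcs.trans ?_)
  have hJ0 : 0 ≤ Jn s d M := by rw [← hJ]; positivity
  refine mul_le_mul_of_nonneg_left ?_ hJ0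
  have hexp : ((∑ v ∈ Box, ‖∑ r ∈ R, w r * E r v‖^2 : ℝ):ℂ) =
     ∑ r ∈ R, ∑ r' ∈ R, w r * (starRingEnd ℂ) (w r') * ∏ j : Fin d, ∑ v ∈ Finset.Icc (1:ℤ) ((s * M^((j:ℕ)+1) : ℕ):ℤ), eC ((α r j - α r' j) * v) := by
    push_cast
    have h1 : ∀ z : ℂ, ((‖z‖:ℝ):ℂ)^2 = z * (starRingEnd ℂ) z := by
      intro z; rw [Complex.mul_conj, Complex.normSq_eq_norm_sq]; push_cast; rfl
    simp_rw [h1, map_sum, Finset.sum_mul_sum]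
    rw [Finset.sum_comm]
    refine Finset.sum_congr rfl fun r _ => ?_
    rw [Finset.sum_comm]
    refine Finset.sum_congr rfl fun r' _ => ?_
    rw [Finset.prod_univ_sum, Finset.mul_sum]
    refine Finset.sum_congr (by rw [hBox]; push_cast; rfl) fun v _ => ?_
    rw [← eC_sum, map_mul, hE]
    simp only
    rw [← eC_neg]
    have : ∑ j, (α r j - α r' j) * (v j:ℝ) = ∑ j, α r j * (v j:ℝ) + -∑ j, α r' j * (v j:ℝ) := by
      rw [← sub_eq_add_neg, ← Finset.sum_sub_distrib]
      exact Finset.sum_congr rfl fun j _ => by ring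
    rw [this, eC_add]; ring
  have h1 : ∑ v ∈ Box, ‖∑ r ∈ R, w r * E r v‖^2 = ‖((∑ v ∈ Box, ‖∑ r ∈ R, w r * E r v‖^2 : ℝ):ℂ)‖ := by
    rw [Complex.norm_real, Real.norm_of_nonneg (by positivity)]
  rw [h1, hexp, Finset.mul_sum]
  refine (norm_sum_le _ _).trans (Finset.sum_le_sum fun r _ => ?_)
  rw [Finset.mul_sum]
  refine (norm_sum_le _ _).trans (Finset.sum_le_sum fun r' _ => ?_)
  rw [norm_mul, norm_mul, RCLike.norm_conj, norm_prod, ← Finset.mul_prod_erase Finset.univ _ (Finset.mem_univ j0)]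
  have h2 : ‖w r‖ * ‖w r'‖ ≤ 1 := mul_le_one₀ (hw1 r) (norm_nonneg _) (hw1 r')
  have h3 : ∏ j ∈ Finset.univ.erase j0, ‖∑ v ∈ Finset.Icc (1:ℤ) ((s * M^((j:ℕ)+1) : ℕ):ℤ), eC ((α r j - α r' j) * v)‖ ≤
     ∏ j ∈ Finset.univ.erase j0, (s * (M:ℝ)^((j:ℕ)+1)) := by
    refine Finset.prod_le_prod (fun _ _ => norm_nonneg _) fun j _ => ?_
    refine (geom_triv _ _).trans (le_of_eq (by push_cast; rfl))
  have h4 : 0 ≤ ∏ j ∈ Finset.univ.erase j0, ‖∑ v ∈ Finset.Icc (1:ℤ) ((s * M^((j:ℕ)+1) : ℕ):ℤ), eC ((α r j - α r' j) * v)‖ := Finset.prod_nonneg fun _ _ => norm_nonneg _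
  have h5 := norm_nonneg (∑ v ∈ Finset.Icc (1:ℤ) ((s * M^((j0:ℕ)+1) : ℕ):ℤ), eC ((α r j0 - α r' j0) * v))
  refine (mul_le_of_le_one_left (mul_nonneg h5 h4) h2).trans ?_
  rw [mul_comm]
  exact mul_le_mul_of_nonneg_right h3 h5

def wt (Q x : ℝ) : ℝ := 1 / max 1 (Q * dz x)

lemma wt_nonneg (Q x : ℝ) : 0 ≤ wt Q x := by unfold wt; positivity
lemma wt_le_one (Q x : ℝ) : wt Q x ≤ 1 := by
  unfold wt
  rw [div_le_one (lt_of_lt_of_le one_pos (le_max_left _ _))]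
  exact le_max_left _ _
lemma wt_le (Q x u : ℝ) (hQ : 0 < Q) (hu : 0 < u) (h : u ≤ dz x) : wt Q x ≤ 1 / (Q * u) := by
  unfold wt
  apply one_div_le_one_div_of_le (by positivity)
  exact le_max_of_le_right (by gcongr)

lemma geom_wt (s : ℕ) (hs : 1 ≤ s) (Q : ℕ) (hQ : 1 ≤ Q) (x : ℝ) :
    ‖∑ v ∈ Finset.Icc (1:ℤ) ((s * Q : ℕ):ℤ), eC (x * v)‖ ≤ s * Q * wt Q x := by
  have h1 := geom_triv x (s*Q)
  have h2 := geom_bound x (s*Q)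
  have hs' : (1:ℝ) ≤ s := by exact_mod_cast hs
  have hQ' : (1:ℝ) ≤ Q := by exact_mod_cast hQ
  unfold wt
  rw [mul_one_div, le_div_iff₀ (lt_of_lt_of_le one_pos (le_max_left _ _))]
  set g := ‖∑ v ∈ Finset.Icc (1:ℤ) ((s * Q : ℕ):ℤ), eC (x * v)‖
  rcases max_cases (1:ℝ) (Q * dz x) with ⟨h, _⟩ | ⟨h, _⟩
  · rw [h]; push_cast at h1; linarith
  · rw [h]
    calc g * (Q * dz x) = Q * (g * dz x) := by ring
      _ ≤ Q * 1 := by gcongr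
      _ ≤ s * Q := by nlinarith

open Polynomial in
lemma block_poly (d : ℕ) (hd : 2 ≤ d) (ε : ℝ) (hε : 0 < ε) : ∃ C : ℝ, 1 ≤ C ∧ ∀ (M R : ℕ) (P : ℝ[X]) (B : ℝ), 1 ≤ M → 1 ≤ R →
    P.natDegree ≤ d →
    ∑ r ∈ Finset.range R, ∑ r' ∈ Finset.range R, wt ((M:ℝ)^(d-1)) (d * P.coeff d * ((r:ℝ) - r')) ≤ B * (R:ℝ)^2 →
    (∑ r ∈ Finset.range R, ‖∑ t ∈ Finset.Icc (1:ℤ) M, eC (P.eval ((r:ℝ) + t))‖)^(d*(d+1)) ≤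
      C * ((R:ℝ) * M)^(d*(d+1)) * (M:ℝ)^ε * B := by
  obtain ⟨C, hC, hJ⟩ := vmvt d (by omega) ε hε
  set s := d*(d+1)/2 with hs
  have h2s : d*(d+1) = s * 2 := by
    rw [hs]; exact (Nat.div_mul_cancel (even_iff_two_dvd.1 (Nat.even_mul_succ_self d))).symm
  have hs1 : 1 ≤ s := by
    have : 2 ≤ d * (d+1) := by nlinarith
    omega
  have hs' : (1:ℝ) ≤ s := by exact_mod_cast hs1
  refine ⟨C * (s:ℝ)^d, by have : 1 ≤ (s:ℝ)^d := one_le_pow₀ hs'; nlinarith, fun M R P B hM h0 hP hB => ?_⟩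
  have hM' : (1:ℝ) ≤ M := by exact_mod_cast hM
  have hM0 : (0:ℝ) < M := by linarith
  set α : ℕ → Fin d → ℝ := fun r j => (taylor (r:ℝ) P).coeff ((j:ℕ)+1) with hα
  set j0 : Fin d := ⟨d-2, by omega⟩ with hj0
  have hj0' : (j0:ℕ) + 1 = d - 1 := by simp only [hj0]; omega
  have hα0 : ∀ r, α r j0 = P.coeff (d-1) + d * P.coeff d * r := by
    intro r
    simp only [hα]
    rw [hj0', taylor_coeff, eval_eq_sum_range' (n := 2)]
    · rw [Finset.sum_range_succ, Finset.sum_range_one, hasseDeriv_coeff, hasseDeriv_coeff]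
      have e1 : 0 + (d-1) = d - 1 := by omega
      have e2 : 1 + (d-1) = d := by omega
      rw [e1, e2, Nat.choose_self, Nat.choose_symm_of_eq_add (by omega : d = (d-1) + 1), Nat.choose_one_right]
      simp
    · have := natDegree_hasseDeriv_le P (d-1)
      omega
  have hQ : ∀ r : ℕ, ‖∑ t ∈ Finset.Icc (1:ℤ) M, eC (P.eval ((r:ℝ) + t))‖ =
     ‖∑ t ∈ Finset.Icc (1:ℤ) M, eC (∑ j, α r j * (t:ℝ)^((j:ℕ)+1))‖ := by
    intro r
    have : ∀ t : ℤ, eC (P.eval ((r:ℝ) + t)) = eC ((taylor (r:ℝ) P).coeff 0) * eC (∑ j, α r j * (t:ℝ)^((j:ℕ)+1)) := by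
      intro t
      rw [← eC_add]
      congr 1
      rw [add_comm (r:ℝ), ← taylor_eval, eval_eq_sum_range' (n := d+1) (by rw [natDegree_taylor]; omega), Finset.sum_range_succ',
        Finset.sum_range]
      simp [hα, add_comm]
    simp_rw [this]
    rw [← Finset.mul_sum, norm_mul, eC_norm, one_mul]
  simp_rw [hQ]
  have hb := block s d M hs1 (Finset.range R) α j0
  set Q : ℕ → ℝ := fun r => ‖∑ t ∈ Finset.Icc (1:ℤ) M, eC (∑ j, α r j * (t:ℝ)^((j:ℕ)+1))‖ with hQd
  have hpow := pow_sum_le_card (Finset.range R) Q (fun _ => norm_nonneg _) s hs1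
  rw [Finset.card_range] at hpow
  have hG : ∑ r ∈ Finset.range R, ∑ r' ∈ Finset.range R, ‖∑ v ∈ Finset.Icc (1:ℤ) ((s * M^((j0:ℕ)+1) : ℕ):ℤ), eC ((α r j0 - α r' j0) * v)‖
      ≤ s * (M:ℝ)^((j0:ℕ)+1) * (B * (R:ℝ)^2) := by
    refine le_trans ?_ (mul_le_mul_of_nonneg_left hB (by positivity))
    rw [Finset.mul_sum]
    refine Finset.sum_le_sum fun r _ => ?_
    rw [Finset.mul_sum]
    refine Finset.sum_le_sum fun r' _ => ?_
    have := geom_wt s hs1 (M^((j0:ℕ)+1)) (Nat.one_le_pow _ _ hM) (α r j0 - α r' j0)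
    refine this.trans (le_of_eq ?_)
    rw [hα0, hα0, hj0']
    push_cast
    congr 2; ring
  have hprod : (∏ j ∈ Finset.univ.erase j0, (s * (M:ℝ)^((j:ℕ)+1))) * (s * (M:ℝ)^((j0:ℕ)+1)) = (s:ℝ)^d * (M:ℝ)^s := by
    rw [Finset.prod_erase_mul _ _ (Finset.mem_univ j0), Finset.prod_mul_distrib, Finset.prod_pow_eq_pow_sum]
    simp only [Finset.prod_const, Finset.card_univ, Fintype.card_fin]
    congr 2
    rw [Fin.sum_univ_eq_sum_range (fun j => j + 1) d, hs]
    have := Finset.sum_range_id_mul_two (d+1)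
    rw [Finset.sum_range_succ'] at this
    simp only [add_zero, Nat.add_sub_cancel] at this
    rw [mul_comm d]; omega
  have hBR : 0 ≤ B * (R:ℝ)^2 := le_trans (Finset.sum_nonneg fun r _ => Finset.sum_nonneg fun r' _ => wt_nonneg _ _) hB
  have hMe : (M:ℝ)^((s:ℝ)+ε) = (M:ℝ)^s * (M:ℝ)^ε := by rw [rpow_add hM0, rpow_natCast]
  have hfin : (∑ r ∈ Finset.range R, Q r ^ s)^2 ≤ C * (s:ℝ)^d * (M:ℝ)^(s*2) * (M:ℝ)^ε * (B * (R:ℝ)^2) := by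
    calc _ ≤ _ := hb
      _ ≤ (C * (M:ℝ)^((s:ℝ)+ε)) * ((∏ j ∈ Finset.univ.erase j0, (s * (M:ℝ)^((j:ℕ)+1))) * (s * (M:ℝ)^((j0:ℕ)+1) * (B * (R:ℝ)^2))) := by
          have := hJ M hM
          gcongr
      _ = C * (M:ℝ)^((s:ℝ)+ε) * (((∏ j ∈ Finset.univ.erase j0, (s * (M:ℝ)^((j:ℕ)+1))) * (s * (M:ℝ)^((j0:ℕ)+1))) * (B * (R:ℝ)^2)) := by ring
      _ = _ := by rw [hprod, hMe]; ring
  have hQs0 : 0 ≤ ∑ r ∈ Finset.range R, Q r := Finset.sum_nonneg fun r _ => norm_nonneg _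
  rw [h2s, pow_mul]
  calc ((∑ r ∈ Finset.range R, Q r)^s)^2 ≤ ((R:ℝ)^(s-1) * ∑ r ∈ Finset.range R, Q r ^ s)^2 := by
        exact pow_le_pow_left₀ (by positivity) hpow 2
    _ = ((R:ℝ)^(s-1))^2 * (∑ r ∈ Finset.range R, Q r ^ s)^2 := by ring
    _ ≤ ((R:ℝ)^(s-1))^2 * (C * (s:ℝ)^d * (M:ℝ)^(s*2) * (M:ℝ)^ε * (B * (R:ℝ)^2)) := by gcongr
    _ = C * (s:ℝ)^d * (((R:ℝ)^(s-1) * R)^2 * (M:ℝ)^(s*2)) * (M:ℝ)^ε * B := by ring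
    _ = _ := by
        rw [← pow_succ, Nat.sub_add_cancel hs1, mul_pow]
        ring

/-- counting lemma -/
lemma dz_ge_of (x : ℝ) (u : ℝ) (h : ∀ z : ℤ, u ≤ |x - z|) : u ≤ dz x := h _

lemma sum_class (R q : ℕ) (hq : 1 ≤ q) (r : ℕ) (hr : r < R) (w : ℝ → ℝ) (g : ℤ → ℝ) (hg : ∀ k, 0 ≤ g k)
    (h : ∀ k : ℤ, |k| * q < R → w (k * q) ≤ g k) :
    ∑ r' ∈ (Finset.range R).filter (fun r' : ℕ => (q:ℤ) ∣ (r:ℤ) - r'), w ((r:ℝ) - r') ≤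
      ∑ k ∈ Finset.Icc (-((R/q : ℕ):ℤ)) ((R/q : ℕ):ℤ), g k := by
  have hq0 : (q:ℤ) ≠ 0 := by exact_mod_cast (by omega : q ≠ 0)
  have hqp : (0:ℤ) < q := by exact_mod_cast hq
  set F := (Finset.range R).filter (fun r' : ℕ => (q:ℤ) ∣ (r:ℤ) - r') with hF
  have hk : ∀ r' ∈ F, |((r:ℤ) - r')/q| * q < R ∧ (((r:ℤ) - r')/q) * q = (r:ℤ) - r' := by
    intro r' hr'
    rw [hF, Finset.mem_filter, Finset.mem_range] at hr'
    have e := Int.ediv_mul_cancel hr'.2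
    refine ⟨?_, e⟩
    have : |((r:ℤ) - r')/q| * q = |(r:ℤ) - r'| := by
      conv_rhs => rw [← e, abs_mul, abs_of_pos hqp]
    rw [this, abs_lt]; omega
  calc ∑ r' ∈ F, w ((r:ℝ) - r') ≤ ∑ r' ∈ F, g (((r:ℤ) - r')/q) := by
        refine Finset.sum_le_sum fun r' hr' => ?_
        have := hk r' hr'
        have h2 := h _ this.1
        have e : ((((r:ℤ) - r')/q : ℤ):ℝ) * q = (r:ℝ) - r' := by exact_mod_cast this.2
        rwa [e] at h2
    _ = ∑ k ∈ F.image (fun r' : ℕ => ((r:ℤ) - r')/q), g k := by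
        rw [Finset.sum_image]
        intro a ha b hb hab
        have h1 := (hk a ha).2
        have h2 := (hk b hb).2
        simp only at hab
        rw [hab] at h1
        omega
    _ ≤ _ := by
        refine Finset.sum_le_sum_of_subset_of_nonneg ?_ (fun k _ _ => hg k)
        intro k hkm
        rw [Finset.mem_image] at hkm
        obtain ⟨r', hr', rfl⟩ := hkm
        have := (hk r' hr').1
        rw [Finset.mem_Icc, ← abs_le]
        set k := ((r:ℤ) - r')/q
        have h3 : k.natAbs * q < R := by
          have : ((k.natAbs * q : ℕ):ℤ) < R := by push_cast; exact this
          exact_mod_cast this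
        have h4 : k.natAbs ≤ R / q := by rw [Nat.le_div_iff_mul_le hq]; omega
        rw [← Int.natCast_natAbs]; exact_mod_cast h4

lemma count_main (R q : ℕ) (hR : 1 ≤ R) (hq : 1 ≤ q) (a : ℤ) (hco : IsCoprime a (q:ℤ)) (β Qb : ℝ) (hQ : 0 < Qb)
    (hβ : |β| * R ≤ 1 / (2*q)) (g : ℤ → ℝ) (hg : ∀ k, 0 ≤ g k)
    (h : ∀ k : ℤ, |k| * q < R → wt Qb (β * (k*q)) ≤ g k) :
    ∑ r ∈ Finset.range R, ∑ r' ∈ Finset.range R, wt Qb (((a:ℝ)/q + β) * ((r:ℝ) - r')) ≤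
     (2 * q / Qb) * (R:ℝ)^2 + R * ∑ k ∈ Finset.Icc (-((R/q : ℕ):ℤ)) ((R/q : ℕ):ℤ), g k := by
  have hq' : (1:ℝ) ≤ q := by exact_mod_cast hq
  have hq0 : (q:ℝ) ≠ 0 := by positivity
  have key : ∀ r ∈ Finset.range R, ∑ r' ∈ Finset.range R, wt Qb (((a:ℝ)/q + β) * ((r:ℝ) - r')) ≤
      (2 * q / Qb) * R + ∑ k ∈ Finset.Icc (-((R/q : ℕ):ℤ)) ((R/q : ℕ):ℤ), g k := by
    intro r hr
    have hr' := Finset.mem_range.1 hr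
    rw [← Finset.sum_filter_add_sum_filter_not (Finset.range R) (fun r' : ℕ => (q:ℤ) ∣ (r:ℤ) - r'), add_comm]
    refine add_le_add ?_ ?_
    · have : ∀ r' ∈ (Finset.range R).filter (fun r' : ℕ => ¬ (q:ℤ) ∣ (r:ℤ) - r'),
         wt Qb (((a:ℝ)/q + β) * ((r:ℝ) - r')) ≤ 2 * q / Qb := by
        intro r' hr''
        rw [Finset.mem_filter, Finset.mem_range] at hr''
        have hd : 1 / (2 * (q:ℝ)) ≤ dz (((a:ℝ)/q + β) * ((r:ℝ) - r')) := by
          apply dz_ge_of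
          intro z
          have hne : a * ((r:ℤ) - r') - z * q ≠ 0 := by
            intro h0
            apply hr''.2
            have : (q:ℤ) ∣ a * ((r:ℤ) - r') := ⟨z, by linarith⟩
            exact hco.symm.dvd_of_dvd_mul_left this
          have h1 : (1:ℝ) ≤ |((a * ((r:ℤ) - r') - z * q : ℤ):ℝ)| := by
            rw [← Int.cast_abs]; exact_mod_cast Int.one_le_abs hne
          have h2 : |β * ((r:ℝ) - r')| ≤ 1/(2*q) := by
            rw [abs_mul]
            refine le_trans (mul_le_mul_of_nonneg_left ?_ (abs_nonneg β)) hβ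
            have e1 : (r:ℝ) ≤ R := by exact_mod_cast hr'.le
            have e2 : (r':ℝ) ≤ R := by exact_mod_cast hr''.1.le
            rw [abs_le]; constructor <;> linarith [(Nat.cast_nonneg r : (0:ℝ) ≤ r), (Nat.cast_nonneg r' : (0:ℝ) ≤ r')]
          have h3 : ((a:ℝ)/q + β) * ((r:ℝ) - r') - z = ((a * ((r:ℤ) - r') - z * q : ℤ):ℝ) / q + β * ((r:ℝ) - r') := by
            push_cast; field_simp; ring
          rw [h3]
          have h4 : 1/(q:ℝ) ≤ |((a * ((r:ℤ) - r') - z * q : ℤ):ℝ) / q| := by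
            rw [abs_div, abs_of_pos (by positivity : (0:ℝ) < q)]
            gcongr
          have h5 := abs_sub_abs_le_abs_sub (((a * ((r:ℤ) - r') - z * q : ℤ):ℝ) / q) (-(β * ((r:ℝ) - r')))
          rw [abs_neg, sub_neg_eq_add] at h5
          have h6 : 1/(q:ℝ) = 1/(2*q) + 1/(2*q) := by field_simp; norm_num
          linarith
        refine (wt_le Qb _ _ hQ (by positivity) hd).trans (le_of_eq ?_)
        field_simp
      refine (Finset.sum_le_sum this).trans ?_
      rw [Finset.sum_const, nsmul_eq_mul, mul_comm]
      have hc : ((((Finset.range R).filter (fun r' : ℕ => ¬ (q:ℤ) ∣ (r:ℤ) - r')).card : ℕ):ℝ) ≤ R := by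
        have := Finset.card_filter_le (Finset.range R) (fun r' : ℕ => ¬ (q:ℤ) ∣ (r:ℤ) - r')
        rw [Finset.card_range] at this
        exact_mod_cast this
      gcongr
    · refine sum_class R q hq r hr' (fun x => wt Qb (((a:ℝ)/q + β) * x)) g hg fun k hk => ?_
      have e : ((a:ℝ)/q + β) * (k * q) = β * (k*q) - ((-(a * k) : ℤ):ℝ) := by push_cast; field_simp; ring
      have : wt Qb (((a:ℝ)/q + β) * (k * q)) = wt Qb (β * (k*q)) := by
        unfold wt dz
        rw [e]
        rw [round_sub_intCast]
        congr 4; push_cast; ring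
      rw [this]; exact h k hk
  refine (Finset.sum_le_sum key).trans (le_of_eq ?_)
  rw [Finset.sum_const, Finset.card_range, nsmul_eq_mul]; ring

lemma count_one (R q : ℕ) (hR : 1 ≤ R) (hq : 1 ≤ q) (a : ℤ) (hco : IsCoprime a (q:ℤ)) (β Qb : ℝ) (hQ : 0 < Qb)
    (hβ : |β| * R ≤ 1 / (2*q)) :
    ∑ r ∈ Finset.range R, ∑ r' ∈ Finset.range R, wt Qb (((a:ℝ)/q + β) * ((r:ℝ) - r')) ≤
     (2 * q / Qb + 2/q + 1/R) * (R:ℝ)^2 := by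
  refine (count_main R q hR hq a hco β Qb hQ hβ (fun _ => 1) (fun _ => zero_le_one) (fun k _ => wt_le_one _ _)).trans ?_
  have hR' : (1:ℝ) ≤ R := by exact_mod_cast hR
  have hq' : (1:ℝ) ≤ q := by exact_mod_cast hq
  have hn : ((R/q : ℕ):ℝ) ≤ (R:ℝ)/q := Nat.cast_div_le
  have : ∑ k ∈ Finset.Icc (-((R/q : ℕ):ℤ)) ((R/q : ℕ):ℤ), (1:ℝ) ≤ 2 * ((R:ℝ)/q) + 1 := by
    rw [Finset.sum_const, nsmul_eq_mul, mul_one, Int.card_Icc]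
    have : (((R/q : ℕ):ℤ) + 1 - -((R/q : ℕ):ℤ)).toNat = 2 * (R/q) + 1 := by omega
    rw [this]; push_cast; linarith
  calc _ ≤ (2 * q / Qb) * (R:ℝ)^2 + R * (2 * ((R:ℝ)/q) + 1) := by gcongr
    _ = _ := by field_simp; ring

lemma count_two (R q : ℕ) (hR : 1 ≤ R) (hq : 1 ≤ q) (a : ℤ) (hco : IsCoprime a (q:ℤ)) (β Qb : ℝ) (hQ : 0 < Qb)
    (hβ : |β| * R ≤ 1 / (2*q)) (hβ0 : β ≠ 0) :
    ∑ r ∈ Finset.range R, ∑ r' ∈ Finset.range R, wt Qb (((a:ℝ)/q + β) * ((r:ℝ) - r')) ≤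
     (2 * q / Qb + 1/R + 2 * (1 + Real.log R) / (Qb * |β| * q * R)) * (R:ℝ)^2 := by
  have hR' : (1:ℝ) ≤ R := by exact_mod_cast hR
  have hq' : (1:ℝ) ≤ q := by exact_mod_cast hq
  have hb : 0 < |β| := abs_pos.2 hβ0
  set X := Qb * |β| * q with hX
  have hX0 : 0 < X := by positivity
  let g : ℤ → ℝ := fun k => if k = 0 then 1 else 1 / (X * |(k:ℝ)|)
  have hg : ∀ k, 0 ≤ g k := fun k => by simp only [g]; split_ifs <;> positivity
  refine (count_main R q hR hq a hco β Qb hQ hβ g hg (fun k hk => ?_)).trans ?_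
  · simp only [g]
    split_ifs with hk0
    · exact wt_le_one _ _
    · have hk1 : 0 < |(k:ℝ)| := abs_pos.2 (by exact_mod_cast hk0)
      have hhalf : |β * (k*q)| ≤ 1/2 := by
        have hk' : |(k:ℝ)| * q ≤ R := by
          rw [← Int.cast_abs]; exact_mod_cast hk.le
        calc |β * (k*q)| = |β| * (|(k:ℝ)| * q) := by rw [abs_mul, abs_mul, abs_of_pos (by positivity : (0:ℝ) < q)]
          _ ≤ |β| * R := by gcongr
          _ ≤ 1/(2*q) := hβ
          _ ≤ 1/2 := by apply one_div_le_one_div_of_le <;> linarith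
      have hd : |β| * (|(k:ℝ)| * q) ≤ dz (β * (k*q)) := by
        apply dz_ge_of
        intro z
        have e : |β| * (|(k:ℝ)| * q) = |β * (k*q)| := by rw [abs_mul, abs_mul, abs_of_pos (by positivity : (0:ℝ) < q)]
        rw [e]
        rcases eq_or_ne z 0 with rfl | hz
        · simp
        · have h1 : (1:ℝ) ≤ |(z:ℝ)| := by rw [← Int.cast_abs]; exact_mod_cast Int.one_le_abs hz
          have h2 := abs_sub_abs_le_abs_sub (z:ℝ) (β * (k*q))
          rw [abs_sub_comm] at h2
          linarith
      refine (wt_le Qb _ _ hQ (by positivity) hd).trans (le_of_eq ?_)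
      rw [hX]; congr 1; ring
  · have heven : Function.Even g := by
      intro k; simp [g]
    rw [Finset.sum_Icc_of_even_eq_range heven, Finset.sum_range_succ']
    set n := R/q with hn
    have hnR : n ≤ R := Nat.div_le_self _ _
    have hsum : ∑ k ∈ Finset.range n, g ((k+1:ℕ):ℤ) ≤ (1 + Real.log R) / X := by
      have h1 : ∑ k ∈ Finset.range n, g ((k+1:ℕ):ℤ) = (1/X) * ((harmonic n : ℚ):ℝ) := by
        rw [harmonic]
        push_cast
        rw [Finset.mul_sum]
        refine Finset.sum_congr rfl fun k _ => ?_
        simp only [g]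
        rw [if_neg (by omega)]
        have : |(((k:ℤ)+1:ℤ):ℝ)| = (k:ℝ) + 1 := by
          push_cast; exact abs_of_pos (by positivity)
        rw [this]; field_simp
      rw [h1]
      rcases Nat.eq_zero_or_pos n with h0 | h0
      · rw [h0]; simp;
        have := Real.log_nonneg hR'
        positivity
      have h2 := harmonic_le_one_add_log n
      have h3 : Real.log n ≤ Real.log R := Real.log_le_log (by exact_mod_cast h0) (by exact_mod_cast hnR)
      rw [one_div, inv_mul_eq_div]
      gcongr; linarith
    have hg0 : g 0 = 1 := by simp [g]
    have hg0' : g ((0:ℕ):ℤ) = 1 := by simp [g]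
    rw [hg0, hg0', two_nsmul]
    calc _ ≤ (2 * q / Qb) * (R:ℝ)^2 + R * (1 + 2 * ((1 + Real.log R) / X)) := by gcongr; linarith
      _ = _ := by field_simp; ring

lemma eC_lip (a b : ℝ) : ‖eC a - eC b‖ ≤ 2 * π * |a - b| := by
  have h : eC a - eC b = eC b * (eC (a - b) - 1) := by
    rw [mul_sub, ← eC_add]; simp
  rw [h, norm_mul, eC_norm, one_mul]
  have := Real.norm_exp_I_mul_ofReal_sub_one_le (x := 2 * π * (a - b))
  have e : (Complex.I * ((2 * π * (a-b) : ℝ):ℂ)) = (2 * (π:ℂ) * Complex.I * ((a-b:ℝ):ℂ)) := by push_cast; ring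
  rw [e] at this
  unfold eC
  refine this.trans (le_of_eq ?_)
  rw [Real.norm_eq_abs, abs_mul, abs_of_pos (by positivity : 0 < 2 * π)]

lemma shift_one (f : ℤ → ℂ) (hf : ∀ n, ‖f n‖ ≤ 1) (A B : ℤ) (L : ℕ) (u : ℤ) (hu0 : 0 ≤ u) (hu : u ≤ L) :
    ‖∑ n ∈ Finset.Ioc A B, f n - ∑ n ∈ Finset.Ioc A (B - L), f (n + u)‖ ≤ L := by
  have h1 : ∑ n ∈ Finset.Ioc A (B - L), f (n + u) = ∑ n ∈ Finset.Ioc (A+u) (B - L + u), f n := by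
    rw [← Finset.map_add_right_Ioc, Finset.sum_map]; rfl
  have hsub : Finset.Ioc (A+u) (B - L + u) ⊆ Finset.Ioc A B := by
    apply Finset.Ioc_subset_Ioc <;> omega
  rw [h1, ← Finset.sum_sdiff hsub, add_sub_cancel_right]
  refine (norm_sum_le _ _).trans ?_
  refine (Finset.sum_le_sum (fun n _ => hf n)).trans ?_
  rw [Finset.sum_const, nsmul_eq_mul, mul_one, Finset.card_sdiff_of_subset hsub, Int.card_Ioc, Int.card_Ioc]
  have : (B - A).toNat - (B - L + u - (A + u)).toNat ≤ L := by omega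
  exact_mod_cast this

lemma shift_lemma (f : ℤ → ℂ) (hf : ∀ n, ‖f n‖ ≤ 1) (A B : ℤ) (M R : ℕ) (hM : 1 ≤ M) (hR : 1 ≤ R) (X N : ℝ) (hX : 0 ≤ X)
    (hN : 0 ≤ N) (hAB : (B:ℝ) - A ≤ N)
    (h : ∀ n : ℤ, A < n → n + R + M ≤ B → ∑ r ∈ Finset.range R, ‖∑ t ∈ Finset.Icc (1:ℤ) M, f (n + r + t)‖ ≤ R * M * X) :
    ‖∑ n ∈ Finset.Ioc A B, f n‖ ≤ (R + M) + N * X := by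
  set S := ∑ n ∈ Finset.Ioc A B, f n with hS
  have hM' : (1:ℝ) ≤ M := by exact_mod_cast hM
  have hR' : (1:ℝ) ≤ R := by exact_mod_cast hR
  set L : ℕ := R + M with hL
  have hdiff : ‖(R:ℂ) * M * S - ∑ r ∈ Finset.range R, ∑ t ∈ Finset.Icc (1:ℤ) M, ∑ n ∈ Finset.Ioc A (B - L), f (n + (r + t))‖ ≤ R * M * L := by
    have e : (R:ℂ) * M * S = ∑ r ∈ Finset.range R, ∑ t ∈ Finset.Icc (1:ℤ) M, S := by
      simp [mul_assoc]
    rw [e, ← Finset.sum_sub_distrib]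
    refine (norm_sum_le _ _).trans ?_
    have : ∀ r ∈ Finset.range R, ‖∑ t ∈ Finset.Icc (1:ℤ) M, S - ∑ t ∈ Finset.Icc (1:ℤ) M, ∑ n ∈ Finset.Ioc A (B - L), f (n + (r + t))‖ ≤ M * L := by
      intro r hr
      rw [← Finset.sum_sub_distrib]
      refine (norm_sum_le _ _).trans ?_
      have : ∀ t ∈ Finset.Icc (1:ℤ) M, ‖S - ∑ n ∈ Finset.Ioc A (B - L), f (n + (r + t))‖ ≤ L := by
        intro t ht
        rw [Finset.mem_Icc] at ht
        rw [Finset.mem_range] at hr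
        exact shift_one f hf A B L _ (by omega) (by omega)
      refine (Finset.sum_le_sum this).trans ?_
      simp
    refine (Finset.sum_le_sum this).trans ?_
    simp [mul_assoc]
  have hmain : ‖∑ r ∈ Finset.range R, ∑ t ∈ Finset.Icc (1:ℤ) M, ∑ n ∈ Finset.Ioc A (B - L), f (n + (r + t))‖ ≤ N * (R * M * X) := by
    have e : ∑ r ∈ Finset.range R, ∑ t ∈ Finset.Icc (1:ℤ) M, ∑ n ∈ Finset.Ioc A (B - L), f (n + (r + t)) =
       ∑ n ∈ Finset.Ioc A (B - L), ∑ r ∈ Finset.range R, ∑ t ∈ Finset.Icc (1:ℤ) M, f (n + r + t) := by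
      rw [Finset.sum_comm (s := Finset.Ioc A (B - L))]
      refine Finset.sum_congr rfl fun r _ => ?_
      rw [Finset.sum_comm]
      simp only [add_assoc]
    rw [e]
    refine (norm_sum_le _ _).trans ?_
    have : ∀ n ∈ Finset.Ioc A (B - L), ‖∑ r ∈ Finset.range R, ∑ t ∈ Finset.Icc (1:ℤ) M, f (n + r + t)‖ ≤ R * M * X := by
      intro n hn
      rw [Finset.mem_Ioc] at hn
      exact (norm_sum_le _ _).trans (h n hn.1 (by omega))
    refine (Finset.sum_le_sum this).trans ?_
    rw [Finset.sum_const, nsmul_eq_mul, Int.card_Ioc]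
    refine mul_le_mul_of_nonneg_right ?_ (by positivity)
    rcases le_or_gt 0 (B - L - A) with h0 | h0
    · have : (((B - L - A).toNat : ℤ):ℝ) = ((B - L - A : ℤ):ℝ) := by rw [Int.toNat_of_nonneg h0]
      have e2 : (((B - L - A).toNat : ℕ):ℝ) = ((B - L - A : ℤ):ℝ) := by rw [← this]; norm_cast
      rw [e2]; push_cast; linarith [(Nat.cast_nonneg L : (0:ℝ) ≤ L)]
    · rw [Int.toNat_of_nonpos h0.le]; simpa using hN
  have h2 : ‖(R:ℂ) * M * S‖ ≤ R * M * L + N * (R * M * X) := by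
    have := norm_sub_norm_le ((R:ℂ) * M * S) (∑ r ∈ Finset.range R, ∑ t ∈ Finset.Icc (1:ℤ) M, ∑ n ∈ Finset.Ioc A (B - L), f (n + (r + t)))
    linarith
  rw [norm_mul, norm_mul, Complex.norm_natCast, Complex.norm_natCast] at h2
  have h3 : (R:ℝ) * M * ‖S‖ ≤ R * M * ((R + M) + N * X) := by
    refine h2.trans (le_of_eq ?_)
    rw [hL]; push_cast; ring
  exact le_of_mul_le_mul_left h3 (by positivity)

open Polynomial in
lemma taylor_poly (γ : ℝ) (d : ℕ) : ∃ p : ℝ[X], p.natDegree ≤ d ∧ ∃ C : ℝ, 0 ≤ C ∧ ∀ w : ℝ, 0 ≤ w → w ≤ 2 →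
    |(1+w)^γ - p.eval w| ≤ C * w^(d+1) := by
  have hf : ContDiffOn ℝ (d+1) (fun w : ℝ => (1+w)^γ) (Set.Icc 0 2) := by
    apply ContDiffOn.rpow_const_of_ne
    · fun_prop
    · intro x hx; have := hx.1; positivity
  obtain ⟨C0, hC⟩ := exists_taylor_mean_remainder_bound (by norm_num : (0:ℝ) ≤ 2) hf
  refine ⟨∑ k ∈ Finset.range (d+1), C (((k.factorial:ℝ))⁻¹ * iteratedDerivWithin k (fun w : ℝ => (1+w)^γ) (Set.Icc 0 2) 0) * X^k, ?_, max C0 0, le_max_right _ _, ?_⟩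
  · apply natDegree_sum_le_of_forall_le
    intro k hk
    have := Finset.mem_range.1 hk
    exact (natDegree_C_mul_X_pow_le _ _).trans (by omega)
  · intro w hw0 hw2
    have := hC w ⟨hw0, hw2⟩
    rw [taylor_within_apply] at this
    rw [Real.norm_eq_abs] at this
    have e : eval w (∑ k ∈ Finset.range (d+1), C (((k.factorial:ℝ))⁻¹ * iteratedDerivWithin k (fun w : ℝ => (1+w)^γ) (Set.Icc 0 2) 0) * X^k)
       = ∑ k ∈ Finset.range (d + 1), ((k.factorial:ℝ)⁻¹ * (w - 0) ^ k) • iteratedDerivWithin k (fun w : ℝ => (1+w)^γ) (Set.Icc 0 2) 0 := by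
      rw [eval_finsetSum]
      refine Finset.sum_congr rfl fun k _ => ?_
      simp; ring
    rw [e]
    refine this.trans ?_
    rw [sub_zero]
    have := le_max_left C0 0
    gcongr

def GG (d : ℕ) : ℝ := 2 / (5 * d * (d+1))
def dl (d : ℕ) : ℝ := (1 + 3 * GG d) / (d+1)
def rr (d : ℕ) : ℝ := (d - 1) * dl d - 2 * GG d

lemma GG_mul (d : ℕ) (hd : 4 ≤ d) : GG d * (d * (d+1)) = 2/5 := by
  have : (0:ℝ) < d := by exact_mod_cast (by omega : 0 < d)
  unfold GG; field_simp
lemma dl_mul (d : ℕ) : dl d * (d+1) = 1 + 3 * GG d := by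
  unfold dl; field_simp
lemma GG_pos (d : ℕ) (hd : 4 ≤ d) : 0 < GG d := by
  have : (0:ℝ) < d := by exact_mod_cast (by omega : 0 < d)
  unfold GG; positivity
lemma GG_le (d : ℕ) (hd : 4 ≤ d) : GG d ≤ 1/50 := by
  have h4 : (4:ℝ) ≤ d := by exact_mod_cast hd
  have := GG_mul d hd
  have := GG_pos d hd
  have h5 : (20:ℝ) ≤ d * (d+1) := by nlinarith
  nlinarith
lemma dl_le (d : ℕ) (hd : 4 ≤ d) : dl d ≤ 53/250 := by
  have h4 : (4:ℝ) ≤ d := by exact_mod_cast hd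
  have := dl_mul d
  have := GG_le d hd
  nlinarith
lemma dl_pos (d : ℕ) (hd : 4 ≤ d) : 0 < dl d := by
  have := GG_pos d hd
  unfold dl; positivity
lemma dl_ge (d : ℕ) (hd : 4 ≤ d) : GG d ≤ dl d := by
  have h4 : (4:ℝ) ≤ d := by exact_mod_cast hd
  have h1 := GG_pos d hd
  have h2 := GG_mul d hd
  have h3 := dl_mul d
  have : GG d * (d+1) ≤ dl d * (d+1) := by rw [h3]; nlinarith
  exact le_of_mul_le_mul_right this (by positivity)
lemma rr_ge (d : ℕ) (hd : 4 ≤ d) : 14/25 ≤ rr d := by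
  have h4 : (4:ℝ) ≤ d := by exact_mod_cast hd
  have h1 := GG_pos d hd
  have h2 := GG_le d hd
  have h3 := dl_mul d
  have h5 : (3:ℝ)/5 ≤ (d-1) * dl d := by
    have : 3/5 * ((d:ℝ)+1) ≤ (d-1) * dl d * (d+1) := by
      rw [mul_assoc, h3]; nlinarith
    exact le_of_mul_le_mul_right this (by positivity)
  unfold rr; linarith
lemma rr_le (d : ℕ) (hd : 4 ≤ d) : rr d ≤ 1 - dl d := by
  have h4 : (4:ℝ) ≤ d := by exact_mod_cast hd
  have h1 := GG_pos d hd
  have h2 := GG_mul d hd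
  have h3 := dl_mul d
  have h5 : d * dl d ≤ 1 := by
    have : (d * dl d) * ((d:ℝ)+1) ≤ 1 * (d+1) := by
      rw [mul_assoc, h3]; nlinarith
    exact le_of_mul_le_mul_right this (by positivity)
  unfold rr; nlinarith
lemma rr_add (d : ℕ) : (1 - dl d) * (d-1) + rr d = d - 1 - 2 * GG d := by
  unfold rr; ring
lemma rr_sub (d : ℕ) (hd : 4 ≤ d) : 1 ≤ (1 - dl d) * (d-1) - rr d := by
  have h4 : (4:ℝ) ≤ d := by exact_mod_cast hd
  have h1 := GG_pos d hd
  have h2 := dl_le d hd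
  unfold rr; nlinarith

open Polynomial in
lemma phase_approx (γ : ℝ) (d : ℕ) : ∃ pd C : ℝ, 0 ≤ C ∧ ∀ (θ h n0 z : ℝ), 0 ≤ h → 0 < z →
    ∃ P : ℝ[X], P.natDegree ≤ d ∧ P.coeff d = θ + h * z^γ * (pd * (z⁻¹)^d) ∧ ∀ u : ℝ, 0 ≤ u → u ≤ 2 * z →
      |θ * (n0 + u)^d + h * (z + u)^γ - P.eval u| ≤ h * z^γ * (C * (u / z)^(d+1)) := by
  obtain ⟨p, hp, C0, hC0, hC⟩ := taylor_poly γ d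
  refine ⟨p.coeff d, C0, hC0, fun θ h n0 z hh hz => ?_⟩
  refine ⟨C θ * (X + C n0)^d + C (h * z^γ) * p.comp (C z⁻¹ * X), ?_, ?_, ?_⟩
  · have h1 : (C θ * (X + C n0)^d).natDegree ≤ d := by
      refine (natDegree_C_mul_le _ _).trans ?_
      refine natDegree_pow_le.trans ?_
      rw [natDegree_X_add_C, mul_one]
    have h2 : (C (h * z^γ) * p.comp (C z⁻¹ * X)).natDegree ≤ d := by
      refine (natDegree_C_mul_le _ _).trans ?_
      refine natDegree_comp_le.trans ?_
      have : (C z⁻¹ * X : ℝ[X]).natDegree ≤ 1 := (natDegree_C_mul_le _ _).trans natDegree_X_le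
      nlinarith
    exact natDegree_add_le_of_degree_le h1 h2
  · rw [coeff_add, coeff_C_mul, coeff_C_mul, coeff_X_add_C_pow, comp_C_mul_X_coeff]
    simp
  · intro u hu0 hu
    have hw := hC (u/z) (by positivity) (by rw [div_le_iff₀ hz]; linarith)
    have e : (z + u)^γ = z^γ * (1 + u/z)^γ := by
      rw [← Real.mul_rpow hz.le (by positivity)]; congr 1; field_simp
    have e2 : θ * (n0 + u)^d + h * (z + u)^γ - eval u (C θ * (X + C n0)^d + C (h * z^γ) * p.comp (C z⁻¹ * X))
       = h * z^γ * ((1 + u/z)^γ - eval (u/z) p) := by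
      rw [e]; simp only [eval_add, eval_mul, eval_C, eval_pow, eval_X, eval_comp]
      rw [show z⁻¹ * u = u/z by field_simp]; ring
    rw [e2, abs_mul, abs_of_nonneg (by positivity)]
    gcongr

lemma count_comb (c0 : ℝ) (hc0 : 0 ≤ c0) : ∃ K : ℝ, 1 ≤ K ∧ ∀ (R q : ℕ) (a : ℤ) (β b Qb Y : ℝ), 1 ≤ R → 1 ≤ q → q ≤ 4 * R →
    IsCoprime a (q:ℤ) → 0 < Qb → 0 < Y → |β| * R ≤ 1 / (4*q) → |b| * R * Qb ≤ c0 → 16 * c0 * R ≤ Qb →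
    ¬ ((q:ℝ) < Y ∧ |β| * q * (R * Qb) < Y) →
    ∑ r ∈ Finset.range R, ∑ r' ∈ Finset.range R, wt Qb (((a:ℝ)/q + (β + b)) * ((r:ℝ) - r')) ≤
      (8 * R / Qb + 1 / R + K * (1 + log R) / Y) * R^2 := by
  refine ⟨2 * max 1 (2*c0) + 4, by linarith [le_max_left 1 (2*c0)], ?_⟩
  intro R q a β b Qb Y hR hq hqR hco hQ hY hβ hb h16 hnot
  set c1 := max 1 (2*c0) with hc1
  have h1 : 1 ≤ c1 := le_max_left _ _
  have h2 : 2 * c0 ≤ c1 := le_max_right _ _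
  have hR' : (1:ℝ) ≤ R := by exact_mod_cast hR
  have hq' : (1:ℝ) ≤ q := by exact_mod_cast hq
  have hqR' : (q:ℝ) ≤ 4 * R := by exact_mod_cast hqR
  have hlog : 0 ≤ log R := Real.log_nonneg hR'
  have hbR : |b| * R ≤ 1 / (4*q) := by
    rw [le_div_iff₀ (by positivity)]
    have h3 : |b| * R * Qb * 16 * R ≤ Qb * 1 := by nlinarith
    have h4 : |b| * R * (16 * R) ≤ 1 := by
      refine le_of_mul_le_mul_left ?_ hQ
      nlinarith
    have : 0 ≤ |b| * R := by positivity
    nlinarith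
  have hsum : |β + b| * R ≤ 1 / (2*q) := by
    have := abs_add_le β b
    have e : 1 / (2*(q:ℝ)) = 1/(4*q) + 1/(4*q) := by field_simp; norm_num
    rw [e]; nlinarith
  have e8 : 2 * (q:ℝ) / Qb ≤ 8 * R / Qb := by rw [div_le_div_iff_of_pos_right hQ]; linarith
  by_cases hqc : Y ≤ c1 * q
  · refine (count_one R q hR hq a hco (β+b) Qb hQ hsum).trans ?_
    gcongr ?_ * _
    have : 2 / (q:ℝ) ≤ (2 * c1 + 4) * (1 + log R) / Y := by
      rw [div_le_div_iff₀ (by positivity) hY]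
      have : 0 ≤ (2 * c1 + 4) * log R * q := by positivity
      nlinarith
    linarith
  · push Not at hqc
    have hqY : (q:ℝ) < Y := by nlinarith
    have hbig : Y ≤ |β| * q * (R * Qb) := by
      by_contra hcon; push Not at hcon; exact hnot ⟨hqY, hcon⟩
    have hbb : c1 ≤ |β| * (R * Qb) := by
      by_contra hcon; push Not at hcon
      have : |β| * q * (R * Qb) < Y := by nlinarith
      linarith
    have hb2 : |b| ≤ |β| / 2 := by
      have : |b| * (R * Qb) ≤ |β|/2 * (R * Qb) := by nlinarith
      exact le_of_mul_le_mul_right this (by positivity)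
    have hβ0 : 0 < |β| := by
      by_contra hcon
      have : |β| = 0 := le_antisymm (not_lt.1 hcon) (abs_nonneg _)
      rw [this] at hbb; linarith
    have hge : |β| / 2 ≤ |β + b| := by
      have := abs_sub_abs_le_abs_sub β (-b)
      rw [abs_neg, sub_neg_eq_add] at this; linarith
    have hne : β + b ≠ 0 := by
      intro h0; rw [h0, abs_zero] at hge; linarith
    refine (count_two R q hR hq a hco (β+b) Qb hQ hsum hne).trans ?_
    gcongr ?_ * _
    have hp : 0 < |β + b| := by linarith
    have : 2 * (1 + log R) / (Qb * |β + b| * q * R) ≤ (2 * c1 + 4) * (1 + log R) / Y := by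
      rw [div_le_div_iff₀ (by positivity) hY]
      have h5 : Y ≤ 2 * (Qb * |β + b| * q * R) := by
        have : |β| * (q * (R * Qb)) ≤ 2 * |β + b| * (q * (R * Qb)) := by gcongr; linarith
        nlinarith
      have h6 : 0 ≤ Qb * |β + b| * q * R := by positivity
      have h7 : 2 * (1 + log R) * Y ≤ 2 * (1 + log R) * (2 * (Qb * |β + b| * q * R)) := by gcongr
      have h8 : 0 ≤ (2 * c1) * (1 + log R) * (Qb * |β + b| * q * R) := by positivity
      nlinarith
    linarith

lemma floor_bd (x : ℝ) (hx : 1 ≤ x) : 1 ≤ ⌊x⌋₊ ∧ x / 2 ≤ (⌊x⌋₊:ℝ) ∧ (⌊x⌋₊:ℝ) ≤ x := by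
  have h1 : 1 ≤ ⌊x⌋₊ := Nat.le_floor (by simpa using hx)
  have h2 := Nat.lt_floor_add_one x
  have h3 : (1:ℝ) ≤ (⌊x⌋₊:ℝ) := by exact_mod_cast h1
  exact ⟨h1, by linarith, Nat.floor_le (by linarith)⟩

lemma B_bound (y R Qb K K2 : ℝ) (hy : 1 ≤ y) (hK : 0 ≤ K) (hK2 : 0 ≤ K2) (hR1 : y^(14/25:ℝ)/2 ≤ R) (hRy : R ≤ y) (hR0 : 1 ≤ R)
    (hQ : 8 * R / Qb ≤ K2 / y) :
    8 * R / Qb + 1 / R + K * (1 + log R) / y^(21/50:ℝ) ≤ (K2 + 2 + 101 * K) * y^(-(41/100):ℝ) := by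
  have y0 : 0 < y := by linarith
  have e1 : K2 / y ≤ K2 * y^(-(41/100):ℝ) := by
    rw [div_eq_mul_inv, ← Real.rpow_neg_one]
    gcongr <;> norm_num [hy]
  have e2 : 1 / R ≤ 2 * y^(-(41/100):ℝ) := by
    have : 1 / R ≤ 2 * y^(-(14/25):ℝ) := by
      rw [Real.rpow_neg y0.le, div_le_iff₀ (by linarith)]
      have hp : 0 < y^(14/25:ℝ) := by positivity
      have : 1 = 2 * (y^(14/25:ℝ))⁻¹ * (y^(14/25:ℝ)/2) := by field_simp
      rw [this]
      have : 0 ≤ 2 * (y^(14/25:ℝ))⁻¹ := by positivity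
      nlinarith
    exact this.trans (mul_le_mul_of_nonneg_left (Real.rpow_le_rpow_of_exponent_le hy (by norm_num)) (by norm_num))
  have e3 : K * (1 + log R) / y^(21/50:ℝ) ≤ 101 * K * y^(-(41/100):ℝ) := by
    have h1 : log R ≤ log y := Real.log_le_log (by linarith) hRy
    have h2 : log y ≤ y^(1/100:ℝ) / (1/100) := Real.log_le_rpow_div y0.le (by norm_num)
    have h3 : 1 ≤ y^(1/100:ℝ) := Real.one_le_rpow hy (by norm_num)
    have h4 : 1 + log R ≤ 101 * y^(1/100:ℝ) := by linarith
    have e : y^(-(41/100):ℝ) = y^(1/100:ℝ) / y^(21/50:ℝ) := by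
      rw [← Real.rpow_sub y0]; norm_num
    rw [e, ← mul_div_assoc]
    rw [div_le_div_iff_of_pos_right (by positivity)]
    nlinarith
  linarith

lemma root_bd (D : ℕ) (hD : 1 ≤ D) (S C1 W y G : ℝ) (hS : 0 ≤ S) (hC1 : 1 ≤ C1) (hW : 0 ≤ W) (hy : 1 ≤ y) (hG : G * D = 2/5)
    (h : S^D ≤ C1 * W^D * y^(-(2/5):ℝ)) : S ≤ C1 * (W * y^(-G)) := by
  have y0 : 0 < y := by linarith
  rw [← pow_le_pow_iff_left₀ hS (by positivity) (by omega : D ≠ 0)]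
  refine h.trans ?_
  rw [mul_pow, mul_pow, ← Real.rpow_natCast (y^(-G)), ← Real.rpow_mul y0.le, neg_mul, hG, ← mul_assoc]
  have : C1 ≤ C1^D := le_self_pow₀ hC1 (by omega)
  gcongr

lemma minor_block (d : ℕ) (hd : 4 ≤ d) (K2 : ℝ) (hK2 : 0 ≤ K2) (c0 : ℝ) (hc0 : 0 ≤ c0) : ∃ C : ℝ, 1 ≤ C ∧
    ∀ (y : ℝ) (M R q : ℕ) (a : ℤ) (β b : ℝ) (P : Polynomial ℝ),
    1 ≤ y → 1 ≤ M → (M:ℝ) ≤ y → 1 ≤ R → (R:ℝ) ≤ y → y^(14/25:ℝ)/2 ≤ R → 8 * R / ((M:ℝ)^(d-1)) ≤ K2 / y → 1 ≤ q → q ≤ 4 * R →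
    IsCoprime a (q:ℤ) → |β| * R ≤ 1 / (4*q) → |b| * R * (M:ℝ)^(d-1) ≤ c0 → 16 * c0 * R ≤ (M:ℝ)^(d-1) →
    ¬ ((q:ℝ) < y^(21/50:ℝ) ∧ |β| * q * (R * (M:ℝ)^(d-1)) < y^(21/50:ℝ)) →
    P.natDegree ≤ d → d * P.coeff d = a / q + (β + b) →
    ∑ r ∈ Finset.range R, ‖∑ t ∈ Finset.Icc (1:ℤ) M, eC (P.eval ((r:ℝ) + t))‖ ≤ C * (R * M * y^(-GG d)) := by
  obtain ⟨K, hK, hcount⟩ := count_comb c0 hc0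
  obtain ⟨C, hC, hbl⟩ := block_poly d (by omega) (1/100) (by norm_num)
  refine ⟨C * (K2 + 2 + 101 * K), by nlinarith, ?_⟩
  intro y M R q a β b P hy hM hMy hR hRy hR1 hQ hq hqR hco hβ hb h16 hnot hdeg hcoef
  have y0 : 0 < y := by linarith
  have hM' : (1:ℝ) ≤ M := by exact_mod_cast hM
  have hR' : (1:ℝ) ≤ R := by exact_mod_cast hR
  have h1 := hcount R q a β b ((M:ℝ)^(d-1)) (y^(21/50:ℝ)) hR hq hqR hco (by positivity) (by positivity) hβ hb h16 hnot
  have h2 := B_bound y R ((M:ℝ)^(d-1)) K K2 hy (by linarith) hK2 hR1 hRy hR' hQ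
  have h3 := hbl M R P ((K2 + 2 + 101 * K) * y^(-(41/100):ℝ)) hM hR hdeg (by
    rw [hcoef]; exact h1.trans (by gcongr))
  refine root_bd (d*(d+1)) (by nlinarith) _ _ _ y (GG d) (by positivity) (by nlinarith) (by positivity) hy (by
    push_cast; exact GG_mul d hd) (h3.trans ?_)
  have h4 : (M:ℝ)^(1/100:ℝ) ≤ y^(1/100:ℝ) := by gcongr
  have e : y^(-(2/5):ℝ) = y^(1/100:ℝ) * y^(-(41/100):ℝ) := by rw [← Real.rpow_add y0]; norm_num
  rw [e]
  calc C * ((R:ℝ) * M)^(d*(d+1)) * (M:ℝ)^(1/100:ℝ) * ((K2 + 2 + 101 * K) * y^(-(41/100):ℝ))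
      ≤ C * ((R:ℝ) * M)^(d*(d+1)) * y^(1/100:ℝ) * ((K2 + 2 + 101 * K) * y^(-(41/100):ℝ)) := by gcongr
    _ = _ := by ring

lemma dirichlet (x : ℝ) (R : ℕ) (hR : 1 ≤ R) : ∃ (q : ℕ) (a : ℤ) (β : ℝ), 1 ≤ q ∧ q ≤ 4 * R ∧ IsCoprime a (q:ℤ) ∧
    |β| * R ≤ 1 / (4*q) ∧ x = a / q + β := by
  obtain ⟨r, hr1, hr2⟩ := Real.exists_rat_abs_sub_le_and_den_le x (n := 4 * R) (by omega)
  refine ⟨r.den, r.num, x - r, r.pos, hr2, ?_, ?_, ?_⟩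
  · have := r.reduced
    rw [Int.isCoprime_iff_gcd_eq_one]; exact this
  · have hR' : (1:ℝ) ≤ R := by exact_mod_cast hR
    have hd : (1:ℝ) ≤ r.den := by exact_mod_cast r.pos
    push_cast at hr1
    rw [le_div_iff₀ (by positivity)] at hr1 ⊢
    have : 0 ≤ |x - r| * r.den := by positivity
    nlinarith
  · have : ((r.num:ℝ) / r.den) = (r:ℝ) := by exact_mod_cast r.num_div_den
    rw [this]; ring

set_option maxHeartbeats 1000000 in
theorem minor (d : ℕ) (hd : 4 ≤ d) (γ : ℝ) (hγ0 : 0 < γ) (hγ1 : γ < 1) : ∃ C y0 : ℝ, 1 ≤ C ∧ 1 ≤ y0 ∧ ∀ y ≥ y0,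
    ∀ h : ℝ, 0 ≤ h → h ≤ y^(2 * GG d) → ∀ σ : ℝ, 0 ≤ σ → σ ≤ 1 → ∀ θ : ℝ,
    ‖∑ m ∈ Finset.Ioc ⌊y⌋ ⌊2*y⌋, eC (θ * (m:ℝ)^d + h * ((m:ℝ) + σ)^γ)‖ ≤ C * y^(1 - GG d) ∨
    ∃ (q : ℕ) (a : ℤ) (β : ℝ), 1 ≤ q ∧ d * θ = a / q + β ∧ (q:ℝ) ≤ y^(21/50:ℝ) ∧
      |β| * q ≤ C * y^(21/50 - ((d:ℝ) - 1) + 2 * GG d) := by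
  obtain ⟨pd, Ct, hCt, happ⟩ := phase_approx γ d
  set c0 := d * |pd| with hc0
  have hc00 : 0 ≤ c0 := by positivity
  obtain ⟨C, hC, hblk⟩ := minor_block d hd (8 * 2^(d-1)) (by positivity) c0 hc00
  set Z : ℝ := C + 2 * π * (3 * (Ct * 2^(d+1))) with hZ
  have hZ0 : 0 ≤ Z := by positivity
  refine ⟨2 + 2 * Z + 2^d, max 1 (16 * c0 * 2^(d-1)), by linarith [one_le_pow₀ (M₀ := ℝ) (a := 2) (by norm_num) (n := d)], le_max_left _ _, ?_⟩
  intro y hyy h hh0 hh σ hσ0 hσ1 θ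
  have hy : 1 ≤ y := (le_max_left _ _).trans hyy
  have hy16 : 16 * c0 * 2^(d-1) ≤ y := (le_max_right _ _).trans hyy
  have y0 : 0 < y := by linarith
  have hdl := dl_le d hd
  have hdl0 := dl_pos d hd
  have hrr := rr_ge d hd
  have hrl := rr_le d hd
  have hG0 := GG_pos d hd
  have hGl := GG_le d hd
  have hGd := dl_ge d hd
  have hd4 : (4:ℝ) ≤ d := by exact_mod_cast hd
  have hcast : (((d-1:ℕ)):ℝ) = (d:ℝ) - 1 := by push_cast [Nat.cast_sub (by omega : 1 ≤ d)]; ring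
  obtain ⟨hM1, hMl, hMu⟩ := floor_bd (y^(1 - dl d)) (Real.one_le_rpow hy (by linarith))
  obtain ⟨hR1, hRl, hRu⟩ := floor_bd (y^(rr d)) (Real.one_le_rpow hy (by linarith))
  set M := ⌊y^(1 - dl d)⌋₊ with hM
  set R := ⌊y^(rr d)⌋₊ with hR
  have hM' : (1:ℝ) ≤ M := by exact_mod_cast hM1
  have hR' : (1:ℝ) ≤ R := by exact_mod_cast hR1
  have hMG : y^(1 - dl d) ≤ y^(1 - GG d) := Real.rpow_le_rpow_of_exponent_le hy (by linarith)
  have hRM : y^(rr d) ≤ y^(1 - dl d) := Real.rpow_le_rpow_of_exponent_le hy (by linarith)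
  have hGy : y^(1 - GG d) ≤ y := by
    conv_rhs => rw [← Real.rpow_one y]
    exact Real.rpow_le_rpow_of_exponent_le hy (by linarith)
  set Q : ℝ := (M:ℝ)^(d-1) with hQ
  have hQ0 : 0 < Q := by positivity
  set V := y^((1 - dl d) * ((d:ℝ) - 1)) with hV
  have eV : (y^(1 - dl d))^(d-1) = V := by
    rw [← Real.rpow_natCast, hcast, ← Real.rpow_mul y0.le]
  have hV0 : 0 < V := by positivity
  have hQu : Q ≤ V := by rw [← eV]; exact pow_le_pow_left₀ (by positivity) hMu _
  have hQl : V / 2^(d-1) ≤ Q := by rw [← eV, ← div_pow]; exact pow_le_pow_left₀ (by positivity) hMl _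
  have hVR : y^(rr d) * y ≤ V := by
    rw [hV]; nth_rewrite 2 [← Real.rpow_one y]; rw [← Real.rpow_add y0]
    exact Real.rpow_le_rpow_of_exponent_le hy (by linarith [rr_sub d hd])
  have hQR : R * y ≤ 2^(d-1) * Q := by
    rw [div_le_iff₀ (by positivity)] at hQl
    nlinarith
  obtain ⟨q, a, β, hq1, hq4, hco, hβ, hθ⟩ := dirichlet (d * θ) R hR1
  have hq' : (1:ℝ) ≤ q := by exact_mod_cast hq1
  by_cases hmaj : ((q:ℝ) < y^(21/50:ℝ) ∧ |β| * q * (R * Q) < y^(21/50:ℝ))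
  · right
    refine ⟨q, a, β, hq1, hθ, hmaj.1.le, ?_⟩
    have h1 : y^((d:ℝ) - 1 - 2 * GG d) ≤ 2^d * (R * Q) := by
      rw [← rr_add d, Real.rpow_add y0]
      rw [div_le_iff₀ (by positivity)] at hQl
      calc V * y^(rr d) ≤ (Q * 2^(d-1)) * (R * 2) := by gcongr; linarith
        _ = 2^(d-1+1) * (R * Q) := by rw [pow_succ]; ring
        _ = _ := by rw [show d - 1 + 1 = d by omega]
    have e : y^(21/50 - ((d:ℝ) - 1) + 2 * GG d) = y^(21/50:ℝ) / y^((d:ℝ) - 1 - 2 * GG d) := by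
      rw [← Real.rpow_sub y0]; congr 1; ring
    rw [e, ← mul_div_assoc, le_div_iff₀ (by positivity)]
    have h0 : 0 ≤ |β| * q := by positivity
    have h2 : |β| * q * y^((d:ℝ) - 1 - 2 * GG d) ≤ |β| * q * (2^d * (R * Q)) := by gcongr
    have h3 : |β| * q * (2^d * (R * Q)) ≤ 2^d * y^(21/50:ℝ) := by
      have := mul_le_mul_of_nonneg_left hmaj.2.le (by positivity : (0:ℝ) ≤ 2^d)
      linarith
    have h4 : 0 ≤ (2 + 2 * Z) * y^(21/50:ℝ) := by positivity
    linarith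
  left
  have key := shift_lemma (fun m : ℤ => eC (θ * (m:ℝ)^d + h * ((m:ℝ) + σ)^γ)) (fun n => (eC_norm _).le) ⌊y⌋ ⌊2*y⌋ M R hM1 hR1
    (Z * y^(-GG d)) (2 * y) (by positivity) (by positivity) (by
      have := Int.floor_le (2*y); have := Int.lt_floor_add_one y; linarith) ?_
  · refine key.trans ?_
    have e : y^(1 - GG d) = y * y^(-GG d) := by
      rw [sub_eq_add_neg, Real.rpow_add y0, Real.rpow_one]
    have h1 : 0 ≤ 2^d * y^(1 - GG d) := by positivity
    calc (R:ℝ) + M + 2 * y * (Z * y^(-GG d)) ≤ 2 * y^(1 - GG d) + 2 * Z * (y * y^(-GG d)) := by linarith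
      _ ≤ _ := by rw [← e]; linarith
  · intro n hn1 hn2
    have hny : y ≤ n := by
      have := Int.lt_floor_add_one y
      have h5 : ((⌊y⌋ + 1 : ℤ):ℝ) ≤ n := by exact_mod_cast hn1
      push_cast at h5; linarith
    have hn2y : (n:ℝ) ≤ 2 * y := by
      have h5 : n ≤ ⌊2*y⌋ := by omega
      exact Int.le_floor.1 h5
    have hz0 : 0 < (n:ℝ) + σ := by linarith
    obtain ⟨P, hPd, hPc, hPa⟩ := happ θ h n ((n:ℝ)+σ) hh0 hz0
    set z := (n:ℝ) + σ with hz
    have hzy : y ≤ z := by linarith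
    have hz3 : z ≤ 3 * y := by linarith
    have hzz : h * z^γ ≤ 3 * (y^(2 * GG d) * y) := by
      have : z^γ ≤ 3 * y := by
        calc z^γ ≤ z^(1:ℝ) := Real.rpow_le_rpow_of_exponent_le (by linarith) hγ1.le
          _ ≤ 3 * y := by rw [Real.rpow_one]; exact hz3
      calc h * z^γ ≤ y^(2 * GG d) * (3 * y) := by gcongr
        _ = _ := by ring
    have hb : |d * (h * z^γ * (pd * (z⁻¹)^d))| * R * Q ≤ c0 := by
      have e1 : z^γ * (z⁻¹)^d = z^(γ - d) := by
        rw [Real.rpow_sub hz0, inv_pow, Real.rpow_natCast, div_eq_mul_inv]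
      have e2 : z^(γ - d) ≤ y^(γ - d) := Real.rpow_le_rpow_of_nonpos y0 hzy (by linarith)
      have e3 : |d * (h * z^γ * (pd * (z⁻¹)^d))| = c0 * (h * z^(γ - d)) := by
        rw [← e1, abs_mul, abs_mul, abs_mul, abs_mul, Nat.abs_cast, abs_of_nonneg hh0, abs_of_nonneg (by positivity : 0 ≤ z^γ),
          abs_of_nonneg (by positivity : 0 ≤ (z⁻¹)^d), hc0]; ring
      rw [e3]
      have e4 : y^(2 * GG d) * y^(γ - d) * y^(rr d) * V ≤ 1 := by
        rw [hV, ← Real.rpow_add y0, ← Real.rpow_add y0, ← Real.rpow_add y0]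
        exact Real.rpow_le_one_of_one_le_of_nonpos hy (by linarith [rr_add d])
      calc c0 * (h * z^(γ - d)) * R * Q ≤ c0 * (y^(2 * GG d) * y^(γ - d)) * y^(rr d) * V := by gcongr
        _ = c0 * (y^(2 * GG d) * y^(γ - d) * y^(rr d) * V) := by ring
        _ ≤ c0 * 1 := by gcongr
        _ = c0 := mul_one _
    have hP := hblk y M R q a β (d * (h * z^γ * (pd * (z⁻¹)^d))) P hy hM1 (by linarith) hR1 (by linarith)
      ((div_le_div_of_nonneg_right (Real.rpow_le_rpow_of_exponent_le hy hrr) (by norm_num)).trans hRl)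
      (by rw [div_le_div_iff₀ hQ0 y0]; linarith) hq1 hq4 hco hβ hb
      (by
        have h2 : (0:ℝ) < 2^(d-1) := by positivity
        have h3 : 16 * c0 * 2^(d-1) * R ≤ y * R := mul_le_mul_of_nonneg_right hy16 (by positivity)
        have : 2^(d-1) * (16 * c0 * R) ≤ 2^(d-1) * Q := by linarith
        exact le_of_mul_le_mul_left this h2) hmaj hPd (by rw [hPc, mul_add, hθ]; ring)
    have herr : ∀ r ∈ Finset.range R, ∀ t ∈ Finset.Icc (1:ℤ) M,
        ‖eC (θ * ((n + r + t : ℤ):ℝ)^d + h * (((n + r + t : ℤ):ℝ) + σ)^γ) - eC (P.eval ((r:ℝ) + t))‖ ≤ 2 * π * (3 * (Ct * 2^(d+1))) * y^(-GG d) := by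
      intro r hr t ht
      rw [Finset.mem_range] at hr
      rw [Finset.mem_Icc] at ht
      have ht1 : (1:ℝ) ≤ t := by exact_mod_cast ht.1
      have ht2 : (t:ℝ) ≤ M := by exact_mod_cast ht.2
      have hr2 : (r:ℝ) ≤ R := by exact_mod_cast hr.le
      have hr0 : (0:ℝ) ≤ r := Nat.cast_nonneg _
      have hu : (r:ℝ) + t ≤ 2 * y^(1 - dl d) := by linarith
      refine (eC_lip _ _).trans ?_
      rw [mul_assoc (2*π) (3 * (Ct * 2^(d+1)))]
      refine mul_le_mul_of_nonneg_left ?_ (by positivity)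
      have := hPa ((r:ℝ) + t) (by linarith) (by linarith)
      push_cast
      rw [show (n:ℝ) + r + t = n + (r + t) by ring, show (n:ℝ) + (r + t) + σ = z + (r + t) by rw [hz]; ring]
      refine this.trans ?_
      have e1 : ((r:ℝ) + t) / z ≤ 2 * y^(-dl d) := by
        rw [div_le_iff₀ hz0]
        have : y^(1 - dl d) = y^(-dl d) * y := by
          rw [sub_eq_neg_add, Real.rpow_add y0, Real.rpow_one]
        have h7 : y^(-dl d) * y ≤ y^(-dl d) * z := by gcongr
        linarith
      have e2 : y^(2 * GG d) * y * (y^(-dl d))^(d+1) = y^(-GG d) := by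
        rw [← Real.rpow_natCast, ← Real.rpow_mul y0.le]
        nth_rewrite 2 [← Real.rpow_one y]
        rw [← Real.rpow_add y0, ← Real.rpow_add y0]; congr 1
        push_cast; linarith [dl_mul d]
      calc h * z^γ * (Ct * (((r:ℝ) + t) / z)^(d+1)) ≤ 3 * (y^(2 * GG d) * y) * (Ct * (2 * y^(-dl d))^(d+1)) := by
            have : 0 ≤ ((r:ℝ) + t) / z := by positivity
            gcongr
        _ = 3 * (Ct * 2^(d+1)) * (y^(2 * GG d) * y * (y^(-dl d))^(d+1)) := by rw [mul_pow]; ring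
        _ = _ := by rw [e2]
    have hr : ∀ r ∈ Finset.range R, ‖∑ t ∈ Finset.Icc (1:ℤ) M, eC (θ * ((n + r + t : ℤ):ℝ)^d + h * (((n + r + t : ℤ):ℝ) + σ)^γ)‖ ≤
        ‖∑ t ∈ Finset.Icc (1:ℤ) M, eC (P.eval ((r:ℝ) + t))‖ + M * (2 * π * (3 * (Ct * 2^(d+1))) * y^(-GG d)) := by
      intro r hr
      have h1 : ‖∑ t ∈ Finset.Icc (1:ℤ) M, eC (θ * ((n + r + t : ℤ):ℝ)^d + h * (((n + r + t : ℤ):ℝ) + σ)^γ) -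
          ∑ t ∈ Finset.Icc (1:ℤ) M, eC (P.eval ((r:ℝ) + t))‖ ≤ M * (2 * π * (3 * (Ct * 2^(d+1))) * y^(-GG d)) := by
        rw [← Finset.sum_sub_distrib]
        refine (norm_sum_le _ _).trans ((Finset.sum_le_sum (herr r hr)).trans ?_)
        simp
      have h2 := norm_sub_norm_le (∑ t ∈ Finset.Icc (1:ℤ) M, eC (θ * ((n + r + t : ℤ):ℝ)^d + h * (((n + r + t : ℤ):ℝ) + σ)^γ))
          (∑ t ∈ Finset.Icc (1:ℤ) M, eC (P.eval ((r:ℝ) + t)))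
      linarith
    refine (Finset.sum_le_sum hr).trans ?_
    rw [Finset.sum_add_distrib, Finset.sum_const, Finset.card_range, nsmul_eq_mul]
    refine (add_le_add_left hP _).trans (le_of_eq ?_)
    rw [hZ]; ring

def ct (x : ℝ) : ℝ := cos (π * x) / sin (π * x)

lemma sin_lb (x D : ℝ) (hD : 0 < D) (h1 : D ≤ x) (h2 : x ≤ 1 - D) : 2 * D ≤ sin (π * x) := by
  have hpi := Real.pi_pos
  rcases le_total x (1/2) with h | h
  · have := Real.mul_le_sin (x := π * x) (by nlinarith) (by nlinarith)
    have e : 2 / π * (π * x) = 2 * x := by field_simp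
    rw [e] at this; linarith
  · have := Real.mul_le_sin (x := π * (1 - x)) (by nlinarith) (by nlinarith)
    have e : 2 / π * (π * (1-x)) = 2 * (1-x) := by field_simp
    rw [e, show π * (1 - x) = π - π * x by ring, Real.sin_pi_sub] at this; linarith

lemma ct_abs (x D : ℝ) (hD : 0 < D) (h1 : D ≤ x) (h2 : x ≤ 1 - D) : |ct x| ≤ 1 / (2 * D) := by
  have h := sin_lb x D hD h1 h2
  unfold ct
  rw [abs_div, abs_of_pos (by linarith : 0 < sin (π * x))]
  gcongr
  exact Real.abs_cos_le_one _

lemma ct_anti (x z D : ℝ) (hD : 0 < D) (h1 : D ≤ x) (hxz : x ≤ z) (h2 : z ≤ 1 - D) : ct z ≤ ct x := by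
  have hx := sin_lb x D hD h1 (by linarith)
  have hz := sin_lb z D hD (by linarith) h2
  unfold ct
  rw [div_le_div_iff₀ (by linarith) (by linarith)]
  have : 0 ≤ sin (π * z - π * x) := Real.sin_nonneg_of_nonneg_of_le_pi (by nlinarith [Real.pi_pos]) (by nlinarith [Real.pi_pos])
  rw [Real.sin_sub] at this
  linarith

lemma ct_eq (x : ℝ) (h : sin (π * x) ≠ 0) : (1/2 + Complex.I / 2 * (ct x : ℂ)) * (1 - eC x) = 1 := by
  have e : eC x = (Real.cos (π * x) + Real.sin (π * x) * Complex.I)^2 := by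
    unfold eC
    rw [Complex.ofReal_cos, Complex.ofReal_sin, ← Complex.exp_mul_I, ← Complex.exp_nat_mul]
    congr 1; push_cast; ring
  have hs : (Real.sin (π * x) : ℂ) ≠ 0 := by exact_mod_cast h
  have h1 : (Real.sin (π * x) : ℂ)^2 + (Real.cos (π * x):ℂ)^2 = 1 := by exact_mod_cast Real.sin_sq_add_cos_sq (π * x)
  rw [e, ct]; push_cast [-Complex.ofReal_cos, -Complex.ofReal_sin]
  generalize (Real.sin (π * x) : ℂ) = s at *
  generalize (Real.cos (π * x) : ℂ) = c at *
  have hI := Complex.I_sq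
  field_simp
  linear_combination (s - Complex.I * c) * h1 + (- (s^3) - 2 * c^2 * s - Complex.I * s^2 * c) * hI

lemma abel (c E : ℕ → ℂ) (N : ℕ) : ∑ k ∈ Finset.range (N+1), c k * (E k - E (k+1)) =
    c 0 * E 0 - c N * E (N+1) + ∑ k ∈ Finset.range N, (c (k+1) - c k) * E (k+1) := by
  induction N with
  | zero => simp; ring
  | succ n ih => rw [Finset.sum_range_succ, ih, Finset.sum_range_succ (n := n)]; ring

lemma kusmin0 (f : ℕ → ℝ) (N : ℕ) (D : ℝ) (hD : 0 < D) (hD2 : D ≤ 1/2)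
    (h1 : ∀ k < N, D ≤ f (k+1) - f k ∧ f (k+1) - f k ≤ 1 - D)
    (h2 : ∀ k, k + 1 < N → f (k+1) - f k ≤ f (k+2) - f (k+1)) : ‖∑ k ∈ Finset.range N, eC (f k)‖ ≤ 2 / D := by
  rcases N with _ | N
  · simp; positivity
  set c : ℕ → ℂ := fun k => 1/2 + Complex.I / 2 * (ct (f (k+1) - f k) : ℂ) with hc
  have e : ∑ k ∈ Finset.range (N+1), eC (f k) = ∑ k ∈ Finset.range (N+1), c k * (eC (f k) - eC (f (k+1))) := by
    refine Finset.sum_congr rfl fun k hk => ?_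
    have hk := h1 k (Finset.mem_range.1 hk)
    have hs := sin_lb _ D hD hk.1 hk.2
    have e1 : eC (f (k+1)) = eC (f k) * eC (f (k+1) - f k) := by rw [← eC_add]; congr 1; ring
    have := ct_eq (f (k+1) - f k) (by linarith)
    rw [e1, hc]
    linear_combination (-eC (f k)) * this
  have hD4 : 1/2 ≤ 1 / (4 * D) := by rw [div_le_div_iff₀ (by norm_num) (by positivity)]; linarith
  have e42 : 1 / (2 * D) = 1/(4*D) + 1/(4*D) := by field_simp; norm_num
  have hcn : ∀ k < N+1, ‖c k‖ ≤ 1 / (2*D) := by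
    intro k hk
    have hk := h1 k hk
    have := ct_abs _ D hD hk.1 hk.2
    refine (norm_add_le _ _).trans ?_
    rw [norm_mul, Complex.norm_real, Real.norm_eq_abs, norm_div, norm_div, Complex.norm_I]
    rw [norm_one, Complex.norm_ofNat]
    linarith
  rw [e, abel c (fun k => eC (f k)) N]
  refine (norm_add_le _ _).trans ?_
  have hA : ‖c 0 * eC (f 0) - c N * eC (f (N+1))‖ ≤ 1/(2*D) + 1/(2*D) := by
    refine (norm_sub_le _ _).trans ?_
    rw [norm_mul, norm_mul, eC_norm, eC_norm, mul_one, mul_one]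
    exact add_le_add (hcn 0 (by omega)) (hcn N (by omega))
  have hB : ‖∑ k ∈ Finset.range N, (c (k+1) - c k) * eC (f (k+1))‖ ≤ 1 / (2*D) := by
    refine (norm_sum_le _ _).trans ?_
    have : ∀ k ∈ Finset.range N, ‖(c (k+1) - c k) * eC (f (k+1))‖ ≤ (1/2) * ct (f (k+1) - f k) - (1/2) * ct (f (k+1+1) - f (k+1)) := by
      intro k hk
      have hk := Finset.mem_range.1 hk
      have ha := ct_anti (f (k+1) - f k) (f (k+1+1) - f (k+1)) D hD (h1 k (by omega)).1 (h2 k (by omega)) (h1 (k+1) (by omega)).2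
      have e3 : c (k+1) - c k = Complex.I / 2 * ((ct (f (k+1+1) - f (k+1)) - ct (f (k+1) - f k) : ℝ) : ℂ) := by
        rw [hc]; push_cast; ring
      rw [norm_mul, eC_norm, mul_one, e3, norm_mul, Complex.norm_real, Real.norm_eq_abs, abs_of_nonpos (by linarith), norm_div, Complex.norm_I]
      norm_num; linarith
    refine (Finset.sum_le_sum this).trans ?_
    rw [Finset.sum_range_sub' (fun k => (1/2) * ct (f (k+1) - f k))]
    have b1 := abs_le.1 (ct_abs _ D hD (h1 0 (by omega)).1 (h1 0 (by omega)).2)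
    have b2 := abs_le.1 (ct_abs _ D hD (h1 N (by omega)).1 (h1 N (by omega)).2)
    linarith [b1.2, b2.1]
  have : 1/(2*D) + 1/(2*D) + 1/(2*D) ≤ 2 / D := by
    have e5 : 1/(2*D) = (1/2) * (1/D) := by field_simp
    have e6 : 2 / D = 2 * (1/D) := by field_simp
    have : 0 < 1 / D := by positivity
    rw [e5, e6]; linarith
  linarith

lemma kusmin (f : ℕ → ℝ) (a b : ℕ) (ν : ℤ) (D : ℝ) (hD : 0 < D) (hD2 : D ≤ 1/2)
    (h1 : ∀ k, a ≤ k → k < b → ν + D ≤ f (k+1) - f k ∧ f (k+1) - f k ≤ ν + 1 - D)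
    (h2 : ∀ k, a ≤ k → k + 1 < b → f (k+1) - f k ≤ f (k+2) - f (k+1)) : ‖∑ k ∈ Finset.Ico a b, eC (f k)‖ ≤ 2 / D := by
  rw [Finset.sum_Ico_eq_sum_range]
  have e : ∑ k ∈ Finset.range (b - a), eC (f (a + k)) = ∑ k ∈ Finset.range (b-a), eC (f (a + k) - ν * k) := by
    refine Finset.sum_congr rfl fun k _ => ?_
    have := eC_sub_int (f (a+k)) (ν * k)
    push_cast at this; exact this.symm
  rw [e]
  apply kusmin0 (fun k => f (a + k) - ν * k) (b-a) D hD hD2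
  · intro k hk
    have := h1 (a+k) (by omega) (by omega)
    simp only [← add_assoc]; push_cast
    constructor <;> linarith [this.1, this.2]
  · intro k hk
    have := h2 (a+k) (by omega) (by omega)
    simp only [← add_assoc]; push_cast
    linarith

lemma incr (φ : ℕ → ℝ) (N : ℕ) (l : ℝ) (h : ∀ k, k + 1 < N → l ≤ φ (k+1) - φ k) (i j : ℕ) (hij : i ≤ j) (hj : j < N) :
    l * ((j:ℝ) - i) ≤ φ j - φ i := by
  induction j, hij using Nat.le_induction with
  | base => simp
  | succ n hn ih =>
    have := h n hj
    have := ih (by omega)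
    push_cast; linarith

lemma card_win (φ : ℕ → ℝ) (N : ℕ) (l : ℝ) (hl : 0 < l) (h : ∀ k, k + 1 < N → l ≤ φ (k+1) - φ k) (u v : ℝ) (D : ℝ) (hD : 0 ≤ D) (huv : v - u ≤ D)
    (T : Finset ℕ) (hT : ∀ k ∈ T, k < N ∧ u ≤ φ k ∧ φ k ≤ v) : (T.card:ℝ) ≤ D / l + 1 := by
  rcases T.eq_empty_or_nonempty with h0 | h0
  · rw [h0]; simp; positivity
  have ha := T.min'_mem h0
  have hb := T.max'_mem h0
  have hab : T.min' h0 ≤ T.max' h0 := T.min'_le _ hb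
  have hsub : T ⊆ Finset.Icc (T.min' h0) (T.max' h0) := fun k hk => Finset.mem_Icc.2 ⟨T.min'_le _ hk, T.le_max' _ hk⟩
  have h1 := Finset.card_le_card hsub
  rw [Nat.card_Icc] at h1
  have h2 := incr φ N l h _ _ hab (hT _ hb).1
  have h3 : (T.card:ℝ) ≤ (T.max' h0:ℝ) + 1 - T.min' h0 := by
    have : T.card + T.min' h0 ≤ T.max' h0 + 1 := by omega
    have : (T.card:ℝ) + T.min' h0 ≤ T.max' h0 + 1 := by exact_mod_cast this
    linarith
  have h4 : (T.max' h0:ℝ) - T.min' h0 ≤ D / l := by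
    rw [le_div_iff₀ hl]
    have := (hT _ hb).2.2; have := (hT _ ha).2.1
    linarith
  linarith

lemma mid_win (φ : ℕ → ℝ) (N : ℕ) (h : ∀ k, k + 1 < N → 0 ≤ φ (k+1) - φ k) (u v : ℝ) :
    ∃ a b, b ≤ N ∧ (Finset.range N).filter (fun k => u ≤ φ k ∧ φ k ≤ v) = Finset.Ico a b := by
  set T := (Finset.range N).filter (fun k => u ≤ φ k ∧ φ k ≤ v) with hT
  rcases T.eq_empty_or_nonempty with h0 | h0
  · exact ⟨0, 0, by omega, by rw [h0]; simp⟩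
  have ha := T.min'_mem h0
  have hb := T.max'_mem h0
  have hTm : ∀ k, k ∈ T ↔ k < N ∧ u ≤ φ k ∧ φ k ≤ v := fun k => by rw [hT, Finset.mem_filter, Finset.mem_range]
  have ha' := (hTm _).1 ha
  have hb' := (hTm _).1 hb
  refine ⟨T.min' h0, T.max' h0 + 1, by omega, ?_⟩
  ext k
  rw [Finset.mem_Ico]
  constructor
  · intro hk; exact ⟨T.min'_le _ hk, by have := T.le_max' _ hk; omega⟩
  · intro hk
    rw [hTm]
    have h1 := incr φ N 0 h _ _ hk.1 (by omega)
    have h2 := incr φ N 0 h k (T.max' h0) (by omega) (by omega)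
    refine ⟨by omega, by linarith [ha'.2.1], by linarith [hb'.2.2]⟩

lemma second_test0 (f : ℕ → ℝ) (N : ℕ) (l V W : ℝ) (hl : 0 < l) (hl4 : l ≤ 1/4) (hV : 0 ≤ V)
    (h : ∀ k, k + 1 < N → l ≤ (f (k+2) - f (k+1)) - (f (k+1) - f k))
    (hW : ∀ k < N, W ≤ f (k+1) - f k ∧ f (k+1) - f k ≤ W + V) :
    ‖∑ k ∈ Finset.range N, eC (f k)‖ ≤ (V + 2) * (5 / √l + 1) := by
  set φ : ℕ → ℝ := fun k => f (k+1) - f k with hφ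
  have hd : ∀ k, k + 1 < N → l ≤ φ (k+1) - φ k := fun k hk => h k hk
  have hs0 : 0 < √l := Real.sqrt_pos.2 hl
  have hs2 : √l ≤ 1/2 := by
    rw [show (1/2:ℝ) = √(1/4) by rw [show (1/4:ℝ) = (1/2)^2 by norm_num, Real.sqrt_sq (by norm_num)]]
    exact Real.sqrt_le_sqrt hl4
  have hsl : √l / l = 1 / √l := by
    rw [div_eq_div_iff hl.ne' hs0.ne', one_mul, Real.mul_self_sqrt hl.le]
  have hmap : ∀ k ∈ Finset.range N, ⌊φ k⌋ ∈ Finset.Icc ⌊W⌋ ⌊W+V⌋ := by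
    intro k hk
    have := hW k (Finset.mem_range.1 hk)
    exact Finset.mem_Icc.2 ⟨Int.floor_le_floor this.1, Int.floor_le_floor this.2⟩
  rw [← Finset.sum_fiberwise_of_maps_to hmap]
  refine (norm_sum_le _ _).trans ?_
  have hcl : ∀ ν ∈ Finset.Icc ⌊W⌋ ⌊W+V⌋, ‖∑ k ∈ (Finset.range N).filter (fun k => ⌊φ k⌋ = ν), eC (f k)‖ ≤ 5 / √l + 1 := by
    intro ν _
    set T := (Finset.range N).filter (fun k => ⌊φ k⌋ = ν) with hT
    have hTm : ∀ k, k ∈ T ↔ k < N ∧ (ν:ℝ) ≤ φ k ∧ φ k < ν + 1 := by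
      intro k; rw [hT, Finset.mem_filter, Finset.mem_range, Int.floor_eq_iff]
    obtain ⟨a, b, hbN, hab⟩ := mid_win φ N (fun k hk => hl.le.trans (hd k hk)) (ν + √l) (ν + 1 - √l)
    have hsub : Finset.Ico a b ⊆ T := by
      intro k hk
      rw [← hab, Finset.mem_filter, Finset.mem_range] at hk
      rw [hTm]; exact ⟨hk.1, by linarith [hk.2.1], by linarith [hk.2.2]⟩
    have hmid := kusmin f a b ν (√l) hs0 hs2 (by
      intro k h1 h2
      have : k ∈ Finset.Ico a b := Finset.mem_Ico.2 ⟨h1, h2⟩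
      rw [← hab, Finset.mem_filter] at this
      exact this.2) (fun k h1 h2 => by linarith [h k (by omega)])
    rw [← Finset.sum_sdiff hsub]
    refine (norm_add_le _ _).trans ?_
    have hout : ‖∑ k ∈ T \ Finset.Ico a b, eC (f k)‖ ≤ (1/√l + 1) + (1/√l+1) := by
      refine (norm_sum_le _ _).trans ?_
      simp only [eC_norm, Finset.sum_const, nsmul_eq_mul, mul_one]
      rw [← Finset.card_filter_add_card_filter_not (s := T \ Finset.Ico a b) (fun k => φ k ≤ ν + √l)]
      push_cast
      refine add_le_add ?_ ?_
      · have := card_win φ N l hl hd ν (ν + √l) (√l) hs0.le (by linarith) ((T \ Finset.Ico a b).filter (fun k => φ k ≤ ν + √l)) (by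
          intro k hk
          rw [Finset.mem_filter, Finset.mem_sdiff, hTm] at hk
          exact ⟨hk.1.1.1, hk.1.1.2.1, hk.2⟩)
        rwa [hsl] at this
      · have := card_win φ N l hl hd (ν + 1 - √l) (ν + 1) (√l) hs0.le (by linarith) ((T \ Finset.Ico a b).filter (fun k => ¬ φ k ≤ ν + √l)) (by
          intro k hk
          rw [Finset.mem_filter, Finset.mem_sdiff, hTm, ← hab, Finset.mem_filter, Finset.mem_range] at hk
          refine ⟨hk.1.1.1, ?_, hk.1.1.2.2.le⟩
          by_contra hcon
          push Not at hcon
          have h3 := hk.2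
          push Not at h3
          exact hk.1.2 ⟨hk.1.1.1, h3.le, hcon.le⟩)
        rwa [hsl] at this
    have h21 : 2 ≤ 1 / √l := by rw [le_div_iff₀ hs0]; linarith
    have e5 : 5 / √l = 5 * (1/√l) := by field_simp
    have e2 : 2 / √l = 2 * (1/√l) := by field_simp
    rw [e2] at hmid
    rw [e5]; linarith
  refine (Finset.sum_le_sum hcl).trans ?_
  rw [Finset.sum_const, nsmul_eq_mul, Int.card_Icc]
  refine mul_le_mul_of_nonneg_right ?_ (by positivity)
  have h1 : ⌊W⌋ ≤ ⌊W+V⌋ := Int.floor_le_floor (by linarith)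
  have h2 : (((⌊W+V⌋ + 1 - ⌊W⌋).toNat : ℤ):ℝ) = ((⌊W+V⌋ + 1 - ⌊W⌋ : ℤ):ℝ) := by rw [Int.toNat_of_nonneg (by omega)]
  rw [Int.cast_natCast] at h2
  rw [h2]; push_cast
  linarith [Int.floor_le (W+V), Int.lt_floor_add_one W]

lemma second_test (f : ℕ → ℝ) (N : ℕ) (l V W : ℝ) (hl : 0 < l) (hl4 : l ≤ 1/4) (hV : 0 ≤ V)
    (h : ∀ k, k + 2 < N → l ≤ (f (k+2) - f (k+1)) - (f (k+1) - f k))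
    (hW : ∀ k, k + 1 < N → W ≤ f (k+1) - f k ∧ f (k+1) - f k ≤ W + V) :
    ‖∑ k ∈ Finset.range N, eC (f k)‖ ≤ (V + 2) * (6 / √l) := by
  have hs0 : 0 < √l := Real.sqrt_pos.2 hl
  have hs2 : √l ≤ 1/2 := by
    rw [show (1/2:ℝ) = √(1/4) by rw [show (1/4:ℝ) = (1/2)^2 by norm_num, Real.sqrt_sq (by norm_num)]]
    exact Real.sqrt_le_sqrt hl4
  have h21 : 2 ≤ 1 / √l := by rw [le_div_iff₀ hs0]; linarith
  rcases N with _ | N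
  · simp; positivity
  rw [Finset.sum_range_succ]
  refine (norm_add_le _ _).trans ?_
  rw [eC_norm]
  have := second_test0 f N l V W hl hl4 hV (fun k hk => h k (by omega)) (fun k hk => hW k (by omega))
  have e5 : 5 / √l = 5 * (1/√l) := by field_simp
  have e6 : 6 / √l = 6 * (1/√l) := by field_simp
  rw [e5] at this; rw [e6]
  nlinarith

lemma residue_split (g : ℤ → ℂ) (A B : ℤ) (q : ℕ) (hq : 1 ≤ q) : ∃ N : ℕ → ℕ,
    (∀ s k, k < N s → A + 1 + s + q * k ≤ B) ∧
    ∑ m ∈ Finset.Ioc A B, g m = ∑ s ∈ Finset.range q, ∑ k ∈ Finset.range (N s), g (A + 1 + s + q * k) := by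
  have hq0 : (0:ℤ) < q := by exact_mod_cast hq
  have hN : ∀ (s k : ℕ), k < ((B - A - 1 - s) / q + 1).toNat ↔ A + 1 + s + q * k ≤ B := by
    intro s k
    rw [Int.lt_toNat, Int.lt_add_one_iff, Int.le_ediv_iff_mul_le hq0]
    constructor <;> intro h <;> linarith
  refine ⟨fun s => ((B - A - 1 - s) / q + 1).toNat, fun s k h => (hN s k).1 h, ?_⟩
  have hmap : ∀ m ∈ Finset.Ioc A B, ((m - A - 1) % q).toNat ∈ Finset.range q := by
    intro m _
    rw [Finset.mem_range]
    have := Int.emod_nonneg (m - A - 1) hq0.ne'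
    have := Int.emod_lt_of_pos (m - A - 1) hq0
    omega
  rw [← Finset.sum_fiberwise_of_maps_to hmap]
  refine Finset.sum_congr rfl fun s hs => ?_
  rw [Finset.mem_range] at hs
  refine Finset.sum_nbij' (fun m => ((m - A - 1) / q).toNat) (fun k => A + 1 + s + q * k) ?_ ?_ ?_ ?_ ?_
  · intro m hm
    rw [Finset.mem_filter, Finset.mem_Ioc] at hm
    rw [Finset.mem_range, hN]
    have h1 := Int.emod_nonneg (m - A - 1) hq0.ne'
    have h2 := Int.emod_add_mul_ediv (m - A - 1) q
    have h3 : 0 ≤ (m - A - 1) / (q:ℤ) := Int.ediv_nonneg (by omega) hq0.le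
    rw [Int.toNat_of_nonneg h3]
    have : ((s:ℕ):ℤ) = (m - A - 1) % q := by omega
    omega
  · intro k hk
    rw [Finset.mem_range, hN] at hk
    rw [Finset.mem_filter, Finset.mem_Ioc]
    have h0 : (0:ℤ) ≤ q * k := by positivity
    refine ⟨⟨by omega, hk⟩, ?_⟩
    rw [show A + 1 + (s:ℤ) + q * k - A - 1 = s + q * k by ring, Int.add_mul_emod_self_left, Int.emod_eq_of_lt (by omega) (by omega)]
    simp
  · intro m hm
    rw [Finset.mem_filter, Finset.mem_Ioc] at hm
    have h1 := Int.emod_nonneg (m - A - 1) hq0.ne'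
    have h2 := Int.emod_add_mul_ediv (m - A - 1) q
    have h3 : 0 ≤ (m - A - 1) / (q:ℤ) := Int.ediv_nonneg (by omega) hq0.le
    rw [Int.toNat_of_nonneg h3]
    have : ((s:ℕ):ℤ) = (m - A - 1) % q := by omega
    omega
  · intro k hk
    rw [show A + 1 + (s:ℤ) + q * k - A - 1 = s + q * k by ring, Int.add_mul_ediv_left _ _ hq0.ne', Int.ediv_eq_zero_of_lt (by omega) (by omega)]
    simp
  · intro m hm
    rw [Finset.mem_filter, Finset.mem_Ioc] at hm
    have h1 := Int.emod_nonneg (m - A - 1) hq0.ne'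
    have h2 := Int.emod_add_mul_ediv (m - A - 1) q
    have h3 : 0 ≤ (m - A - 1) / (q:ℤ) := Int.ediv_nonneg (by omega) hq0.le
    rw [Int.toNat_of_nonneg h3]
    have : ((s:ℕ):ℤ) = (m - A - 1) % q := by omega
    congr 1; omega

lemma first_diff (F F1 : ℝ → ℝ) (x h V : ℝ) (hh : 0 < h) (hF : ∀ t ∈ Set.Icc x (x+h), HasDerivAt F (F1 t) t)
    (hV : ∀ t ∈ Set.Icc x (x+h), |F1 t| ≤ V) : |F (x+h) - F x| ≤ h * V := by
  obtain ⟨c, hc, e⟩ := exists_hasDerivAt_eq_slope F F1 (by linarith : x < x+h) (fun t ht => (hF t ht).continuousAt.continuousWithinAt)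
    (fun t ht => hF t ⟨ht.1.le, ht.2.le⟩)
  have h1 : F (x+h) - F x = h * F1 c := by rw [e, add_sub_cancel_left]; field_simp
  rw [h1, abs_mul, abs_of_pos hh]
  exact mul_le_mul_of_nonneg_left (hV c ⟨hc.1.le, hc.2.le⟩) hh.le

lemma second_diff (F F1 F2 : ℝ → ℝ) (x h l : ℝ) (hh : 0 < h) (hF : ∀ t ∈ Set.Icc x (x+2*h), HasDerivAt F (F1 t) t)
    (hF1 : ∀ t ∈ Set.Icc x (x+2*h), HasDerivAt F1 (F2 t) t)
    (hl : ∀ t ∈ Set.Icc x (x+2*h), l ≤ F2 t) : h^2 * l ≤ (F (x+2*h) - F (x+h)) - (F (x+h) - F x) := by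
  have hG : ∀ t ∈ Set.Icc x (x+h), HasDerivAt (fun t => F (t+h) - F t) (F1 (t+h) - F1 t) t := by
    intro t ht
    have h1 := hF (t+h) ⟨by linarith [ht.1], by linarith [ht.2]⟩
    exact (h1.comp_add_const t h).sub (hF t ⟨ht.1, by linarith [ht.2]⟩)
  obtain ⟨c, hc, e⟩ := exists_hasDerivAt_eq_slope (fun t => F (t+h) - F t) (fun t => F1 (t+h) - F1 t) (by linarith : x < x+h)
    (fun t ht => (hG t ht).continuousAt.continuousWithinAt) (fun t ht => hG t ⟨ht.1.le, ht.2.le⟩)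
  obtain ⟨c2, hc2, e2⟩ := exists_hasDerivAt_eq_slope F1 F2 (by linarith : c < c+h)
    (fun t ht => (hF1 t ⟨by linarith [hc.1, ht.1], by linarith [hc.2, ht.2]⟩).continuousAt.continuousWithinAt)
    (fun t ht => hF1 t ⟨by linarith [hc.1, ht.1], by linarith [hc.2, ht.2]⟩)
  have h3 := hl c2 ⟨by linarith [hc.1, hc2.1], by linarith [hc.2, hc2.2]⟩
  have e4 : F1 (c+h) - F1 c = h * F2 c2 := by rw [e2, add_sub_cancel_left]; field_simp
  have e5 : (F (x+h+h) - F (x+h)) - (F (x+h) - F x) = h * (F1 (c+h) - F1 c) := by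
    rw [e, add_sub_cancel_left]; field_simp
  rw [show x + 2 * h = x + h + h by ring, e5, e4]
  nlinarith [mul_le_mul_of_nonneg_left h3 (by positivity : 0 ≤ h^2)]

lemma arc (q : ℕ) (hq : 1 ≤ q) (a : ℤ) (d : ℕ) (F F1 F2 : ℝ → ℝ) (A B : ℤ) (l V : ℝ) (hl : 0 < l) (hV : 0 ≤ V)
    (hF1 : ∀ x ∈ Set.Icc ((A:ℝ)+1) B, HasDerivAt F (F1 x) x) (hF2 : ∀ x ∈ Set.Icc ((A:ℝ)+1) B, HasDerivAt F1 (F2 x) x)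
    (hlb : ∀ x ∈ Set.Icc ((A:ℝ)+1) B, l ≤ F2 x) (hub : ∀ x ∈ Set.Icc ((A:ℝ)+1) B, |F1 x| ≤ V) :
    ‖∑ m ∈ Finset.Ioc A B, eC ((a:ℝ) * (m:ℝ)^d / q + F m)‖ ≤ 12 * (q * V + 1) * (1 / √l + 2 * q) := by
  have hq' : (1:ℝ) ≤ q := by exact_mod_cast hq
  have hq0 : (0:ℝ) < q := by linarith
  obtain ⟨N, hN, hsum⟩ := residue_split (fun m => eC ((a:ℝ) * (m:ℝ)^d / q + F m)) A B q hq
  rw [hsum]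
  have hsl : 0 < √l := Real.sqrt_pos.2 hl
  set l' := min (q^2 * l) (1/4) with hl'
  have hl'0 : 0 < l' := by rw [hl']; positivity
  have h6 : 6 / √l' ≤ 6 * (1 / (q * √l) + 2) := by
    rw [show 6 / √l' = 6 * (1 / √l') by ring]
    refine mul_le_mul_of_nonneg_left ?_ (by norm_num)
    rcases min_choice (q^2 * l) (1/4:ℝ) with h | h
    · rw [hl', h, Real.sqrt_mul (by positivity), Real.sqrt_sq hq0.le]; linarith
    · rw [hl', h, show (1/4:ℝ) = (1/2)^2 by norm_num, Real.sqrt_sq (by norm_num)]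
      have : 0 ≤ 1 / (q * √l) := by positivity
      norm_num at *; exact this
  have hcl : ∀ s ∈ Finset.range q, ‖∑ k ∈ Finset.range (N s), eC ((a:ℝ) * ((A + 1 + s + q * k : ℤ):ℝ)^d / q + F ((A + 1 + s + q * k : ℤ):ℝ))‖
      ≤ (2 * q * V + 2) * (6 * (1 / (q * √l) + 2)) := by
    intro s _
    have e : ∀ k ∈ Finset.range (N s), eC ((a:ℝ) * ((A + 1 + s + q * k : ℤ):ℝ)^d / q + F ((A + 1 + s + q * k : ℤ):ℝ)) =
        eC ((a:ℝ) * ((A + 1 + s : ℤ):ℝ)^d / q) * eC (F ((A:ℝ) + 1 + s + q * k)) := by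
      intro k _
      have hdvd : (q:ℤ) ∣ (A + 1 + s + q * k)^d - (A+1+s)^d := by
        refine dvd_trans ?_ (sub_dvd_pow_sub_pow _ _ d)
        exact ⟨k, by ring⟩
      obtain ⟨u, hu⟩ := hdvd
      have e2 : (a:ℝ) * ((A + 1 + s + q * k : ℤ):ℝ)^d / q = (a:ℝ) * ((A + 1 + s : ℤ):ℝ)^d / q + ((a * u : ℤ):ℝ) := by
        have : ((A + 1 + s + q * k : ℤ):ℝ)^d = ((A + 1 + s : ℤ):ℝ)^d + q * u := by
          have h7 : (A + 1 + s + q * k)^d = (A+1+s)^d + q * u := by linarith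
          exact_mod_cast h7
        rw [this]; push_cast; field_simp
      rw [e2, eC_add, eC_add, eC_int, mul_one]
      push_cast; rfl
    rw [Finset.sum_congr rfl e, ← Finset.mul_sum, norm_mul, eC_norm, one_mul]
    have hs0 : (0:ℝ) ≤ s := Nat.cast_nonneg _
    have hin : ∀ k, k < N s → (A:ℝ) + 1 + s + q * k ≤ B := fun k hk => by exact_mod_cast hN s k hk
    have hmem : ∀ (k j : ℕ), k + j < N s → ∀ t ∈ Set.Icc ((A:ℝ) + 1 + s + q * k) ((A:ℝ) + 1 + s + q * k + j * q), t ∈ Set.Icc ((A:ℝ)+1) B := by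
      intro k j hkj t ht
      have h1 := hin _ hkj
      push_cast at h1
      have : 0 ≤ (q:ℝ) * k := by positivity
      exact ⟨by linarith [ht.1], by linarith [ht.2]⟩
    have hx1 : ∀ k : ℕ, (A:ℝ) + 1 + s + q * ((k+1:ℕ):ℝ) = (A:ℝ) + 1 + s + q * k + q := fun k => by push_cast; ring
    have hx2 : ∀ k : ℕ, (A:ℝ) + 1 + s + q * ((k+2:ℕ):ℝ) = (A:ℝ) + 1 + s + q * k + 2 * q := fun k => by push_cast; ring
    have := second_test (fun k => F ((A:ℝ) + 1 + s + q * k)) (N s) l' (2 * q * V) (-(q * V)) hl'0 (min_le_right _ _) (by positivity) ?_ ?_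
    · refine this.trans ?_
      gcongr
    · intro k hk
      have hm := hmem k 2 hk
      norm_num only [Nat.cast_ofNat] at hm
      rw [hx2, hx1]
      exact (min_le_left _ _).trans (second_diff F F1 F2 _ q l hq0 (fun t ht => hF1 t (hm t ht)) (fun t ht => hF2 t (hm t ht)) (fun t ht => hlb t (hm t ht)))
    · intro k hk
      have hm := hmem k 1 hk
      rw [Nat.cast_one, one_mul] at hm
      rw [hx1]
      have := abs_le.1 (first_diff F F1 _ q V hq0 (fun t ht => hF1 t (hm t ht)) (fun t ht => hub t (hm t ht)))
      exact ⟨this.1, by linarith [this.2]⟩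
  refine (norm_sum_le _ _).trans ((Finset.sum_le_sum hcl).trans (le_of_eq ?_))
  rw [Finset.sum_const, Finset.card_range, nsmul_eq_mul]
  field_simp; ring

lemma arc_neg (q : ℕ) (hq : 1 ≤ q) (a : ℤ) (d : ℕ) (F F1 F2 : ℝ → ℝ) (A B : ℤ) (l V : ℝ) (hl : 0 < l) (hV : 0 ≤ V)
    (hF1 : ∀ x ∈ Set.Icc ((A:ℝ)+1) B, HasDerivAt F (F1 x) x) (hF2 : ∀ x ∈ Set.Icc ((A:ℝ)+1) B, HasDerivAt F1 (F2 x) x)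
    (hlb : ∀ x ∈ Set.Icc ((A:ℝ)+1) B, F2 x ≤ -l) (hub : ∀ x ∈ Set.Icc ((A:ℝ)+1) B, |F1 x| ≤ V) :
    ‖∑ m ∈ Finset.Ioc A B, eC ((a:ℝ) * (m:ℝ)^d / q + F m)‖ ≤ 12 * (q * V + 1) * (1 / √l + 2 * q) := by
  have := arc q hq (-a) d (fun x => - F x) (fun x => - F1 x) (fun x => - F2 x) A B l V hl hV (fun x hx => (hF1 x hx).neg)
    (fun x hx => (hF2 x hx).neg) (fun x hx => by linarith [hlb x hx]) (fun x hx => by rw [abs_neg]; exact hub x hx)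
  have e : ∑ m ∈ Finset.Ioc A B, eC (((-a:ℤ):ℝ) * (m:ℝ)^d / q + - F m) = (starRingEnd ℂ) (∑ m ∈ Finset.Ioc A B, eC ((a:ℝ) * (m:ℝ)^d / q + F m)) := by
    rw [map_sum]
    refine Finset.sum_congr rfl fun m _ => ?_
    rw [← eC_neg]; congr 1; push_cast; ring
  rw [e, RCLike.norm_conj] at this
  exact this

lemma cut (p : ℤ → Prop) (A : ℤ) (n : ℕ) (hp : ∀ i j, A < i → i ≤ j → j ≤ A + n → p j → p i) :
    ∃ A', A ≤ A' ∧ A' ≤ A + n ∧ ∀ m, A < m → m ≤ A + n → (p m ↔ m ≤ A') := by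
  induction n with
  | zero => exact ⟨A, le_refl _, by simp, fun m h1 h2 => by push_cast at h2; omega⟩
  | succ n ih =>
    by_cases h : p (A + n + 1)
    · refine ⟨A + n + 1, by omega, by push_cast; omega, fun m h1 h2 => ?_⟩
      push_cast at h2
      constructor
      · intro _; omega
      · intro h3; exact hp m (A+n+1) h1 h3 (by push_cast; omega) h
    · obtain ⟨A', h1, h2, h3⟩ := ih (fun i j hi hij hj => hp i j hi hij (by push_cast; omega))
      refine ⟨A', h1, by push_cast; omega, fun m hm1 hm2 => ?_⟩
      push_cast at hm2
      rcases lt_or_eq_of_le hm2 with h4 | h4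
      · exact h3 m hm1 (by omega)
      · rw [h4, ← add_assoc]
        constructor
        · intro h5; exact absurd h5 h
        · intro h5; omega

lemma arc_size (c K D : ℝ) (hc : 0 < c) (hK : 0 < K) (hD : 0 < D) : ∃ C : ℝ, 0 < C ∧ ∀ y q P : ℝ, 1 ≤ y → 0 < q →
    q ≤ D * y^(21/50:ℝ) → q^2 * P ≤ D^2 * y^(47/25:ℝ) → y^(49/50:ℝ) ≤ P →
    12 * (q * (K * P / y) + 1) * (1 / √(c * P * y^(-(41/20):ℝ)) + 2 * q) ≤ C * y^(49/50:ℝ) := by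
  have hsc : 0 < √c := Real.sqrt_pos.2 hc
  refine ⟨12 * (K / √c * D + 2 * K * D^2 + 1 / √c + 2 * D), by positivity, ?_⟩
  intro y q P hy hq hq1 hq2 hP
  have y0 : 0 < y := by linarith
  have hP0 : 0 < P := lt_of_lt_of_le (by positivity) hP
  set p := √P with hp
  have hp0 : 0 < p := Real.sqrt_pos.2 hP0
  have hpp : p^2 = P := Real.sq_sqrt hP0.le
  have hs : √(c * P * y^(-(41/20):ℝ)) = √c * p * y^(-(41/40):ℝ) := by
    rw [Real.sqrt_mul (by positivity), Real.sqrt_mul hc.le, show y^(-(41/20):ℝ) = (y^(-(41/40):ℝ))^2 by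
      rw [← Real.rpow_natCast, ← Real.rpow_mul y0.le]; norm_num, Real.sqrt_sq (by positivity)]
  have hinv : 1 / √(c * P * y^(-(41/20):ℝ)) = y^(41/40:ℝ) / (√c * p) := by
    rw [hs, Real.rpow_neg y0.le]; field_simp
  have h1 : q * p ≤ D * y^(47/50:ℝ) := by
    rw [← pow_le_pow_iff_left₀ (by positivity) (by positivity) (by norm_num : 2 ≠ 0), mul_pow, mul_pow, hpp, ← Real.rpow_natCast (y^(47/50:ℝ)), ← Real.rpow_mul y0.le]
    norm_num; exact hq2
  have h2 : y^(49/100:ℝ) ≤ p := by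
    rw [hp]; apply Real.le_sqrt_of_sq_le
    rw [← Real.rpow_natCast, ← Real.rpow_mul y0.le]; norm_num; exact hP
  rw [hinv, ← hpp]
  have mono : ∀ e : ℝ, e ≤ 49/50 → y^e ≤ y^(49/50:ℝ) := fun e he => Real.rpow_le_rpow_of_exponent_le hy he
  have t1 : q * (K * p^2 / y) * (y^(41/40:ℝ) / (√c * p)) ≤ K / √c * D * y^(49/50:ℝ) := by
    have e : q * (K * p^2 / y) * (y^(41/40:ℝ) / (√c * p)) = K / √c * (q * p) * y^(1/40:ℝ) := by
      have : y^(41/40:ℝ) = y^(1/40:ℝ) * y := by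
        nth_rewrite 3 [← Real.rpow_one y]; rw [← Real.rpow_add y0]; norm_num
      rw [this]; field_simp
    rw [e]
    calc K / √c * (q * p) * y^(1/40:ℝ) ≤ K / √c * (D * y^(47/50:ℝ)) * y^(1/40:ℝ) := by gcongr
      _ = K / √c * D * (y^(47/50:ℝ) * y^(1/40:ℝ)) := by ring
      _ ≤ K / √c * D * y^(49/50:ℝ) := by
        rw [← Real.rpow_add y0]; exact mul_le_mul_of_nonneg_left (mono _ (by norm_num)) (by positivity)
  have t2 : q * (K * p^2 / y) * (2 * q) ≤ 2 * K * D^2 * y^(49/50:ℝ) := by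
    have e : q * (K * p^2 / y) * (2 * q) = 2 * K * (q^2 * P) * y^(-1:ℝ) := by
      rw [Real.rpow_neg_one, hpp]; field_simp
    rw [e]
    calc 2 * K * (q^2 * P) * y^(-1:ℝ) ≤ 2 * K * (D^2 * y^(47/25:ℝ)) * y^(-1:ℝ) := by gcongr
      _ = 2 * K * D^2 * (y^(47/25:ℝ) * y^(-1:ℝ)) := by ring
      _ ≤ _ := by
        rw [← Real.rpow_add y0]; exact mul_le_mul_of_nonneg_left (mono _ (by norm_num)) (by positivity)
  have t3 : y^(41/40:ℝ) / (√c * p) ≤ 1 / √c * y^(49/50:ℝ) := by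
    rw [div_le_iff₀ (by positivity)]
    calc y^(41/40:ℝ) ≤ y^(49/50:ℝ) * y^(49/100:ℝ) := by
          rw [← Real.rpow_add y0]; exact Real.rpow_le_rpow_of_exponent_le hy (by norm_num)
      _ ≤ y^(49/50:ℝ) * p := by gcongr
      _ = _ := by field_simp
  have t4 : 2 * q ≤ 2 * D * y^(49/50:ℝ) := by
    have := mul_le_mul_of_nonneg_left (mono (21/50) (by norm_num)) hD.le
    linarith
  linarith

def uf (d : ℕ) (γ σ x : ℝ) : ℝ := x^(d-2) * (x+σ)^(2-γ)

lemma uf_facts (d : ℕ) (hd : 4 ≤ d) (γ σ y : ℝ) (hγ0 : 0 < γ) (hγ1 : γ < 1) (hσ0 : 0 ≤ σ) (hσ1 : σ ≤ 1) (hy : 1 ≤ y) :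
    (∀ x, y ≤ x → x ≤ 2*y → y^((d:ℝ)-γ) ≤ uf d γ σ x ∧ uf d γ σ x ≤ 2^(d-2) * 9 * y^((d:ℝ)-γ)) ∧
    (∀ x x', y ≤ x → x ≤ x' → (x' - x) * y^((d:ℝ)-1-γ) ≤ uf d γ σ x' - uf d γ σ x) := by
  have y0 : 0 < y := by linarith
  have hc : ∀ k : ℕ, k ≤ d → y^(d-k) * y^(2-γ) = y^((d:ℝ)-k+2-γ) := by
    intro k hk
    rw [← Real.rpow_natCast, ← Real.rpow_add y0, Nat.cast_sub hk]; congr 1; ring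
  have e2 : y^(d-2) * y^(2-γ) = y^((d:ℝ)-γ) := by rw [hc 2 (by omega)]; congr 1; push_cast; ring
  have e3 : y^(d-3) * y^(2-γ) = y^((d:ℝ)-1-γ) := by rw [hc 3 (by omega)]; congr 1; push_cast; ring
  refine ⟨fun x h1 h2 => ⟨?_, ?_⟩, fun x x' h1 h2 => ?_⟩
  · rw [← e2, uf]
    refine mul_le_mul (pow_le_pow_left₀ y0.le h1 _) (Real.rpow_le_rpow y0.le (by linarith) (by linarith)) (by positivity) (pow_nonneg (by linarith) _)
  · rw [← e2, uf]
    have : (x+σ)^(2-γ) ≤ 9 * y^(2-γ) := by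
      calc (x+σ)^(2-γ) ≤ (3*y)^(2-γ) := Real.rpow_le_rpow (by linarith) (by linarith) (by linarith)
        _ = 3^(2-γ) * y^(2-γ) := Real.mul_rpow (by norm_num) y0.le
        _ ≤ 9 * y^(2-γ) := by
          gcongr
          calc (3:ℝ)^(2-γ) ≤ 3^(2:ℝ) := Real.rpow_le_rpow_of_exponent_le (by norm_num) (by linarith)
            _ = 9 := by norm_num
    calc x^(d-2) * (x+σ)^(2-γ) ≤ (2*y)^(d-2) * (9 * y^(2-γ)) :=
          mul_le_mul (pow_le_pow_left₀ (by linarith) h2 _) this (Real.rpow_nonneg (by linarith) _) (by positivity)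
      _ = _ := by rw [mul_pow]; ring
  · rw [← e3, uf, uf]
    have a1 : (x+σ)^(2-γ) ≤ (x'+σ)^(2-γ) := Real.rpow_le_rpow (by linarith) (by linarith) (by linarith)
    have a2 : y^(2-γ) ≤ (x+σ)^(2-γ) := Real.rpow_le_rpow (by linarith) (by linarith) (by linarith)
    have x0 : 0 < x := by linarith
    have a3 : (x' - x) * y^(d-3) ≤ x'^(d-2) - x^(d-2) := by
      have b1 : x^(d-3) ≤ x'^(d-3) := pow_le_pow_left₀ x0.le h2 _
      have b2 : y^(d-3) ≤ x'^(d-3) := pow_le_pow_left₀ y0.le (by linarith) _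
      have e : d - 2 = (d - 3) + 1 := by omega
      rw [e, pow_succ, pow_succ]
      nlinarith
    have a4 : 0 ≤ (x' - x) * y^(d-3) := mul_nonneg (by linarith) (by positivity)
    calc (x' - x) * (y^(d-3) * y^(2-γ)) = ((x' - x) * y^(d-3)) * y^(2-γ) := by ring
      _ ≤ (x'^(d-2) - x^(d-2)) * (x+σ)^(2-γ) := mul_le_mul a3 a2 (by positivity) (a4.trans a3)
      _ ≤ x'^(d-2) * (x'+σ)^(2-γ) - x^(d-2) * (x+σ)^(2-γ) := by
        have : x'^(d-2) * (x+σ)^(2-γ) ≤ x'^(d-2) * (x'+σ)^(2-γ) := mul_le_mul_of_nonneg_left a1 (pow_nonneg (by linarith) _)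
        linarith

def gf (d : ℕ) (γ σ h β x : ℝ) : ℝ := (d-1) * β * uf d γ σ x - h * (γ * (1-γ))
def Ff (d : ℕ) (γ σ h β x : ℝ) : ℝ := β/d * x^d + h * (x+σ)^γ
def Ff1 (d : ℕ) (γ σ h β x : ℝ) : ℝ := β * x^(d-1) + h * (γ * (x+σ)^(γ-1))
def Ff2 (d : ℕ) (γ σ h β x : ℝ) : ℝ := gf d γ σ h β x * (x+σ)^(γ-2)

lemma Ff_deriv (d : ℕ) (hd : 4 ≤ d) (γ σ h β x : ℝ) (hx : 0 < x) (hσ : 0 ≤ σ) : HasDerivAt (Ff d γ σ h β) (Ff1 d γ σ h β x) x := by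
  have hd0 : (d:ℝ) ≠ 0 := by exact_mod_cast (by omega : d ≠ 0)
  have h1 : HasDerivAt (fun x : ℝ => x + σ) 1 x := (hasDerivAt_id x).add_const σ
  have h2 := (h1.rpow_const (p := γ) (Or.inl (by linarith : 0 < x + σ).ne')).const_mul h
  have h3 := (hasDerivAt_pow d x).const_mul (β/d)
  have h4 : HasDerivAt (Ff d γ σ h β) _ x := h3.add h2
  refine h4.congr_deriv ?_
  unfold Ff1; field_simp

lemma Ff1_deriv (d : ℕ) (hd : 4 ≤ d) (γ σ h β x : ℝ) (hx : 0 < x) (hσ : 0 ≤ σ) : HasDerivAt (Ff1 d γ σ h β) (Ff2 d γ σ h β x) x := by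
  have h1 : HasDerivAt (fun x : ℝ => x + σ) 1 x := (hasDerivAt_id x).add_const σ
  have hz : 0 < x + σ := by linarith
  have h2 := ((h1.rpow_const (p := γ-1) (Or.inl hz.ne')).const_mul γ).const_mul h
  have h3 := (hasDerivAt_pow (d-1) x).const_mul β
  have h4 : HasDerivAt (Ff1 d γ σ h β) _ x := h3.add h2
  refine h4.congr_deriv ?_
  unfold Ff2 gf uf
  rw [Nat.cast_sub (by omega : 1 ≤ d), show d - 1 - 1 = d - 2 by omega, show γ - 1 - 1 = γ - 2 by ring]
  have e : (x+σ)^(2-γ) * (x+σ)^(γ-2) = 1 := by rw [← Real.rpow_add hz]; norm_num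
  push_cast
  linear_combination -((d:ℝ) - 1) * β * x^(d-2) * e

lemma Ff1_bound (d : ℕ) (hd : 4 ≤ d) (γ σ h β x y : ℝ) (hy : 1 ≤ y) (hx : y ≤ x) (hx2 : x ≤ 2*y) (hσ : 0 ≤ σ) (hγ0 : 0 < γ) (hγ1 : γ < 1) (hh : 0 ≤ h) :
    |Ff1 d γ σ h β x| ≤ 2^d * (|β| * y^d + h * y^γ) / y := by
  have y0 : 0 < y := by linarith
  have x0 : 0 < x := by linarith
  rw [le_div_iff₀ y0]
  have a1 : |β * x^(d-1)| ≤ |β| * (2^d * y^(d-1)) := by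
    rw [abs_mul, abs_of_nonneg (by positivity : 0 ≤ x^(d-1))]
    gcongr
    calc x^(d-1) ≤ (2*y)^(d-1) := by gcongr
      _ = 2^(d-1) * y^(d-1) := mul_pow _ _ _
      _ ≤ 2^d * y^(d-1) := by gcongr <;> [norm_num; omega]
  have a2 : |h * (γ * (x+σ)^(γ-1))| ≤ h * y^(γ-1) := by
    rw [abs_of_nonneg (by positivity)]
    gcongr
    calc γ * (x+σ)^(γ-1) ≤ 1 * y^(γ-1) := by
          gcongr ?_ * ?_
          exact Real.rpow_le_rpow_of_nonpos y0 (by linarith) (by linarith)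
      _ = _ := one_mul _
  have e1 : y^(d-1) * y = y^d := by rw [← pow_succ, show d - 1 + 1 = d by omega]
  have e2 : y^(γ-1) * y = y^γ := by rw [← Real.rpow_add_one y0.ne']; congr 1; ring
  have h2d : (1:ℝ) ≤ 2^d := one_le_pow₀ (by norm_num)
  have hT : 0 ≤ h * y^γ := by positivity
  calc |Ff1 d γ σ h β x| * y ≤ (|β| * (2^d * y^(d-1)) + h * y^(γ-1)) * y := by
        gcongr; exact (abs_add_le _ _).trans (add_le_add a1 a2)
    _ = 2^d * (|β| * (y^(d-1) * y)) + h * (y^(γ-1) * y) := by ring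
    _ ≤ _ := by rw [e1, e2]; nlinarith

lemma major_split (y : ℝ) (hy : 1 ≤ y) (F : ℤ → ℝ) (g : ℝ → ℝ) (s μ C : ℝ) (hs : 0 < s) (hμ0 : 0 < μ)
    (hmono : ∀ x x', y ≤ x → x ≤ x' → (x' - x) * s ≤ g x' - g x) (hμ2 : μ ≤ s * (y * y^(-(1/20):ℝ)))
    (hbd : ∀ A B : ℤ, ⌊y⌋ ≤ A → B ≤ ⌊2*y⌋ → ((∀ x ∈ Set.Icc ((A:ℝ)+1) B, g x ≤ -μ) ∨ (∀ x ∈ Set.Icc ((A:ℝ)+1) B, μ ≤ g x)) →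
     ‖∑ m ∈ Finset.Ioc A B, eC (F m)‖ ≤ C * y^(49/50:ℝ)) :
    ‖∑ m ∈ Finset.Ioc ⌊y⌋ ⌊2*y⌋, eC (F m)‖ ≤ (2 * C + 3) * y^(49/50:ℝ) := by
  have y0 : 0 < y := by linarith
  set e20 := y^(-(1/20):ℝ) with he20
  have he0 : 0 < e20 := by positivity
  have hAB : ⌊y⌋ ≤ ⌊2*y⌋ := Int.floor_le_floor (by linarith)
  have hmono' : ∀ x x', y ≤ x → x ≤ x' → g x ≤ g x' := by
    intro x x' h1 h2
    have := hmono x x' h1 h2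
    have h4 : 0 ≤ (x' - x) * s := mul_nonneg (by linarith) hs.le
    linarith
  set A := ⌊y⌋ with hA
  set B := ⌊2*y⌋ with hB
  obtain ⟨n, hn⟩ := Int.le.dest hAB
  have hyi : ∀ i : ℤ, A < i → y ≤ (i:ℝ) := by
    intro i hi
    have h1 := Int.lt_floor_add_one y
    have h2 : ((A + 1 : ℤ):ℝ) ≤ i := by exact_mod_cast hi
    push_cast at h2; linarith
  obtain ⟨A', ha1, ha2, ha3⟩ := cut (fun m => g m ≤ -μ) A n (fun i j hi hij hj hpj =>
    (hmono' i j (hyi i hi) (by exact_mod_cast hij)).trans hpj)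
  obtain ⟨B', hb1, hb2, hb3⟩ := cut (fun m => g m < μ) A n (fun i j hi hij hj hpj =>
    (hmono' i j (hyi i hi) (by exact_mod_cast hij)).trans_lt hpj)
  rw [hn] at ha2 ha3 hb2 hb3
  have hA'B' : A' ≤ B' := by
    rcases eq_or_lt_of_le ha1 with h1 | h1
    · omega
    · have := (ha3 A' h1 ha2).2 le_rfl
      exact (hb3 A' h1 ha2).1 (by linarith)
  have hsp : Finset.Ioc A B = Finset.Ioc A A' ∪ (Finset.Ioc A' B' ∪ Finset.Ioc B' B) := by
    rw [Finset.Ioc_union_Ioc_eq_Ioc hA'B' hb2, Finset.Ioc_union_Ioc_eq_Ioc ha1 ha2]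
  have s1 := hbd A A' le_rfl ha2 (Or.inl fun x hx => by
    have h0 : A < A' := by
      have : (A:ℝ) < A' := by linarith [hx.1, hx.2]
      exact_mod_cast this
    have hx1 : y ≤ x := by
      have := hyi (A+1) (by omega); push_cast at this; linarith [hx.1]
    exact (hmono' x A' hx1 hx.2).trans ((ha3 A' h0 ha2).2 le_rfl))
  have s3 := hbd B' B hb1 le_rfl (Or.inr fun x hx => by
    have h0 : B' < B := by
      have : (B':ℝ) < B := by linarith [hx.1, hx.2]
      exact_mod_cast this
    have h1 := mt (hb3 (B'+1) (by omega) (by omega)).1 (by omega)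
    rw [not_lt] at h1
    refine h1.trans (hmono' _ x (hyi (B'+1) (by omega)) ?_)
    push_cast; exact hx.1)
  have s2 : ‖∑ m ∈ Finset.Ioc A' B', eC (F m)‖ ≤ 3 * y^(49/50:ℝ) := by
    refine (norm_sum_le _ _).trans ?_
    simp only [eC_norm, Finset.sum_const, nsmul_eq_mul, mul_one, Int.card_Ioc]
    have hone : 1 ≤ y^(49/50:ℝ) := Real.one_le_rpow hy (by norm_num)
    rcases eq_or_lt_of_le hA'B' with h0 | h0
    · rw [h0]; simp; linarith
    have hA1 : -μ < g ((A'+1:ℤ):ℝ) := by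
      have h1 := mt (ha3 (A'+1) (by omega) (by omega)).1 (by omega)
      exact not_le.1 h1
    have hB1 : g (B':ℝ) < μ := (hb3 B' (by omega) hb2).2 le_rfl
    have hm := hmono ((A'+1:ℤ):ℝ) B' (hyi _ (by omega)) (by exact_mod_cast h0)
    have hw : (B':ℝ) - ((A'+1:ℤ):ℝ) ≤ 2 * (y * e20) := by
      have h5 : ((B':ℝ) - ((A'+1:ℤ):ℝ)) * s ≤ (2 * (y * e20)) * s := by linarith
      exact le_of_mul_le_mul_right h5 hs
    have he : y * e20 ≤ y^(49/50:ℝ) := by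
      rw [he20]; nth_rewrite 1 [← Real.rpow_one y]; rw [← Real.rpow_add y0]
      exact Real.rpow_le_rpow_of_exponent_le hy (by norm_num)
    have h2 : (((B' - A').toNat : ℤ):ℝ) = ((B' - A' : ℤ):ℝ) := by rw [Int.toNat_of_nonneg (by omega)]
    rw [Int.cast_natCast] at h2
    rw [h2]; push_cast at hw ⊢
    linarith
  rw [hsp, Finset.sum_union, Finset.sum_union]
  · refine (norm_add_le _ _).trans ((add_le_add s1 ((norm_add_le _ _).trans (add_le_add s2 s3))).trans (le_of_eq ?_))
    ring
  · exact Finset.disjoint_left.2 fun m h1 h2 => by rw [Finset.mem_Ioc] at h1 h2; omega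
  · exact Finset.disjoint_left.2 fun m h1 h2 => by rw [Finset.mem_union, Finset.mem_Ioc, Finset.mem_Ioc] at h2; rw [Finset.mem_Ioc] at h1; omega

lemma major_small (β K0 κ cs h Y u D : ℝ) (hD : 3 ≤ D) (h0 : 0 ≤ h) (hY0 : 0 ≤ Y) (hκ0 : 0 < κ) (hκ1 : κ ≤ 1) (hK01 : 2 ≤ K0) (hcs0 : 0 < cs) (hcs4 : cs ≤ κ/4)
    (u1 : Y ≤ u) (u2 : D * u ≤ K0 * Y) (hsmall : β ≤ 0 ∨ K0 * (|β| * Y) ≤ κ * h / 2) :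
    D * β * u - h * κ ≤ -(cs * (|β| * Y + h)) := by
  rcases le_or_gt β 0 with hb | hb
  · rw [abs_of_nonpos hb]
    have p1 : 0 ≤ -β * Y := mul_nonneg (by linarith) hY0
    have h5 : -β * Y ≤ -β * u := mul_le_mul_of_nonneg_left u1 (by linarith)
    have h6 : 1 * (-β * u) ≤ D * (-β * u) := mul_le_mul_of_nonneg_right (by linarith) (p1.trans h5)
    have h2 : cs * (-β * Y + h) ≤ κ * (-β * Y + h) := mul_le_mul_of_nonneg_right (by linarith) (by linarith)
    have h3 : κ * (-β * Y) ≤ 1 * (-β * Y) := mul_le_mul_of_nonneg_right hκ1 p1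
    linarith
  · have hsm := hsmall.resolve_left (by linarith)
    rw [abs_of_pos hb] at hsm ⊢
    have p1 : 0 ≤ β * Y := mul_nonneg hb.le hY0
    have h1 : β * (D * u) ≤ β * (K0 * Y) := mul_le_mul_of_nonneg_left u2 hb.le
    have h2 : 1 * (β * Y) ≤ K0 * (β * Y) := mul_le_mul_of_nonneg_right (by linarith) p1
    have h4 : κ * h ≤ 1 * h := mul_le_mul_of_nonneg_right hκ1 h0
    have h3 : cs * (β * Y + h) ≤ κ/4 * (β * Y + h) := mul_le_mul_of_nonneg_right hcs4 (by linarith)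
    have h5 : κ/4 * (β * Y + h) ≤ κ/4 * (2 * h) := mul_le_mul_of_nonneg_left (by linarith) (by linarith)
    linarith

set_option maxHeartbeats 1000000 in
theorem major (d : ℕ) (hd : 4 ≤ d) (γ : ℝ) (hγ0 : 49/50 ≤ γ) (hγ1 : γ < 1) (C1 : ℝ) (hC1 : 1 ≤ C1) : ∃ C : ℝ, 0 < C ∧ ∀ y : ℝ, 1 ≤ y →
    ∀ h : ℝ, 1 ≤ h → h ≤ y^(2 * GG d) → ∀ σ : ℝ, 0 ≤ σ → σ ≤ 1 → ∀ (q : ℕ) (a : ℤ) (β : ℝ), 1 ≤ q → (q:ℝ) ≤ y^(21/50:ℝ) →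
      |β| * q ≤ C1 * y^(21/50 - ((d:ℝ) - 1) + 2 * GG d) →
    ‖∑ m ∈ Finset.Ioc ⌊y⌋ ⌊2*y⌋, eC ((a:ℝ) * (m:ℝ)^d / ((d * q : ℕ):ℝ) + Ff d γ σ h β m)‖ ≤ C * y^(49/50:ℝ) := by
  have hd4 : (4:ℝ) ≤ d := by exact_mod_cast hd
  set κ := γ * (1 - γ) with hκ
  have hκ0 : 0 < κ := mul_pos (by linarith) (by linarith)
  have hκ1 : κ ≤ 1 := by nlinarith
  set K0 : ℝ := (d-1) * (2^(d-2) * 9) with hK0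
  have hK01 : 2 ≤ K0 := by
    have h1 : (1:ℝ) ≤ 2^(d-2) := one_le_pow₀ (by norm_num)
    have h2 : (3:ℝ) * 9 ≤ (d-1) * (2^(d-2) * 9) := mul_le_mul (by linarith) (by linarith) (by norm_num) (by linarith)
    linarith
  set cs := κ / (κ + 2 * K0) with hcs
  have hcs0 : 0 < cs := by positivity
  have hcs4 : cs ≤ κ / 4 := by
    rw [hcs]
    gcongr; linarith
  obtain ⟨C, hC, hsize⟩ := arc_size (cs/9) (2^d) (d * (C1 + 1)) (by positivity) (by positivity) (by positivity)
  refine ⟨2 * C + 3, by linarith, ?_⟩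
  intro y hy h hh1 hh σ hσ0 hσ1 q a β hq1 hqy hβ
  have y0 : 0 < y := by linarith
  have hG := GG_le d hd
  obtain ⟨hu1, hu2⟩ := uf_facts d hd γ σ y (by linarith) hγ1 hσ0 hσ1 hy
  set P := |β| * y^d + h * y^γ with hP
  have hT0 : 0 < h * y^γ := by positivity
  have hP0 : 0 ≤ |β| * y^d := by positivity
  have hq' : (1:ℝ) ≤ q := by exact_mod_cast hq1
  have hPy : y^(49/50:ℝ) ≤ P := by
    have : y^(49/50:ℝ) ≤ y^γ := Real.rpow_le_rpow_of_exponent_le hy hγ0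
    have h3 : y^γ ≤ h * y^γ := le_mul_of_one_le_left (by positivity) hh1
    linarith
  have hPpos : 0 < P := by linarith
  have hqP : ((d * q : ℕ):ℝ)^2 * P ≤ (d * (C1 + 1))^2 * y^(47/25:ℝ) := by
    have b1 : (q:ℝ)^2 * (|β| * y^d) ≤ C1 * y^(47/25:ℝ) := by
      calc (q:ℝ)^2 * (|β| * y^d) = q * (|β| * q) * y^(d:ℝ) := by rw [Real.rpow_natCast]; ring
        _ ≤ y^(21/50:ℝ) * (C1 * y^(21/50 - ((d:ℝ) - 1) + 2 * GG d)) * y^(d:ℝ) := by gcongr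
        _ = C1 * (y^(21/50:ℝ) * y^(21/50 - ((d:ℝ) - 1) + 2 * GG d) * y^(d:ℝ)) := by ring
        _ ≤ _ := by
          rw [← Real.rpow_add y0, ← Real.rpow_add y0]
          refine mul_le_mul_of_nonneg_left (Real.rpow_le_rpow_of_exponent_le hy (by linarith)) (by linarith)
    have b2 : (q:ℝ)^2 * (h * y^γ) ≤ y^(47/25:ℝ) := by
      calc (q:ℝ)^2 * (h * y^γ) ≤ (y^(21/50:ℝ))^2 * (y^(2 * GG d) * y^γ) := by gcongr
        _ ≤ _ := by
          rw [← Real.rpow_natCast, ← Real.rpow_mul y0.le, ← Real.rpow_add y0, ← Real.rpow_add y0]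
          exact Real.rpow_le_rpow_of_exponent_le hy (by push_cast; linarith)
    have b3 : 0 ≤ y^(47/25:ℝ) := by positivity
    push_cast
    calc ((d:ℝ) * q)^2 * P = d^2 * (q^2 * (|β| * y^d) + q^2 * (h * y^γ)) := by rw [hP]; ring
      _ ≤ d^2 * ((C1 + 1) * y^(47/25:ℝ)) := by gcongr; linarith
      _ ≤ d^2 * ((C1 + 1)^2 * y^(47/25:ℝ)) := by gcongr; nlinarith
      _ = _ := by ring
  have hq1d : ((d * q : ℕ):ℝ) ≤ d * (C1 + 1) * y^(21/50:ℝ) := by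
    push_cast
    have : (q:ℝ) ≤ (C1 + 1) * y^(21/50:ℝ) := by nlinarith
    calc (d:ℝ) * q ≤ d * ((C1 + 1) * y^(21/50:ℝ)) := by gcongr
      _ = _ := by ring
  have hdq : 1 ≤ d * q := Nat.mul_pos (by omega) hq1
  have hsz := hsize y ((d * q : ℕ):ℝ) P hy (by exact_mod_cast hdq) hq1d hqP hPy
  set V := 2^d * P / y with hV
  set l := cs/9 * P * y^(-(41/20):ℝ) with hl
  have hl0 : 0 < l := by positivity
  set μ := cs * P * y^(-γ) * y^(-(1/20):ℝ) with hμ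
  have hμ0 : 0 < μ := by positivity
  have hgF : ∀ x, y ≤ x → x ≤ 2 * y → l ≤ μ * (x+σ)^(γ-2) := by
    intro x h1 h2
    have : y^(γ-2) / 9 ≤ (x+σ)^(γ-2) := by
      calc y^(γ-2) / 9 ≤ 3^(γ-2) * y^(γ-2) := by
            have : (1:ℝ)/9 ≤ 3^(γ-2) := by
              calc (1:ℝ)/9 = 3^(-2:ℝ) := by rw [Real.rpow_neg (by norm_num)]; norm_num
                _ ≤ _ := Real.rpow_le_rpow_of_exponent_le (by norm_num) (by linarith)
            have h5 : 0 < y^(γ-2) := by positivity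
            nlinarith
        _ = (3*y)^(γ-2) := (Real.mul_rpow (by norm_num) y0.le).symm
        _ ≤ _ := Real.rpow_le_rpow_of_nonpos (by linarith) (by linarith) (by linarith)
    have e : l = μ * (y^(γ-2) / 9) := by
      have : y^(-(41/20):ℝ) = y^(-γ) * y^(-(1/20):ℝ) * y^(γ-2) := by
        rw [← Real.rpow_add y0, ← Real.rpow_add y0]; congr 1; ring
      rw [hl, hμ, this]; ring
    rw [e]; gcongr
  have hbd : ∀ A B : ℤ, ⌊y⌋ ≤ A → B ≤ ⌊2*y⌋ → ((∀ x ∈ Set.Icc ((A:ℝ)+1) B, gf d γ σ h β x ≤ -μ) ∨ (∀ x ∈ Set.Icc ((A:ℝ)+1) B, μ ≤ gf d γ σ h β x)) →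
     ‖∑ m ∈ Finset.Ioc A B, eC ((a:ℝ) * (m:ℝ)^d / ((d * q : ℕ):ℝ) + Ff d γ σ h β m)‖ ≤ C * y^(49/50:ℝ) := by
    intro A B hA hB hg
    have hin : ∀ x ∈ Set.Icc ((A:ℝ)+1) B, y ≤ x ∧ x ≤ 2 * y := by
      intro x hx
      have h1 := Int.lt_floor_add_one y
      have h2 : ((⌊y⌋:ℤ):ℝ) ≤ A := by exact_mod_cast hA
      have h3 : (B:ℝ) ≤ ((⌊2*y⌋:ℤ):ℝ) := by exact_mod_cast hB
      have h4 := Int.floor_le (2*y)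
      exact ⟨by linarith [hx.1], by linarith [hx.2]⟩
    refine le_trans ?_ hsz
    have d1 : ∀ x ∈ Set.Icc ((A:ℝ)+1) B, HasDerivAt (Ff d γ σ h β) (Ff1 d γ σ h β x) x := fun x hx =>
      Ff_deriv d hd γ σ h β x (by linarith [(hin x hx).1]) hσ0
    have d2 : ∀ x ∈ Set.Icc ((A:ℝ)+1) B, HasDerivAt (Ff1 d γ σ h β) (Ff2 d γ σ h β x) x := fun x hx =>
      Ff1_deriv d hd γ σ h β x (by linarith [(hin x hx).1]) hσ0
    have d3 : ∀ x ∈ Set.Icc ((A:ℝ)+1) B, |Ff1 d γ σ h β x| ≤ V := fun x hx =>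
      Ff1_bound d hd γ σ h β x y hy (hin x hx).1 (hin x hx).2 hσ0 (by linarith) hγ1 (by linarith)
    rcases hg with hg | hg
    · refine arc_neg (d*q) hdq a d _ _ _ A B l V hl0 (by positivity) d1 d2 (fun x hx => ?_) d3
      have h1 := hgF x (hin x hx).1 (hin x hx).2
      have h2 : 0 ≤ (x+σ)^(γ-2) := Real.rpow_nonneg (by linarith [(hin x hx).1]) _
      have h3 := mul_le_mul_of_nonneg_right (hg x hx) h2
      unfold Ff2; linarith
    · refine arc (d*q) hdq a d _ _ _ A B l V hl0 (by positivity) d1 d2 (fun x hx => ?_) d3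
      have h1 := hgF x (hin x hx).1 (hin x hx).2
      have h2 : 0 ≤ (x+σ)^(γ-2) := Real.rpow_nonneg (by linarith [(hin x hx).1]) _
      have h3 := mul_le_mul_of_nonneg_right (hg x hx) h2
      unfold Ff2; linarith
  have hy50 : 0 ≤ y^(49/50:ℝ) := by positivity
  have hγγ : y^γ * y^(-γ) = 1 := by rw [← Real.rpow_add y0]; simp
  have hdγ : y^d * y^(-γ) = y^((d:ℝ)-γ) := by rw [← Real.rpow_natCast, ← Real.rpow_add y0]; rfl
  have hPγ : P * y^(-γ) = |β| * y^((d:ℝ)-γ) + h := by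
    rw [hP, ← hdγ]; linear_combination h * hγγ
  have hμle : μ ≤ cs * (|β| * y^((d:ℝ)-γ) + h) := by
    rw [hμ, ← hPγ]
    have : y^(-(1/20):ℝ) ≤ 1 := Real.rpow_le_one_of_one_le_of_nonpos hy (by norm_num)
    have h2 : 0 ≤ cs * P * y^(-γ) := by positivity
    nlinarith
  have hAB : ⌊y⌋ ≤ ⌊2*y⌋ := Int.floor_le_floor (by linarith)
  have hin : ∀ x ∈ Set.Icc (((⌊y⌋:ℤ):ℝ)+1) ((⌊2*y⌋:ℤ):ℝ), y ≤ x ∧ x ≤ 2 * y := by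
    intro x hx
    have h1 := Int.lt_floor_add_one y
    have h4 := Int.floor_le (2*y)
    exact ⟨by linarith [hx.1], by linarith [hx.2]⟩
  set Y := y^((d:ℝ)-γ) with hY
  have hY0 : 0 < Y := by positivity
  by_cases hsmall : β ≤ 0 ∨ K0 * (|β| * Y) ≤ κ * h / 2
  · refine (hbd ⌊y⌋ ⌊2*y⌋ le_rfl le_rfl (Or.inl fun x hx => ?_)).trans (mul_le_mul_of_nonneg_right (by linarith) hy50)
    have hx' := hin x hx
    obtain ⟨u1, u2⟩ := hu1 x hx'.1 hx'.2
    refine le_trans ?_ (neg_le_neg hμle)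
    refine major_small β K0 κ cs h Y _ ((d:ℝ)-1) (by linarith) (by linarith) hY0.le hκ0 hκ1 hK01 hcs0 hcs4 u1 ?_ hsmall
    exact (mul_le_mul_of_nonneg_left u2 (by linarith)).trans (le_of_eq (by rw [hK0]; ring))
  · push Not at hsmall
    obtain ⟨hb, hbig⟩ := hsmall
    rw [abs_of_pos hb] at hbig hPγ
    have hs : 0 < β * y^((d:ℝ)-1-γ) := by positivity
    refine major_split y hy _ (gf d γ σ h β) (β * y^((d:ℝ)-1-γ)) μ C hs hμ0 ?_ ?_ hbd
    · intro x x' h1 h2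
      have h3 := hu2 x x' h1 h2
      have h4 : 0 ≤ (x' - x) * y^((d:ℝ)-1-γ) := mul_nonneg (by linarith) (by positivity)
      have h5 : β * ((x' - x) * y^((d:ℝ)-1-γ)) ≤ β * (uf d γ σ x' - uf d γ σ x) := mul_le_mul_of_nonneg_left h3 hb.le
      have h6 : 0 ≤ β * (uf d γ σ x' - uf d γ σ x) := mul_nonneg hb.le (h4.trans h3)
      have h7 : 1 * (β * (uf d γ σ x' - uf d γ σ x)) ≤ ((d:ℝ)-1) * (β * (uf d γ σ x' - uf d γ σ x)) := mul_le_mul_of_nonneg_right (by linarith) h6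
      unfold gf
      linarith
    · have e1 : cs * (β * Y + h) ≤ β * Y := by
        rw [hcs, div_mul_eq_mul_div, div_le_iff₀ (by positivity)]
        linarith
      have eY : Y = y^((d:ℝ)-1-γ) * y := by
        rw [hY, ← Real.rpow_add_one y0.ne']; congr 1; ring
      calc μ = cs * (P * y^(-γ)) * y^(-(1/20):ℝ) := by rw [hμ]; ring
        _ = cs * (β * Y + h) * y^(-(1/20):ℝ) := by rw [hPγ]
        _ ≤ β * Y * y^(-(1/20):ℝ) := mul_le_mul_of_nonneg_right e1 (by positivity)
        _ = _ := by rw [eY]; ring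

theorem key (d : ℕ) (hd : 4 ≤ d) (γ : ℝ) (hγ0 : 49/50 ≤ γ) (hγ1 : γ < 1) : ∃ C : ℝ, 0 < C ∧ ∀ y : ℝ, 1 ≤ y →
    ∀ h : ℝ, 1 ≤ h → h ≤ y^(2 * GG d) → ∀ σ : ℝ, 0 ≤ σ → σ ≤ 1 → ∀ θ : ℝ,
    ‖∑ m ∈ Finset.Ioc ⌊y⌋ ⌊2*y⌋, eC (θ * (m:ℝ)^d + h * ((m:ℝ)+σ)^γ)‖ ≤ C * y^(1 - GG d) := by
  obtain ⟨C1, y1, hC1, hy1, hmin⟩ := minor d hd γ (by linarith) hγ1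
  obtain ⟨C2, hC2, hmaj⟩ := major d hd γ hγ0 hγ1 C1 hC1
  refine ⟨C1 + C2 + (2 * y1 + 1), by linarith, ?_⟩
  intro y hy h hh1 hh σ hσ0 hσ1 θ
  have hG := GG_le d hd
  have hone : 1 ≤ y^(1 - GG d) := Real.one_le_rpow hy (by linarith)
  have p1 : 0 ≤ C1 * y^(1 - GG d) := by positivity
  have p2 : 0 ≤ C2 * y^(1 - GG d) := by positivity
  have p3 : 0 ≤ (2 * y1 + 1) * y^(1 - GG d) := by positivity
  rcases lt_or_ge y y1 with hlt | hge
  · have : ‖∑ m ∈ Finset.Ioc ⌊y⌋ ⌊2*y⌋, eC (θ * (m:ℝ)^d + h * ((m:ℝ)+σ)^γ)‖ ≤ 2 * y1 + 1 := by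
      refine (norm_sum_le _ _).trans ?_
      simp only [eC_norm, Finset.sum_const, nsmul_eq_mul, mul_one, Int.card_Ioc]
      have h1 : ⌊y⌋ ≤ ⌊2*y⌋ := Int.floor_le_floor (by linarith)
      have h2 : (((⌊2*y⌋ - ⌊y⌋).toNat : ℤ):ℝ) = ((⌊2*y⌋ - ⌊y⌋ : ℤ):ℝ) := by rw [Int.toNat_of_nonneg (by omega)]
      rw [Int.cast_natCast] at h2
      rw [h2]; push_cast
      have h3 := Int.floor_le (2*y)
      have h4 := Int.lt_floor_add_one y
      linarith
    have h5 : (2 * y1 + 1) * 1 ≤ (2 * y1 + 1) * y^(1 - GG d) := mul_le_mul_of_nonneg_left hone (by linarith)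
    linarith
  · rcases hmin y hge h (by linarith) hh σ hσ0 hσ1 θ with h1 | ⟨q, a, β, hq, hθ, hqy, hβ⟩
    · linarith
    · have h2 := hmaj y hy h hh1 hh σ hσ0 hσ1 q a β hq hqy hβ
      have e : ∀ m : ℤ, (a:ℝ) * (m:ℝ)^d / ((d * q : ℕ):ℝ) + Ff d γ σ h β m = θ * (m:ℝ)^d + h * ((m:ℝ)+σ)^γ := by
        intro m
        have hd0 : (d:ℝ) ≠ 0 := by exact_mod_cast (by omega : d ≠ 0)
        have hq0 : (q:ℝ) ≠ 0 := by exact_mod_cast (by omega : q ≠ 0)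
        have : θ = (a / q + β) / d := by rw [← hθ]; field_simp
        rw [this, Ff]; push_cast; field_simp; ring
      simp only [e] at h2
      have h3 : C2 * y^(49/50:ℝ) ≤ C2 * y^(1 - GG d) := mul_le_mul_of_nonneg_left (Real.rpow_le_rpow_of_exponent_le hy (by linarith)) hC2.le
      linarith

def Bp (x : ℝ) : ℝ := Int.fract x ^ 2 - Int.fract x

lemma Bp_add_int (x : ℝ) (n : ℤ) : Bp (x + n) = Bp x := by simp [Bp]

lemma Bp_eq (x : ℝ) (h0 : 0 ≤ x) (h1 : x ≤ 1) : Bp x = x^2 - x := by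
  rcases eq_or_lt_of_le h1 with h | h
  · subst h; simp [Bp]
  · simp [Bp, Int.fract_eq_self.2 ⟨h0, h⟩]

lemma Bp_eq' (x : ℝ) (h0 : -1 ≤ x) (h1 : x ≤ 0) : Bp x = x^2 + x := by
  have := Bp_add_int x 1
  push_cast at this
  rw [← this, Bp_eq _ (by linarith) (by linarith)]; ring

lemma Bp_eq2 (x : ℝ) (h0 : 1 ≤ x) (h1 : x ≤ 2) : Bp x = (x-1)^2 - (x-1) := by
  have := Bp_add_int (x-1) 1
  push_cast at this
  rw [sub_add_cancel] at this
  rw [this, Bp_eq _ (by linarith) (by linarith)]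

lemma saw_point (x η : ℝ) (h0 : 0 < η) (h1 : η ≤ 1/4) :
    |psiSaw x - (Bp (x + η) - Bp x) / (2 * η)| ≤ 5 * η - (Bp (x + 2 * η) + Bp (x + -(2 * η)) - 2 * Bp x) / (2 * η) := by
  obtain ⟨t, n, ht, ht0, ht1⟩ : ∃ (t : ℝ) (n : ℤ), x = t + n ∧ 0 ≤ t ∧ t < 1 :=
    ⟨Int.fract x, ⌊x⌋, (Int.fract_add_floor x).symm, Int.fract_nonneg x, Int.fract_lt_one x⟩
  have hfl : ⌊x⌋ = n := by rw [ht, Int.floor_add_intCast, Int.floor_eq_zero_iff.2 ⟨ht0, ht1⟩, zero_add]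
  have hψ : psiSaw x = t - 1/2 := by rw [psiSaw, hfl, ht]; ring
  have hs : ∀ α, Bp (x + α) = Bp (t + α) := fun α => by rw [ht, show t + n + α = t + α + n by ring, Bp_add_int]
  have hx : Bp x = t^2 - t := by rw [ht, Bp_add_int, Bp_eq t ht0 ht1.le]
  rw [hψ, hs, hs, hs, hx]
  have key : |(t - 1/2) * (2 * η) - (Bp (t + η) - (t^2 - t))| ≤ 5 * η * (2 * η) - (Bp (t + 2 * η) + Bp (t + -(2 * η)) - 2 * (t^2 - t)) := by
    have k2 : ∀ z, 0 ≤ z → z ≤ 2 → Bp z = z^2 - z ∧ z ≤ 1 ∨ Bp z = (z-1)^2 - (z-1) ∧ 1 ≤ z := fun z a b => by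
      rcases le_total z 1 with h | h
      · exact Or.inl ⟨Bp_eq z a h, h⟩
      · exact Or.inr ⟨Bp_eq2 z h b, h⟩
    have k3 : ∀ z, -1 ≤ z → z ≤ 1 → Bp z = z^2 - z ∧ 0 ≤ z ∨ Bp z = z^2 + z ∧ z ≤ 0 := fun z a b => by
      rcases le_total 0 z with h | h
      · exact Or.inl ⟨Bp_eq z h b, h⟩
      · exact Or.inr ⟨Bp_eq' z a h, h⟩
    rcases k2 (t+η) (by linarith) (by linarith) with ⟨e1, f1⟩ | ⟨e1, f1⟩ <;>
    rcases k2 (t+2*η) (by linarith) (by linarith) with ⟨e2, f2⟩ | ⟨e2, f2⟩ <;>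
    rcases k3 (t+-(2*η)) (by linarith) (by linarith) with ⟨e3, f3⟩ | ⟨e3, f3⟩ <;>
    rw [e1, e2, e3, abs_le] <;> constructor <;> linarith [mul_pos h0 h0]
  have e1 : t - 1/2 - (Bp (t + η) - (t^2 - t)) / (2 * η) = ((t - 1/2) * (2 * η) - (Bp (t + η) - (t^2 - t))) / (2 * η) := by field_simp
  have e2 : 5 * η - (Bp (t + 2 * η) + Bp (t + -(2 * η)) - 2 * (t^2 - t)) / (2 * η) = (5 * η * (2 * η) - (Bp (t + 2 * η) + Bp (t + -(2 * η)) - 2 * (t^2 - t))) / (2 * η) := by field_simp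
  rw [e1, e2, abs_div, abs_of_pos (by linarith : 0 < 2 * η)]
  gcongr

lemma Bp_hasSum (x : ℝ) : HasSum (fun n : ℕ => 1 / (n : ℝ) ^ 2 * Real.cos (2 * π * n * x)) (π^2 * (Bp x + 1/6)) := by
  have h := hasSum_one_div_nat_pow_mul_cos one_ne_zero (x := Int.fract x) ⟨Int.fract_nonneg x, (Int.fract_lt_one x).le⟩
  convert h using 1
  · funext n
    norm_num
    left
    have : 2 * π * n * x = 2 * π * n * Int.fract x + ((n * ⌊x⌋ : ℤ):ℝ) * (2 * π) := by
      nth_rewrite 1 [← Int.fract_add_floor x]; push_cast; ring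
    rw [this, Real.cos_add_int_mul_two_pi]
  · have := bernoulliFun_two (Int.fract x)
    rw [bernoulliFun] at this
    rw [Bp]
    rw [show 2 * 1 = 2 from rfl, this, Nat.factorial_two]; push_cast; ring

lemma cos_eC (t α : ℝ) : ((Real.cos (2 * π * (t + α)) - Real.cos (2 * π * t) : ℝ) : ℂ) =
    ((eC α - 1) * eC t + (eC (-α) - 1) * eC (-t)) / 2 := by
  have h : ∀ t : ℝ, ((Real.cos (2 * π * t) : ℝ) : ℂ) = (eC t + eC (-t)) / 2 := by
    intro t
    rw [Complex.ofReal_cos, Complex.cos, eC, eC]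
    congr 3 <;> push_cast <;> ring
  rw [Complex.ofReal_sub, h, h, neg_add, eC_add, eC_add]; ring

lemma Bp_diff {ι : Type*} (s : Finset ι) (w : ι → ℂ) (x : ι → ℝ) (α K : ℝ) (H : ℕ) (hH : 1 ≤ H) (hK : 0 ≤ K)
    (hw : ∀ m ∈ s, ‖w m‖ ≤ 1)
    (hS : ∀ n : ℕ, 1 ≤ n → n ≤ H → ‖∑ m ∈ s, w m * eC (n * x m)‖ ≤ K ∧ ‖∑ m ∈ s, w m * eC (-(n * x m))‖ ≤ K) :
    ‖∑ m ∈ s, w m * ((Bp (x m + α) - Bp (x m) : ℝ) : ℂ)‖ ≤ |α| * K * (1 + Real.log H) + s.card / H := by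
  set f : ℕ → ℂ := fun n => ∑ m ∈ s, w m * ((1 / (n:ℝ)^2 * (Real.cos (2 * π * (n * x m + n * α)) - Real.cos (2 * π * (n * x m))) : ℝ) : ℂ) with hf
  have hsum : HasSum f (∑ m ∈ s, w m * ((π^2 * (Bp (x m + α) - Bp (x m)) : ℝ) : ℂ)) := by
    refine hasSum_sum fun m _ => HasSum.mul_left _ ?_
    rw [Complex.hasSum_ofReal]
    have := (Bp_hasSum (x m + α)).sub (Bp_hasSum (x m))
    rw [show π^2 * (Bp (x m + α) + 1/6) - π^2 * (Bp (x m) + 1/6) = π^2 * (Bp (x m + α) - Bp (x m)) by ring] at this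
    refine Eq.mp (congrArg (fun g => HasSum g _) (funext fun n => ?_)) this
    rw [← mul_sub, show 2 * π * n * (x m + α) = 2 * π * (n * x m + n * α) by ring, show 2 * π * n * x m = 2 * π * (n * x m) by ring]
  set c := 2 * π * |α| * K with hc
  have hc0 : 0 ≤ c := by positivity
  have fe : ∀ n : ℕ, f n = (1 / (n:ℂ)^2) * (((eC (n * α) - 1) * ∑ m ∈ s, w m * eC (n * x m) + (eC (-(n * α)) - 1) * ∑ m ∈ s, w m * eC (-(n * x m))) / 2) := by
    intro n
    rw [hf, Finset.mul_sum, Finset.mul_sum, ← Finset.sum_add_distrib, Finset.sum_div, Finset.mul_sum]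
    refine Finset.sum_congr rfl fun m _ => ?_
    rw [Complex.ofReal_mul, cos_eC]
    push_cast; ring
  have hb1 : ∀ n : ℕ, 1 ≤ n → n ≤ H → ‖f n‖ ≤ c * (n:ℝ)⁻¹ := by
    intro n h1 h2
    have n0 : (0:ℝ) < n := by exact_mod_cast h1
    obtain ⟨k1, k2⟩ := hS n h1 h2
    have l : ∀ t : ℝ, ‖eC t - 1‖ ≤ 2 * π * |t| := fun t => by
      have := eC_lip t 0
      rwa [eC_zero, sub_zero] at this
    have l1 := l (n * α)
    have l2 := l (-(n * α))
    rw [abs_neg] at l2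
    rw [abs_mul, Nat.abs_cast] at l1 l2
    rw [fe, norm_mul, norm_div, norm_div, norm_one, norm_pow, Complex.norm_natCast, Complex.norm_two]
    calc 1 / (n:ℝ)^2 * (‖(eC (n * α) - 1) * ∑ m ∈ s, w m * eC (n * x m) + (eC (-(n * α)) - 1) * ∑ m ∈ s, w m * eC (-(n * x m))‖ / 2)
        ≤ 1 / (n:ℝ)^2 * ((2 * π * (n * |α|) * K + 2 * π * (n * |α|) * K) / 2) := by
          gcongr
          refine (norm_add_le _ _).trans ?_
          rw [norm_mul, norm_mul]
          gcongr
      _ = c * (n:ℝ)⁻¹ := by rw [hc]; field_simp; ring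
  have hb2 : ∀ n : ℕ, ‖f n‖ ≤ 2 * s.card * (1 / (n:ℝ)^2) := by
    intro n
    calc ‖f n‖ ≤ ∑ m ∈ s, 2 * (1 / (n:ℝ)^2) := by
          refine (norm_sum_le _ _).trans (Finset.sum_le_sum fun m hm => ?_)
          rw [norm_mul, Complex.norm_real, norm_mul, Real.norm_of_nonneg (by positivity : 0 ≤ 1 / (n:ℝ)^2)]
          have : ‖Real.cos (2 * π * (n * x m + n * α)) - Real.cos (2 * π * (n * x m))‖ ≤ 2 := by
            rw [Real.norm_eq_abs, abs_le]
            constructor <;> linarith [Real.cos_le_one (2 * π * (n * x m + n * α)), Real.cos_le_one (2 * π * (n * x m)), Real.neg_one_le_cos (2 * π * (n * x m + n * α)), Real.neg_one_le_cos (2 * π * (n * x m))]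
          calc ‖w m‖ * (1 / (n:ℝ)^2 * ‖Real.cos (2 * π * (n * x m + n * α)) - Real.cos (2 * π * (n * x m))‖) ≤ 1 * (1 / (n:ℝ)^2 * 2) := by
                gcongr; exact hw m hm
            _ = _ := by ring
      _ = _ := by rw [Finset.sum_const, nsmul_eq_mul]; ring
  have h0 : ‖f 0‖ = 0 := by simp [hf]
  have hharm : ∑ n ∈ Finset.range (H+1), ‖f n‖ ≤ c * (1 + Real.log H) := by
    rw [Finset.sum_range_succ', h0, add_zero]
    have h1 := harmonic_le_one_add_log H
    rw [harmonic] at h1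
    push_cast at h1
    refine le_trans ?_ (mul_le_mul_of_nonneg_left h1 hc0)
    rw [Finset.mul_sum]
    refine Finset.sum_le_sum fun i hi => ?_
    have := hb1 (i+1) (by omega) (by have := Finset.mem_range.1 hi; omega)
    push_cast at this
    exact this
  have H0 : (0:ℝ) < H := by exact_mod_cast hH
  have htail : ∀ N : ℕ, ∑ n ∈ Finset.range (H+1+N), ‖f n‖ ≤ c * (1 + Real.log H) + 2 * s.card * (1 / H - 1 / (H + N)) := by
    intro N
    induction N with
    | zero => simpa using hharm
    | succ N ih =>
      rw [← Nat.add_assoc, Finset.sum_range_succ]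
      have h1 := hb2 (H+1+N)
      have h2 : 1 / ((H+1+N : ℕ):ℝ)^2 ≤ 1 / (H + N) - 1 / (H + (N + 1 : ℕ)) := by
        push_cast
        rw [div_sub_div _ _ (by positivity) (by positivity), div_le_div_iff₀ (by positivity) (by positivity)]
        have : (0:ℝ) ≤ H + N := by positivity
        nlinarith
      have h3 := mul_le_mul_of_nonneg_left h2 (by positivity : (0:ℝ) ≤ 2 * s.card)
      linarith
  have hfin : ‖∑ m ∈ s, w m * ((π^2 * (Bp (x m + α) - Bp (x m)) : ℝ) : ℂ)‖ ≤ c * (1 + Real.log H) + 2 * s.card / H := by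
    have ht := ((hsum.tendsto_sum_nat).comp (Filter.tendsto_add_atTop_nat (H+1))).norm
    refine le_of_tendsto ht (Filter.Eventually.of_forall fun N => ?_)
    refine (norm_sum_le _ _).trans ?_
    change ∑ i ∈ Finset.range (N + (H+1)), ‖f i‖ ≤ _
    rw [Nat.add_comm N]
    refine (htail N).trans ?_
    have : (0:ℝ) ≤ 2 * s.card * (1 / (H + N)) := by positivity
    have e : (2 * s.card / H : ℝ) = 2 * s.card * (1 / H) := by ring
    rw [e]; linarith
  have hpi : ∑ m ∈ s, w m * ((π^2 * (Bp (x m + α) - Bp (x m)) : ℝ) : ℂ) = ((π^2:ℝ):ℂ) * ∑ m ∈ s, w m * ((Bp (x m + α) - Bp (x m) : ℝ) : ℂ) := by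
    rw [Finset.mul_sum]
    refine Finset.sum_congr rfl fun m _ => ?_
    push_cast; ring
  rw [hpi, norm_mul, Complex.norm_real, Real.norm_of_nonneg (by positivity)] at hfin
  have p3 := Real.pi_gt_three
  refine le_of_mul_le_mul_left (hfin.trans ?_) (by positivity : 0 < π^2)
  have L0 : 0 ≤ 1 + Real.log H := by linarith [Real.log_nonneg (by exact_mod_cast hH : (1:ℝ) ≤ H)]
  have q1 : 2 * π * (|α| * K * (1 + Real.log H)) ≤ π^2 * (|α| * K * (1 + Real.log H)) := by
    refine mul_le_mul_of_nonneg_right (by nlinarith) (by positivity)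
  have q2 : 2 * (s.card / H : ℝ) ≤ π^2 * (s.card / H) := by
    refine mul_le_mul_of_nonneg_right (by nlinarith) (by positivity)
  rw [hc, mul_div_assoc]; linarith

lemma saw_sum {ι : Type*} (s : Finset ι) (w : ι → ℂ) (x : ι → ℝ) (η K : ℝ) (H : ℕ) (hH : 1 ≤ H) (hK : 0 ≤ K) (h0 : 0 < η) (h1 : η ≤ 1/4)
    (hw : ∀ m ∈ s, ‖w m‖ ≤ 1)
    (hS : ∀ n : ℕ, 1 ≤ n → n ≤ H → ‖∑ m ∈ s, w m * eC (n * x m)‖ ≤ K ∧ ‖∑ m ∈ s, w m * eC (-(n * x m))‖ ≤ K)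
    (hS1 : ∀ n : ℕ, 1 ≤ n → n ≤ H → ‖∑ m ∈ s, eC (n * x m)‖ ≤ K) :
    ‖∑ m ∈ s, w m * ((psiSaw (x m) : ℝ):ℂ)‖ ≤ 5 * η * s.card + 3 * K * (1 + Real.log H) + 2 * s.card / (η * H) := by
  have L0 : 0 ≤ 1 + Real.log H := by linarith [Real.log_nonneg (by exact_mod_cast hH : (1:ℝ) ≤ H)]
  have H0 : (0:ℝ) < H := by exact_mod_cast hH
  have a1 := Bp_diff s w x η K H hH hK hw hS
  have hS1' : ∀ n : ℕ, 1 ≤ n → n ≤ H → ‖∑ m ∈ s, (1:ℂ) * eC (n * x m)‖ ≤ K ∧ ‖∑ m ∈ s, (1:ℂ) * eC (-(n * x m))‖ ≤ K := by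
    intro n b1 b2
    simp only [one_mul]
    refine ⟨hS1 n b1 b2, ?_⟩
    simp only [eC_neg]
    rw [← map_sum, RCLike.norm_conj]
    exact hS1 n b1 b2
  have a2 := Bp_diff s (fun _ => 1) x (2*η) K H hH hK (by simp) hS1'
  have a3 := Bp_diff s (fun _ => 1) x (-(2*η)) K H hH hK (by simp) hS1'
  simp only [one_mul, ← Complex.ofReal_sum, Complex.norm_real, Real.norm_eq_abs] at a2 a3
  rw [abs_neg] at a3
  rw [abs_of_pos (by linarith : 0 < 2 * η)] at a2 a3
  rw [abs_of_pos h0] at a1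
  have b2 := neg_le_of_abs_le a2
  have b3 := neg_le_of_abs_le a3
  have e : ∑ m ∈ s, w m * ((psiSaw (x m) : ℝ):ℂ) = ∑ m ∈ s, w m * ((psiSaw (x m) - (Bp (x m + η) - Bp (x m)) / (2 * η) : ℝ):ℂ)
      + ((1 / (2 * η) : ℝ):ℂ) * ∑ m ∈ s, w m * ((Bp (x m + η) - Bp (x m) : ℝ) : ℂ) := by
    rw [Finset.mul_sum, ← Finset.sum_add_distrib]
    refine Finset.sum_congr rfl fun m _ => ?_
    push_cast; ring
  have f1 : ‖∑ m ∈ s, w m * ((psiSaw (x m) - (Bp (x m + η) - Bp (x m)) / (2 * η) : ℝ):ℂ)‖ ≤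
      5 * η * s.card - 1 / (2 * η) * (∑ m ∈ s, (Bp (x m + 2 * η) - Bp (x m)) + ∑ m ∈ s, (Bp (x m + -(2 * η)) - Bp (x m))) := by
    calc _ ≤ ∑ m ∈ s, (5 * η - (Bp (x m + 2 * η) + Bp (x m + -(2 * η)) - 2 * Bp (x m)) / (2 * η)) := by
          refine (norm_sum_le _ _).trans (Finset.sum_le_sum fun m hm => ?_)
          rw [norm_mul, Complex.norm_real, Real.norm_eq_abs]
          exact (mul_le_of_le_one_left (abs_nonneg _) (hw m hm)).trans (saw_point (x m) η h0 h1)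
      _ = _ := by
        rw [← Finset.sum_add_distrib, Finset.mul_sum, Finset.sum_sub_distrib, Finset.sum_const, nsmul_eq_mul]
        congr 1
        · ring
        · refine Finset.sum_congr rfl fun m _ => ?_
          ring
  rw [e]
  refine (norm_add_le _ _).trans ?_
  rw [norm_mul, Complex.norm_real, Real.norm_of_nonneg (by positivity)]
  have p : 0 < 1 / (2 * η) := by positivity
  have g1 := mul_le_mul_of_nonneg_left a1 p.le
  have g2 := mul_le_mul_of_nonneg_left (add_le_add b2 b3) p.le
  have e2 : 1 / (2 * η) * (η * K * (1 + Real.log H) + s.card / H) + 1 / (2 * η) * (2 * (2 * η * K * (1 + Real.log H) + s.card / H))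
     = 5/2 * (K * (1 + Real.log H)) + 3/2 * (s.card / (η * H)) := by
    field_simp; ring
  have q1 : 0 ≤ K * (1 + Real.log H) := by positivity
  have q2 : (0:ℝ) ≤ s.card / (η * H) := by positivity
  rw [mul_div_assoc]
  linarith

lemma saw_key (d : ℕ) (hd : 4 ≤ d) (γ : ℝ) (hγ0 : 49/50 ≤ γ) (hγ1 : γ < 1) : ∃ C : ℝ, 0 < C ∧ ∀ y : ℝ, 1 ≤ y →
    ∀ σ : ℝ, 0 ≤ σ → σ ≤ 1 → ∀ θ : ℝ,
    ‖∑ m ∈ Finset.Ioc ⌊y⌋ ⌊2*y⌋, eC ((m:ℝ)^d * θ) * ((psiSaw (-(((m:ℝ)+σ)^γ)) : ℝ):ℂ)‖ ≤ C * y^(1 - GG d) * (1 + Real.log y) := by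
  obtain ⟨C, hC, hkey⟩ := key d hd γ hγ0 hγ1
  refine ⟨3 * C + 35, by linarith, ?_⟩
  intro y hy σ hσ0 hσ1 θ
  have y0 : 0 < y := by linarith
  have hG := GG_le d hd
  have hG0 := GG_pos d hd
  have hyG : 1 ≤ y^(2 * GG d) := Real.one_le_rpow hy (by linarith)
  set H := ⌊y^(2 * GG d)⌋₊ with hHdef
  have hH : 1 ≤ H := Nat.one_le_floor_iff _ |>.2 hyG
  have hH1 : (H:ℝ) ≤ y^(2 * GG d) := Nat.floor_le (by positivity)
  have hH2 : y^(2 * GG d) / 2 ≤ H := by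
    have := Nat.lt_floor_add_one (y^(2 * GG d))
    have h3 : (1:ℝ) ≤ H := by exact_mod_cast hH
    linarith
  set K := C * y^(1 - GG d) with hK
  have hconj : ∀ (θ : ℝ) (n : ℕ), 1 ≤ n → n ≤ H → ‖∑ m ∈ Finset.Ioc ⌊y⌋ ⌊2*y⌋, eC (θ * (m:ℝ)^d + n * ((m:ℝ)+σ)^γ)‖ ≤ K := fun θ n h1 h2 =>
    hkey y hy n (by exact_mod_cast h1) (le_trans (by exact_mod_cast h2) hH1) σ hσ0 hσ1 θ
  have hconj2 : ∀ (θ : ℝ) (n : ℕ), 1 ≤ n → n ≤ H → ‖∑ m ∈ Finset.Ioc ⌊y⌋ ⌊2*y⌋, eC (-(θ * (m:ℝ)^d + n * ((m:ℝ)+σ)^γ))‖ ≤ K := by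
    intro θ n h1 h2
    simp only [eC_neg]
    rw [← map_sum, RCLike.norm_conj]
    exact hconj θ n h1 h2
  set η := y^(-GG d) / 4 with hη
  have hη0 : 0 < η := by positivity
  have hη1 : η ≤ 1/4 := by
    have : y^(-GG d) ≤ 1 := Real.rpow_le_one_of_one_le_of_nonpos hy (by linarith)
    rw [hη]; linarith
  have hmain := saw_sum (Finset.Ioc ⌊y⌋ ⌊2*y⌋) (fun m => eC ((m:ℝ)^d * θ)) (fun m => -(((m:ℝ)+σ)^γ)) η K H hH (by positivity) hη0 hη1
    (fun m _ => (eC_norm _).le) (fun n h1 h2 => by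
      constructor
      · convert hconj2 (-θ) n h1 h2 using 4 with m
        rw [← eC_add]; congr 1; ring
      · convert hconj θ n h1 h2 using 4 with m
        rw [← eC_add]; congr 1; ring) (fun n h1 h2 => by
      convert hconj2 0 n h1 h2 using 4 with m
      ring)
  refine hmain.trans ?_
  have hcard : ((Finset.Ioc ⌊y⌋ ⌊2*y⌋).card : ℝ) ≤ 2 * y := by
    rw [Int.card_Ioc]
    have h1 : ⌊y⌋ ≤ ⌊2*y⌋ := Int.floor_le_floor (by linarith)
    have h2 : (((⌊2*y⌋ - ⌊y⌋).toNat : ℤ):ℝ) = ((⌊2*y⌋ - ⌊y⌋ : ℤ):ℝ) := by rw [Int.toNat_of_nonneg (by omega)]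
    rw [Int.cast_natCast] at h2
    rw [h2]; push_cast
    have h3 := Int.floor_le (2*y)
    have h4 := Int.lt_floor_add_one y
    linarith
  have hlog : Real.log H ≤ Real.log y := by
    refine Real.log_le_log (by exact_mod_cast hH) (hH1.trans ?_)
    nth_rewrite 2 [← Real.rpow_one y]
    exact Real.rpow_le_rpow_of_exponent_le hy (by linarith)
  have hlog0 : 0 ≤ Real.log y := Real.log_nonneg hy
  set Z := y^(1 - GG d) with hZ
  have hZ0 : 0 < Z := by positivity
  have eZ : y * y^(-GG d) = Z := by
    rw [hZ, ← Real.rpow_one_add' y0.le (by linarith)]; rfl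
  have t1 : 5 * η * ((Finset.Ioc ⌊y⌋ ⌊2*y⌋).card : ℝ) ≤ 3 * Z := by
    calc _ ≤ 5 * η * (2 * y) := by gcongr
      _ = 5/2 * (y * y^(-GG d)) := by rw [hη]; ring
      _ ≤ _ := by rw [eZ]; linarith
  have t2 : 3 * K * (1 + Real.log H) ≤ 3 * K * (1 + Real.log y) := by gcongr
  have t3 : 2 * ((Finset.Ioc ⌊y⌋ ⌊2*y⌋).card : ℝ) / (η * H) ≤ 32 * Z := by
    have e : η * (y^(2 * GG d) / 2) * 8 = y^(GG d) := by
      have : y^(-GG d) * y^(2 * GG d) = y^(GG d) := by rw [← Real.rpow_add y0]; congr 1; ring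
      rw [hη, ← this]; ring
    have e2 : Z * y^(GG d) = y := by rw [hZ, ← Real.rpow_add y0]; simp
    rw [div_le_iff₀ (by positivity)]
    calc 2 * ((Finset.Ioc ⌊y⌋ ⌊2*y⌋).card : ℝ) ≤ 2 * (2 * y) := by gcongr
      _ = 32 * Z * (η * (y^(2 * GG d) / 2)) := by nth_rewrite 1 [← e2]; rw [← e]; ring
      _ ≤ _ := by gcongr
  have t4 : 35 * Z * 1 ≤ 35 * Z * (1 + Real.log y) := by gcongr; linarith
  rw [hK] at t2 ⊢
  linarith

lemma expo (k c G : ℝ) (hk : 0 < k) (hk1 : k < 1) (hG : 2 * k ≤ G * (1 + k)) (hc1 : 1 < c) (hc : c < 1 + 2 * k / (1 - k)) :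
    1 - G ≤ (1 + c) / 2 * (1 - k) / c ∧ 1 - G ≤ 1 / c := by
  have c0 : 0 < c := by linarith
  have h1 : c * (1 - k) ≤ 1 + k := by
    have : 1 + 2 * k / (1 - k) = (1 + k) / (1 - k) := by
      have : 1 - k ≠ 0 := by linarith
      field_simp; ring
    rw [this, lt_div_iff₀ (by linarith)] at hc
    exact hc.le
  have h2 : (1 - G) * (1 + k) ≤ 1 - k := by linarith
  have h3 : (1 - G) * (1 + k) * c ≤ 1 + k := (mul_le_mul_of_nonneg_right h2 c0.le).trans (by linarith)
  have h4 : (1 - G) * c ≤ 1 := by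
    refine le_of_mul_le_mul_right (a := 1 + k) ?_ (by linarith)
    linarith
  constructor
  · rw [le_div_iff₀ c0]
    refine le_of_mul_le_mul_right (a := 1 + k) ?_ (by linarith)
    have h5 : (1 - G) * (1 + k) * c ≤ (1 - k) * c := mul_le_mul_of_nonneg_right h2 c0.le
    have h6 : c * (1 - k) * (1 - k) ≤ (1 + k) * (1 - k) := mul_le_mul_of_nonneg_right h1 (by linarith)
    nlinarith
  · rw [le_div_iff₀ c0]; exact h4

lemma expo_d (d : ℕ) (hd : 4 ≤ d) (c : ℝ) (hc1 : 1 < c) (hc2 : c < 1 + c3ps d) :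
    1 - GG d ≤ θdc d c / c ∧ 1 - GG d ≤ 1 / c := by
  have hd4 : (4:ℝ) ≤ d := by exact_mod_cast hd
  have main : ∀ D : ℝ, 1 < D → 5 * d * (d + 1) ≤ D + 1 → ∀ k, k = 1 / D → c < 1 + 2 * k / (1 - k) →
      1 - GG d ≤ (1 + c) / 2 * (1 - k) / c ∧ 1 - GG d ≤ 1 / c := by
    intro D hD1 hD2 k hk hc
    refine expo k c (GG d) (by rw [hk]; positivity) (by rw [hk, div_lt_one (by linarith)]; exact hD1) ?_ hc1 hc
    have D0 : 0 < D := by linarith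
    rw [hk, GG, div_mul_eq_mul_div, le_div_iff₀ (by positivity)]
    have e : 2 * (1 + 1 / D) = 2 * (D + 1) / D := by field_simp
    rw [e, le_div_iff₀ D0]
    have e2 : 2 * (1 / D) * (5 * d * (d + 1)) * D = 2 * (5 * d * (d + 1)) := by field_simp
    rw [e2]; linarith
  have h2 : d ≠ 2 := by omega
  have h3 : d ≠ 3 := by omega
  rw [c3ps] at hc2
  rw [θdc, if_neg h2, if_neg h3]
  split_ifs at hc2 ⊢ with h11 hev
  · refine main (d * (d+1)^2 - 1) ?_ ?_ _ rfl hc2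
    · nlinarith [mul_le_mul hd4 (by nlinarith : (4:ℝ) ≤ (d+1)^2) (by norm_num) (by linarith)]
    nlinarith [mul_nonneg (by positivity : (0:ℝ) ≤ d * (d+1)) (by linarith : (0:ℝ) ≤ d - 4)]
  · refine main ((27 * d^2 - 14)/2) (by nlinarith) (by nlinarith) _ ?_ hc2
    rw [kD, one_div_div]
  · refine main ((27 * d^2 - 5)/2) (by nlinarith) (by nlinarith) _ ?_ hc2
    rw [lD, one_div_div]

theorem final_bd (d : ℕ) (hd : 4 ≤ d) (c : ℝ) (hc1 : 1 < c) (hc2 : c < 1 + c3ps d)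
    (ε : ℝ) (hε : 0 < ε) :
    ∃ C : ℝ, 0 < C ∧ ∀ θ : ℝ, 0 ≤ θ → θ < 1 → ∀ y : ℝ, 2 ≤ y →
      ‖∑ m ∈ Finset.Ioc ⌊y⌋ ⌊2 * y⌋,
          eC ((m : ℝ) ^ d * θ) * ((deltaPsi c (m : ℝ) : ℝ) : ℂ)‖ ≤
        C * y ^ (θdc d c / c + ε) := by
  obtain ⟨hE, hγ⟩ := expo_d d hd c hc1 hc2
  have hG := GG_le d hd
  obtain ⟨C, hC, hkey⟩ := saw_key d hd (1/c) (by linarith) (by rw [div_lt_one (by linarith)]; exact hc1)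
  refine ⟨2 * C * (1 + 1/ε), by positivity, ?_⟩
  intro θ _ _ y hy
  have y0 : 0 < y := by linarith
  have hy1 : 1 ≤ y := by linarith
  have k0 := hkey y hy1 0 le_rfl zero_le_one θ
  have k1 := hkey y hy1 1 zero_le_one le_rfl θ
  simp only [add_zero] at k0
  have e : ∑ m ∈ Finset.Ioc ⌊y⌋ ⌊2 * y⌋, eC ((m : ℝ) ^ d * θ) * ((deltaPsi c (m : ℝ) : ℝ) : ℂ) =
    ∑ m ∈ Finset.Ioc ⌊y⌋ ⌊2 * y⌋, eC ((m : ℝ) ^ d * θ) * ((psiSaw (-(((m:ℝ)+1)^(1/c))) : ℝ):ℂ) -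
    ∑ m ∈ Finset.Ioc ⌊y⌋ ⌊2 * y⌋, eC ((m : ℝ) ^ d * θ) * ((psiSaw (-((m:ℝ)^(1/c))) : ℝ):ℂ) := by
    rw [← Finset.sum_sub_distrib]
    refine Finset.sum_congr rfl fun m _ => ?_
    rw [deltaPsi, Complex.ofReal_sub]; ring
  rw [e]
  refine (norm_sub_le _ _).trans ((add_le_add k1 k0).trans ?_)
  have hl : Real.log y ≤ y^ε / ε := Real.log_le_rpow_div y0.le hε
  have h1 : 1 ≤ y^ε := Real.one_le_rpow hy1 hε.le
  have hL : 1 + Real.log y ≤ (1 + 1/ε) * y^ε := by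
    rw [add_mul, one_mul, one_div_mul_eq_div]; linarith
  have hyE : y^(1 - GG d) ≤ y^(θdc d c / c) := Real.rpow_le_rpow_of_exponent_le hy1 hE
  have hlog0 : 0 ≤ Real.log y := Real.log_nonneg hy1
  calc C * y^(1 - GG d) * (1 + Real.log y) + C * y^(1 - GG d) * (1 + Real.log y) = 2 * C * (y^(1 - GG d) * (1 + Real.log y)) := by ring
    _ ≤ 2 * C * (y^(θdc d c / c) * ((1 + 1/ε) * y^ε)) := by gcongr
    _ = _ := by rw [Real.rpow_add y0]; ring

/-- for `d ≥ 4` and `c ∈ (1, 1+c₃(d))`, uniformly in `θ ∈ [0,1)`,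
`∑_{y<m≤2y} e(m^d θ) Δψ(m) ≪ y^{θ(d,c)/c+ε}` for all `y ≥ 2`. -/
theorem stmt11 (d : ℕ) (hd : 4 ≤ d) (c : ℝ) (hc1 : 1 < c) (hc2 : c < 1 + c3ps d)
    (ε : ℝ) (hε : 0 < ε) :
    ∃ C : ℝ, 0 < C ∧ ∀ θ : ℝ, 0 ≤ θ → θ < 1 → ∀ y : ℝ, 2 ≤ y →
      ‖∑ m ∈ Finset.Ioc ⌊y⌋ ⌊2 * y⌋,
          eC ((m : ℝ) ^ d * θ) * ((deltaPsi c (m : ℝ) : ℝ) : ℂ)‖ ≤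
        C * y ^ (θdc d c / c + ε) := by
  exact final_bd d hd c hc1 hc2 ε hε
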